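/- Fix p > 2 and let (ω,u) be a smooth solution of the vorticity form of the 2D incompressible Euler equations on ℍ with nonnegative, compactly supported, not identically zero initial vorticity ω₀ = ω(0,·). Define ω̃(t,y) = t² ω(t, ty), and suppose that as t → ∞ the measures ω̃(t,·) converge weak-* to μ ⊗ δ₀ for a single finite nonnegative measure μ on ℝ, i.e. ∫_ℍ φ(y) ω̃(t,y) dy → ∫_ℝ φ(s,0) dμ(s) for every bounded continuous φ on the closed half-plane. Then μ = Σ_{i=1}^∞ m_i δ_{α_i}, where: (1) the α_i are distinct and α_i → 0 as i → ∞; (2) the masses m_i are nonnegative and Σ_i m_i = ‖ω₀‖_{L¹}; (3) every α_i lies in [0,M] where M = ‖u‖_{L^∞([0,∞)×ℍ)}; (4) there exists a constant D > 0 depending only on p such that α_i ≤ D · ‖ω₀‖_{L^p}^{p′/2} · m_i^{1 − p′/2} for every i with m_i ≠ 0; and (5) there exists an index i₀ with α_{i₀} ≠ 0 and m_{i₀} ≠ 0. -/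

import Mathlib

open MeasureTheory

/-- The Euclidean norm on `ℝ × ℝ`. -/
noncomputable def nrm (z : ℝ × ℝ) : ℝ := Real.sqrt (z.1 ^ 2 + z.2 ^ 2)

/-- The upper half-plane `ℍ = {x ∈ ℝ² : x₂ > 0}`. -/
def Hplane : Set (ℝ × ℝ) := {x | 0 < x.2}

/-- Reflection `x̄ = (x₁, -x₂)`. -/
def pbar (z : ℝ × ℝ) : ℝ × ℝ := (z.1, -z.2)

/-- Perpendicular vector `z^⊥ = (-z₂, z₁)`. -/
def perp (z : ℝ × ℝ) : ℝ × ℝ := (-z.2, z.1)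

/-- The half-plane Biot–Savart kernel
`K(x,y) = (x-y)^⊥/(2π|x-y|²) - (x-ȳ)^⊥/(2π|x-ȳ|²)`. -/
noncomputable def Kker (x y : ℝ × ℝ) : ℝ × ℝ :=
  (2 * Real.pi * nrm (x - y) ^ 2)⁻¹ • perp (x - y) -
    (2 * Real.pi * nrm (x - pbar y) ^ 2)⁻¹ • perp (x - pbar y)

/-- A smooth solution of the vorticity form of the 2D incompressible Euler
equations on the half-plane `ℍ`: `ω` is smooth, compactly supported in `ℍ`
at each time, transported by the velocity `u` recovered from `ω` by the
half-plane Biot–Savart law. -/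
structure IsEulerSol (ω : ℝ → ℝ × ℝ → ℝ) (u : ℝ → ℝ × ℝ → ℝ × ℝ) : Prop where
  smooth : ContDiff ℝ (⊤ : ℕ∞) (fun q : ℝ × (ℝ × ℝ) => ω q.1 q.2)
  compactSupp : ∀ t, HasCompactSupport (ω t)
  suppIn : ∀ t, tsupport (ω t) ⊆ Hplane
  biotSavart : ∀ t x, u t x = ∫ y in Hplane, ω t y • Kker x y
  transport : ∀ t, 0 ≤ t → ∀ x ∈ Hplane,
    deriv (fun s => ω s x) t + fderiv ℝ (ω t) x (u t x) = 0

open Filter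

/-- The rescaled vorticity `ω̃(t,y) = t² ω(t, ty)`. -/
noncomputable def rescVort (ω : ℝ → ℝ × ℝ → ℝ) (t : ℝ) (y : ℝ × ℝ) : ℝ :=
  t ^ 2 * ω t (t • y)

namespace HalfPlane
open MeasureTheory Filter Set Metric Function Topology

/-! ### Integrability of powers of the norm in the plane -/

lemma finrank_plane : Module.finrank ℝ (ℝ × ℝ) = 2 := by simp

lemma integrableOn_norm_rpow_ball {q : ℝ} (hq : q < 2) (ρ : ℝ) :
    IntegrableOn (fun z : ℝ × ℝ => ‖z‖ ^ (-q)) (ball 0 ρ) := by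
  refine integrableOn_ball_of_norm_le_rpow (C := 1) (α := q) (by simp) (by simpa using hq)
    (Eventually.of_forall fun z => ?_) (Measurable.aestronglyMeasurable (by fun_prop))
  rw [Real.norm_of_nonneg (by positivity), one_mul]

lemma setIntegral_norm_rpow_ball {q ρ : ℝ} (hq : q < 2) (hρ : 0 < ρ) :
    ∫ z in ball (0 : ℝ × ℝ) ρ, ‖z‖ ^ (-q) =
      2 * volume.real (ball (0 : ℝ × ℝ) 1) * (ρ ^ (2 - q) / (2 - q)) := by
  have h := integral_fun_norm_addHaar (volume : Measure (ℝ × ℝ))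
    ((Iio ρ).indicator fun r : ℝ => r ^ (-q))
  have e1 : (fun z : ℝ × ℝ => (Iio ρ).indicator (fun r : ℝ => r ^ (-q)) ‖z‖) =
      (ball (0 : ℝ × ℝ) ρ).indicator fun z => ‖z‖ ^ (-q) := by
    ext z
    simp [indicator]
  rw [e1, integral_indicator measurableSet_ball] at h
  rw [h, finrank_plane]
  have e2 : ∫ y in Ioi (0 : ℝ), y ^ (2 - 1) • (Iio ρ).indicator (fun r : ℝ => r ^ (-q)) y =
      ∫ y in Ioi (0 : ℝ), (Iio ρ).indicator (fun r : ℝ => r ^ (1 - q)) y := by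
    refine setIntegral_congr_fun measurableSet_Ioi fun y hy => ?_
    by_cases hyρ : y < ρ
    · simp only [indicator, mem_Iio, hyρ, if_true, smul_eq_mul]
      rw [sub_eq_add_neg 1 q, Real.rpow_add hy]
      simp
    · simp [indicator, hyρ]
  rw [e2, setIntegral_indicator measurableSet_Iio, Ioi_inter_Iio,
    ← integral_Ioc_eq_integral_Ioo, ← intervalIntegral.integral_of_le hρ.le,
    integral_rpow (Or.inl (by linarith))]
  rw [Real.zero_rpow (by linarith)]
  simp only [nsmul_eq_mul, smul_eq_mul]
  rw [show (1 - q + 1) = 2 - q by ring, sub_zero]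
  push_cast
  ring

/-- A bounded integrable function integrates against `‖x - ·‖ ^ (-q)`, `0 ≤ q < 2`. -/
lemma integrable_mul_norm_rpow {q : ℝ} (hq0 : 0 ≤ q) (hq : q < 2) {w : ℝ × ℝ → ℝ} {W : ℝ}
    (hw : Integrable w) (hW : ∀ y, |w y| ≤ W) (x : ℝ × ℝ) :
    Integrable (fun y => |w y| * ‖x - y‖ ^ (-q)) ∧
      ∫ y, |w y| * ‖x - y‖ ^ (-q) ≤
        (∫ z in ball (0 : ℝ × ℝ) 1, ‖z‖ ^ (-q)) * W + ∫ y, |w y| := by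
  have hI := (integrable_indicator_iff measurableSet_ball).2 (integrableOn_norm_rpow_ball hq 1)
  have hb : ∀ y, |w y| * ‖x - y‖ ^ (-q) ≤
      (ball (0 : ℝ × ℝ) 1).indicator (fun z => ‖z‖ ^ (-q)) (x - y) * W + |w y| := by
    intro y
    by_cases hy : x - y ∈ ball (0 : ℝ × ℝ) 1
    · rw [indicator_of_mem hy]
      have : |w y| * ‖x - y‖ ^ (-q) ≤ W * ‖x - y‖ ^ (-q) := by
        gcongr
        exact hW y
      linarith [abs_nonneg (w y)]
    · rw [indicator_of_notMem hy]
      rw [mem_ball_zero_iff, not_lt] at hy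
      have : ‖x - y‖ ^ (-q) ≤ 1 := Real.rpow_le_one_of_one_le_of_nonpos hy (by linarith)
      have := mul_le_mul_of_nonneg_left this (abs_nonneg (w y))
      linarith
  have hR : Integrable fun y =>
      (ball (0 : ℝ × ℝ) 1).indicator (fun z => ‖z‖ ^ (-q)) (x - y) * W + |w y| :=
    ((hI.comp_sub_left x).mul_const W).add hw.abs
  have hL : Integrable (fun y => |w y| * ‖x - y‖ ^ (-q)) := by
    refine hR.mono' (hw.abs.aestronglyMeasurable.mul ?_) (Eventually.of_forall fun y => ?_)
    · exact (Measurable.aestronglyMeasurable (by fun_prop))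
    · rw [Real.norm_of_nonneg (by positivity)]
      exact hb y
  refine ⟨hL, (integral_mono hL hR hb).trans ?_⟩
  rw [integral_add ((hI.comp_sub_left x).mul_const W) hw.abs, integral_mul_const,
    integral_sub_left_eq_self (fun z => (ball (0 : ℝ × ℝ) 1).indicator (fun z => ‖z‖ ^ (-q)) z),
    integral_indicator measurableSet_ball]

/-- The Riesz-type kernel `‖x - y‖ ^ (-q)` is integrable against a product of bounded
integrable functions. -/
lemma integrable_prod_norm_rpow {q : ℝ} (hq0 : 0 ≤ q) (hq : q < 2) {A B : ℝ × ℝ → ℝ} {W : ℝ}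
    (hA : Integrable A) (hB : Integrable B) (hW : ∀ y, |B y| ≤ W) :
    Integrable (fun z : (ℝ × ℝ) × (ℝ × ℝ) => |A z.1| * |B z.2| * ‖z.1 - z.2‖ ^ (-q)) := by
  rw [show (volume : Measure ((ℝ × ℝ) × (ℝ × ℝ))) = (volume : Measure (ℝ × ℝ)).prod volume from rfl]
  have hm : AEStronglyMeasurable
      (fun z : (ℝ × ℝ) × (ℝ × ℝ) => |A z.1| * |B z.2| * ‖z.1 - z.2‖ ^ (-q))
      ((volume : Measure (ℝ × ℝ)).prod volume) := by
    refine ((hA.abs.aestronglyMeasurable.comp_fst).mul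
      (hB.abs.aestronglyMeasurable.comp_snd)).mul ?_
    exact Measurable.aestronglyMeasurable (by fun_prop)
  rw [integrable_prod_iff hm]
  refine ⟨Eventually.of_forall fun x => ?_, ?_⟩
  · simp only [mul_assoc]
    exact ((integrable_mul_norm_rpow hq0 hq hB hW x).1).const_mul _
  · refine Integrable.mono' (hA.abs.mul_const
      ((∫ z in ball (0 : ℝ × ℝ) 1, ‖z‖ ^ (-q)) * W + ∫ y, |B y|)) ?_
      (Eventually.of_forall fun x => ?_)
    · exact hm.norm.integral_prod_right'
    · rw [Real.norm_of_nonneg (integral_nonneg fun y => norm_nonneg _)]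
      have : (fun y => ‖|A x| * |B y| * ‖x - y‖ ^ (-q)‖) =
          fun y => |A x| * (|B y| * ‖x - y‖ ^ (-q)) := by
        ext y
        rw [Real.norm_of_nonneg (by positivity), mul_assoc]
      rw [this, integral_const_mul]
      exact mul_le_mul_of_nonneg_left (integrable_mul_norm_rpow hq0 hq hB hW x).2 (abs_nonneg _)

/-- The diagonal of the plane is a null set. -/
lemma ae_fst_ne_snd : ∀ᵐ z : (ℝ × ℝ) × (ℝ × ℝ), z.1 ≠ z.2 := by
  rw [show (volume : Measure ((ℝ × ℝ) × (ℝ × ℝ))) = (volume : Measure (ℝ × ℝ)).prod volume from rfl,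
    ae_iff]
  have hd : MeasurableSet {z : (ℝ × ℝ) × (ℝ × ℝ) | ¬ z.1 ≠ z.2} := by
    have : {z : (ℝ × ℝ) × (ℝ × ℝ) | ¬ z.1 ≠ z.2} = diagonal (ℝ × ℝ) := by
      ext z
      simp
    rw [this]
    exact measurableSet_diagonal
  rw [Measure.measure_prod_null hd]
  refine Eventually.of_forall fun x => ?_
  have : Prod.mk x ⁻¹' {z : (ℝ × ℝ) × (ℝ × ℝ) | ¬ z.1 ≠ z.2} = {x} := by
    ext y
    simp [eq_comm]
  change volume (Prod.mk x ⁻¹' {z : (ℝ × ℝ) × (ℝ × ℝ) | ¬ z.1 ≠ z.2}) = 0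
  rw [this]
  simp

end HalfPlane

namespace HalfPlane
open MeasureTheory Filter Set Metric Function Topology

/-! ### The Biot–Savart kernel -/

/-- The full-plane Biot–Savart kernel `z^⊥ / (2π|z|²)`. -/
noncomputable def planeKer (z : ℝ × ℝ) : ℝ × ℝ := (2 * Real.pi * nrm z ^ 2)⁻¹ • perp z

lemma Kker_eq (x y : ℝ × ℝ) : Kker x y = planeKer (x - y) - planeKer (x - pbar y) := rfl

lemma nrm_sq (z : ℝ × ℝ) : nrm z ^ 2 = z.1 ^ 2 + z.2 ^ 2 := by
  rw [nrm, Real.sq_sqrt (by positivity)]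

lemma nrm_nonneg (z : ℝ × ℝ) : 0 ≤ nrm z := Real.sqrt_nonneg _

lemma abs_fst_le_nrm (z : ℝ × ℝ) : |z.1| ≤ nrm z :=
  Real.abs_le_sqrt (by nlinarith [sq_nonneg z.2])

lemma abs_snd_le_nrm (z : ℝ × ℝ) : |z.2| ≤ nrm z :=
  Real.abs_le_sqrt (by nlinarith [sq_nonneg z.1])

lemma norm_le_nrm (z : ℝ × ℝ) : ‖z‖ ≤ nrm z :=
  max_le (abs_fst_le_nrm z) (abs_snd_le_nrm z)

lemma nrm_le_two_mul_norm (z : ℝ × ℝ) : nrm z ≤ 2 * ‖z‖ := by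
  have h1 : |z.1| ≤ ‖z‖ := norm_fst_le z
  have h2 : |z.2| ≤ ‖z‖ := norm_snd_le z
  refine Real.sqrt_le_iff.2 ⟨by positivity, ?_⟩
  nlinarith [sq_abs z.1, sq_abs z.2, abs_nonneg z.1, abs_nonneg z.2]

lemma norm_perp (z : ℝ × ℝ) : ‖perp z‖ = ‖z‖ := by
  simp [perp, Prod.norm_def, max_comm]

lemma measurable_nrm : Measurable nrm := by
  unfold nrm
  fun_prop

lemma measurable_perp : Measurable perp := by
  unfold perp
  fun_prop

lemma measurable_pbar : Measurable pbar := by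
  unfold pbar
  fun_prop

lemma measurable_planeKer : Measurable planeKer := by
  unfold planeKer
  exact (((measurable_nrm.pow_const 2).const_mul _).inv).smul measurable_perp

lemma measurable_Kker : Measurable fun z : (ℝ × ℝ) × (ℝ × ℝ) => Kker z.1 z.2 := by
  simp only [Kker_eq]
  exact (measurable_planeKer.comp (measurable_fst.sub measurable_snd)).sub
    (measurable_planeKer.comp (measurable_fst.sub (measurable_pbar.comp measurable_snd)))

lemma norm_planeKer_le (z : ℝ × ℝ) : ‖planeKer z‖ ≤ 2⁻¹ * ‖z‖ ^ (-1 : ℝ) := by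
  rw [Real.rpow_neg_one]
  by_cases hz : z = 0
  · simp [hz, planeKer, perp]
  have hz' : 0 < ‖z‖ := norm_pos_iff.2 hz
  have hn := norm_le_nrm z
  have hn0 : 0 < nrm z := hz'.trans_le hn
  rw [planeKer, norm_smul, norm_perp, Real.norm_of_nonneg (by positivity), ← mul_inv]
  rw [inv_mul_le_iff₀ (by positivity), ← div_eq_mul_inv, le_div_iff₀ (by positivity)]
  nlinarith [Real.pi_gt_three, mul_le_mul hn hn hz'.le (nrm_nonneg z), mul_pos hz' hz']

lemma norm_sub_le_norm_sub_pbar {x y : ℝ × ℝ} (hx : x ∈ Hplane) (hy : y ∈ Hplane) :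
    ‖x - y‖ ≤ ‖x - pbar y‖ := by
  have hx' : 0 < x.2 := hx
  have hy' : 0 < y.2 := hy
  simp only [Prod.norm_def, pbar, Prod.fst_sub, Prod.snd_sub, Real.norm_eq_abs]
  refine max_le_max le_rfl ?_
  rw [sub_neg_eq_add, abs_of_pos (add_pos hx' hy'), abs_le]
  constructor <;> linarith

lemma norm_Kker_le {x y : ℝ × ℝ} (hx : x ∈ Hplane) (hy : y ∈ Hplane) (hxy : x ≠ y) :
    ‖Kker x y‖ ≤ ‖x - y‖ ^ (-1 : ℝ) := by
  have h0 : 0 < ‖x - y‖ := norm_pos_iff.2 (sub_ne_zero.2 hxy)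
  have h1 := norm_planeKer_le (x - y)
  have h2 := norm_planeKer_le (x - pbar y)
  have h3 : ‖x - pbar y‖ ^ (-1 : ℝ) ≤ ‖x - y‖ ^ (-1 : ℝ) :=
    Real.rpow_le_rpow_of_nonpos h0 (norm_sub_le_norm_sub_pbar hx hy) (by norm_num)
  rw [Kker_eq]
  exact (norm_sub_le _ _).trans (by linarith)

/-- The kernel `planeKer` is weakly divergence free in the whole plane. -/
lemma integral_fderiv_planeKer {g : ℝ × ℝ → ℝ} (hg : ContDiff ℝ 1 g) (a : ℝ × ℝ) :
    ∫ x, fderiv ℝ g x (planeKer (x - a)) = 0 := by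
  set G : ℝ × ℝ → ℝ := fun x => g (x + a) with hG
  have hGd : ∀ x, HasFDerivAt G (fderiv ℝ g (x + a)) x := fun x =>
    (hasFDerivAt_comp_add_right a).2 (hg.differentiable one_ne_zero (x + a)).hasFDerivAt
  have e : ∫ x, fderiv ℝ g x (planeKer (x - a)) = ∫ x, fderiv ℝ G x (planeKer x) := by
    rw [← integral_add_right_eq_self _ a]
    refine integral_congr_ae (Eventually.of_forall fun x => ?_)
    simp [(hGd x).fderiv]
  rw [e, ← integral_comp_polarCoord_symm]
  have ht : polarCoord.target = Ioi (0 : ℝ) ×ˢ Ioo (-Real.pi) Real.pi := rfl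
  by_cases hi : IntegrableOn (fun p : ℝ × ℝ => p.1 • fderiv ℝ G (polarCoord.symm p)
      (planeKer (polarCoord.symm p))) polarCoord.target
  swap
  · exact integral_undef hi
  rw [ht] at hi ⊢
  rw [Measure.volume_eq_prod] at hi ⊢
  rw [setIntegral_prod _ hi]
  refine setIntegral_eq_zero_of_forall_eq_zero fun r hr => ?_
  have hr0 : (0 : ℝ) < r := hr
  have hd : ∀ θ : ℝ, HasDerivAt (fun θ : ℝ => G (r * Real.cos θ, r * Real.sin θ))
      (fderiv ℝ G (r * Real.cos θ, r * Real.sin θ) (-(r * Real.sin θ), r * Real.cos θ)) θ := by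
    intro θ
    have h1 : HasDerivAt (fun θ : ℝ => (r * Real.cos θ, r * Real.sin θ))
        (-(r * Real.sin θ), r * Real.cos θ) θ := by
      refine HasDerivAt.prodMk ?_ ?_
      · simpa using (Real.hasDerivAt_cos θ).const_mul r
      · exact (Real.hasDerivAt_sin θ).const_mul r
    exact (((hGd _).differentiableAt).hasFDerivAt).comp_hasDerivAt θ h1
  have hp : ∀ θ : ℝ, r • fderiv ℝ G (polarCoord.symm (r, θ)) (planeKer (polarCoord.symm (r, θ))) =
      (2 * Real.pi * r)⁻¹ *
        fderiv ℝ G (r * Real.cos θ, r * Real.sin θ) (-(r * Real.sin θ), r * Real.cos θ) := by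
    intro θ
    have hs : polarCoord.symm (r, θ) = (r * Real.cos θ, r * Real.sin θ) := rfl
    have hn : nrm (r * Real.cos θ, r * Real.sin θ) ^ 2 = r ^ 2 := by
      rw [nrm_sq]
      simp only
      linear_combination r ^ 2 * Real.sin_sq_add_cos_sq θ
    rw [hs, planeKer, hn, map_smul, perp]
    simp only [smul_eq_mul]
    rw [← mul_assoc]
    congr 1
    field_simp
  simp only [hp]
  rw [integral_const_mul, ← integral_Ioc_eq_integral_Ioo,
    ← intervalIntegral.integral_of_le (by linarith [Real.pi_pos]),
    intervalIntegral.integral_eq_sub_of_hasDerivAt (fun θ _ => hd θ)]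
  · simp
  · refine Continuous.intervalIntegrable ?_ _ _
    have hc : Continuous (fderiv ℝ G) := by
      have : fderiv ℝ G = fun x => fderiv ℝ g (x + a) := funext fun x => (hGd x).fderiv
      rw [this]
      exact (hg.continuous_fderiv one_ne_zero).comp (continuous_add_const a)
    exact (hc.comp (by fun_prop)).clm_apply (by fun_prop)

end HalfPlane

namespace HalfPlane
open MeasureTheory Filter Set Metric Function Topology

/-! ### Velocity fields of compactly supported vorticities -/

/-- Continuous vorticity profiles with compact support in the open half-plane. -/
structure IsProfile (w : ℝ × ℝ → ℝ) : Prop where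
  cont : Continuous w
  compactSupp : HasCompactSupport w
  suppIn : tsupport w ⊆ Hplane

/-- The velocity induced by a vorticity profile. -/
noncomputable def vel (w : ℝ × ℝ → ℝ) (x : ℝ × ℝ) : ℝ × ℝ := ∫ y in Hplane, w y • Kker x y

lemma IsProfile.eq_zero {w : ℝ × ℝ → ℝ} (hw : IsProfile w) {y : ℝ × ℝ} (hy : y ∉ Hplane) :
    w y = 0 :=
  image_eq_zero_of_notMem_tsupport fun h => hy (hw.suppIn h)

lemma IsProfile.integrable {w : ℝ × ℝ → ℝ} (hw : IsProfile w) : Integrable w :=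
  hw.cont.integrable_of_hasCompactSupport hw.compactSupp

lemma IsProfile.exists_bound {w : ℝ × ℝ → ℝ} (hw : IsProfile w) : ∃ W, ∀ y, |w y| ≤ W := by
  obtain ⟨W, hW⟩ := hw.compactSupp.exists_bound_of_continuous hw.cont
  exact ⟨W, hW⟩

lemma setIntegral_Hplane {E : Type*} [NormedAddCommGroup E] [NormedSpace ℝ E]
    {f : ℝ × ℝ → E} (hf : ∀ x, x ∉ Hplane → f x = 0) :
    ∫ x in Hplane, f x = ∫ x, f x :=
  setIntegral_eq_integral_of_forall_compl_eq_zero hf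

lemma IsProfile.vel_eq {w : ℝ × ℝ → ℝ} (hw : IsProfile w) (x : ℝ × ℝ) :
    vel w x = ∫ y, w y • Kker x y :=
  setIntegral_Hplane fun y hy => by rw [hw.eq_zero hy, zero_smul]

lemma IsProfile.norm_smul_Kker_le {w : ℝ × ℝ → ℝ} (hw : IsProfile w) {x : ℝ × ℝ}
    (hx : x ∈ Hplane) : ∀ᵐ y, ‖w y • Kker x y‖ ≤ |w y| * ‖x - y‖ ^ (-1 : ℝ) := by
  have : ∀ᵐ y : ℝ × ℝ, y ≠ x := by simp [ae_iff]
  filter_upwards [this] with y hy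
  rw [norm_smul, Real.norm_eq_abs]
  by_cases hyH : y ∈ Hplane
  · exact mul_le_mul_of_nonneg_left (norm_Kker_le hx hyH hy.symm) (abs_nonneg _)
  · simp [hw.eq_zero hyH]

lemma IsProfile.integrable_smul_Kker {w : ℝ × ℝ → ℝ} (hw : IsProfile w) {x : ℝ × ℝ}
    (hx : x ∈ Hplane) : Integrable fun y => w y • Kker x y := by
  obtain ⟨W, hW⟩ := hw.exists_bound
  refine (integrable_mul_norm_rpow zero_le_one one_lt_two hw.integrable hW x).1.mono' ?_
    (hw.norm_smul_Kker_le hx)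
  exact hw.cont.aestronglyMeasurable.smul
    (measurable_Kker.comp measurable_prodMk_left).aestronglyMeasurable

lemma IsProfile.norm_vel_le {w : ℝ × ℝ → ℝ} (hw : IsProfile w) {x : ℝ × ℝ}
    (hx : x ∈ Hplane) : ‖vel w x‖ ≤ ∫ y, |w y| * ‖x - y‖ ^ (-1 : ℝ) := by
  obtain ⟨W, hW⟩ := hw.exists_bound
  rw [hw.vel_eq]
  exact norm_integral_le_of_norm_le
    (integrable_mul_norm_rpow zero_le_one one_lt_two hw.integrable hW x).1
    (hw.norm_smul_Kker_le hx)

/-- Integrability on the product of kernels controlled by `‖x - y‖⁻¹` off the diagonal. -/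
lemma IsProfile.integrable_prod_kernel {w : ℝ × ℝ → ℝ} (hw : IsProfile w) {A : ℝ × ℝ → ℝ}
    (hA : Integrable A) {F : (ℝ × ℝ) × (ℝ × ℝ) → ℝ}
    (hm : AEStronglyMeasurable F) (hA0 : ∀ x, x ∉ Hplane → A x = 0)
    (hF : ∀ x ∈ Hplane, ∀ y ∈ Hplane, x ≠ y → |F (x, y)| ≤ |A x| * |w y| * ‖x - y‖ ^ (-1 : ℝ))
    (hF0 : ∀ x y, A x = 0 ∨ w y = 0 → F (x, y) = 0) : Integrable F := by
  obtain ⟨W, hW⟩ := hw.exists_bound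
  refine (integrable_prod_norm_rpow zero_le_one one_lt_two hA hw.integrable hW).mono' hm ?_
  filter_upwards [ae_fst_ne_snd] with z hz
  rw [Real.norm_eq_abs]
  by_cases h1 : z.1 ∈ Hplane
  · by_cases h2 : z.2 ∈ Hplane
    · exact hF z.1 h1 z.2 h2 hz
    · have : F z = 0 := hF0 z.1 z.2 (Or.inr (hw.eq_zero h2))
      rw [this, abs_zero]
      positivity
  · have : F z = 0 := hF0 z.1 z.2 (Or.inl (hA0 _ h1))
    rw [this, abs_zero]
    positivity

/-- The induced velocity is weakly divergence free, tangent to the boundary. -/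
lemma IsProfile.integral_fderiv_vel {w : ℝ × ℝ → ℝ} (hw : IsProfile w) {g : ℝ × ℝ → ℝ}
    (hg : ContDiff ℝ 1 g) (hgc : HasCompactSupport g) (hgs : tsupport g ⊆ Hplane) :
    Integrable (fun x => fderiv ℝ g x (vel w x)) ∧ ∫ x, fderiv ℝ g x (vel w x) = 0 := by
  have hdc : Continuous (fderiv ℝ g) := hg.continuous_fderiv one_ne_zero
  have hd0 : ∀ x, x ∉ Hplane → fderiv ℝ g x = 0 := fun x hx =>
    image_eq_zero_of_notMem_tsupport fun h => hx (hgs (tsupport_fderiv_subset ℝ h))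
  have hdi : Integrable fun x => ‖fderiv ℝ g x‖ :=
    (hdc.norm).integrable_of_hasCompactSupport (hgc.fderiv (𝕜 := ℝ)).norm
  have he : ∀ x, fderiv ℝ g x (vel w x) = ∫ y, w y * fderiv ℝ g x (Kker x y) := by
    intro x
    by_cases hx : x ∈ Hplane
    · rw [hw.vel_eq, ← ContinuousLinearMap.integral_comp_comm _ (hw.integrable_smul_Kker hx)]
      simp
    · simp [hd0 x hx]
  have hm : Measurable fun z : (ℝ × ℝ) × (ℝ × ℝ) => w z.2 * fderiv ℝ g z.1 (Kker z.1 z.2) := by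
    have h1 : ∀ z : (ℝ × ℝ) × (ℝ × ℝ), fderiv ℝ g z.1 (Kker z.1 z.2) =
        (Kker z.1 z.2).1 * fderiv ℝ g z.1 (1, 0) + (Kker z.1 z.2).2 * fderiv ℝ g z.1 (0, 1) := by
      intro z
      conv_lhs => rw [show Kker z.1 z.2 = (Kker z.1 z.2).1 • ((1 : ℝ), (0 : ℝ)) +
        (Kker z.1 z.2).2 • ((0 : ℝ), (1 : ℝ)) by ext <;> simp]
      rw [map_add, map_smul, map_smul, smul_eq_mul, smul_eq_mul]
    simp only [h1]
    have h2 : ∀ v : ℝ × ℝ, Measurable fun z : (ℝ × ℝ) × (ℝ × ℝ) => fderiv ℝ g z.1 v := fun v =>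
      ((hdc.comp continuous_fst).clm_apply continuous_const).measurable
    exact (hw.cont.measurable.comp measurable_snd).mul
      (((measurable_fst.comp measurable_Kker).mul (h2 _)).add
        ((measurable_snd.comp measurable_Kker).mul (h2 _)))
  have hint : Integrable fun z : (ℝ × ℝ) × (ℝ × ℝ) =>
      w z.2 * fderiv ℝ g z.1 (Kker z.1 z.2) := by
    refine hw.integrable_prod_kernel hdi hm.aestronglyMeasurable
      (fun x hx => by simp [hd0 x hx]) (fun x hx y hy hxy => ?_) (fun x y h => ?_)
    · simp only
      rw [abs_mul, abs_norm, mul_comm ‖fderiv ℝ g x‖, mul_assoc]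
      refine mul_le_mul_of_nonneg_left ?_ (abs_nonneg _)
      exact ((fderiv ℝ g x).le_opNorm _).trans
        (mul_le_mul_of_nonneg_left (norm_Kker_le hx hy hxy) (norm_nonneg _))
    · rcases h with h | h
      · simp [norm_eq_zero.1 h]
      · simp [h]
  rw [Measure.volume_eq_prod] at hint
  refine ⟨?_, ?_⟩
  · simp only [he]
    exact hint.integral_prod_left
  · simp only [he]
    rw [integral_integral_swap hint]
    refine integral_eq_zero_of_ae (Eventually.of_forall fun y => ?_)
    simp only [Pi.zero_apply]
    obtain ⟨B, hB⟩ := (hgc.fderiv (𝕜 := ℝ)).exists_bound_of_continuous hdc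
    have hk : ∀ a, Integrable fun x => fderiv ℝ g x (planeKer (x - a)) := by
      intro a
      refine (integrable_mul_norm_rpow (q := 1) zero_le_one one_lt_two hdi (W := B)
        (fun y => by simpa using hB y) a).1.mono' ?_ (Eventually.of_forall fun x => ?_)
      · have h1 : ∀ x : ℝ × ℝ, fderiv ℝ g x (planeKer (x - a)) =
          (planeKer (x - a)).1 * fderiv ℝ g x (1, 0) +
            (planeKer (x - a)).2 * fderiv ℝ g x (0, 1) := by
          intro x
          conv_lhs => rw [show planeKer (x - a) = (planeKer (x - a)).1 • ((1 : ℝ), (0 : ℝ)) +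
            (planeKer (x - a)).2 • ((0 : ℝ), (1 : ℝ)) by ext <;> simp]
          rw [map_add, map_smul, map_smul, smul_eq_mul, smul_eq_mul]
        simp only [h1]
        have h2 : ∀ v : ℝ × ℝ, Measurable fun x : ℝ × ℝ => fderiv ℝ g x v := fun v =>
          (hdc.clm_apply continuous_const).measurable
        have h3 : Measurable fun x : ℝ × ℝ => planeKer (x - a) :=
          measurable_planeKer.comp (measurable_id.sub_const a)
        exact (((measurable_fst.comp h3).mul (h2 _)).add
          ((measurable_snd.comp h3).mul (h2 _))).aestronglyMeasurable
      · rw [abs_norm, norm_sub_rev a x]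
        refine ((fderiv ℝ g x).le_opNorm _).trans
          (mul_le_mul_of_nonneg_left ((norm_planeKer_le _).trans ?_) (norm_nonneg _))
        have : 0 ≤ ‖x - a‖ ^ (-1 : ℝ) := by positivity
        linarith
    rw [integral_const_mul]
    simp only [Kker_eq, map_sub]
    rw [integral_sub (hk y) (hk (pbar y)), integral_fderiv_planeKer hg, integral_fderiv_planeKer hg]
    simp

/-! ### Differentiation under the integral sign -/

/-- Differentiation of `t ↦ ∫ H t` for `C¹` families with uniformly bounded support. -/
lemma hasDerivAt_integral_of_support {E : Type*} [NormedAddCommGroup E] [NormedSpace ℝ E]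
    [FiniteDimensional ℝ E] [MeasurableSpace E] [BorelSpace E] {ν : Measure E}
    [IsFiniteMeasureOnCompacts ν] {H H' : ℝ → E → ℝ} {a b R : ℝ}
    (hd : ∀ t ∈ Icc a b, ∀ x, HasDerivAt (fun s => H s x) (H' t x) t)
    (hc : ContinuousOn (uncurry H) (Icc a b ×ˢ univ))
    (hc' : ContinuousOn (uncurry H') (Icc a b ×ˢ univ))
    (hs : ∀ t ∈ Icc a b, ∀ x, R < ‖x‖ → H t x = 0) :
    ContinuousOn (fun t => ∫ x, H t x ∂ν) (Icc a b) ∧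
      ∀ t ∈ Ioo a b, Integrable (H' t) ν ∧
        HasDerivAt (fun t => ∫ x, H t x ∂ν) (∫ x, H' t x ∂ν) t := by
  have : ProperSpace E := FiniteDimensional.proper ℝ E
  have hK : IsCompact (Icc a b ×ˢ closedBall (0 : E) R) :=
    isCompact_Icc.prod (isCompact_closedBall 0 R)
  have hsub : Icc a b ×ˢ closedBall (0 : E) R ⊆ Icc a b ×ˢ univ :=
    prod_mono le_rfl (subset_univ _)
  obtain ⟨B, hB⟩ := hK.exists_bound_of_continuousOn (hc.mono hsub)
  obtain ⟨B', hB'⟩ := hK.exists_bound_of_continuousOn (hc'.mono hsub)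
  have hct : ∀ t ∈ Icc a b, Continuous (H t) := fun t ht =>
    continuousOn_univ.1 (hc.comp (f := fun x => (t, x)) (by fun_prop) fun x _ => ⟨ht, mem_univ _⟩)
  have hct' : ∀ t ∈ Icc a b, Continuous (H' t) := fun t ht =>
    continuousOn_univ.1 (hc'.comp (f := fun x => (t, x)) (by fun_prop) fun x _ => ⟨ht, mem_univ _⟩)
  have hs' : ∀ t ∈ Ioo a b, ∀ x, R < ‖x‖ → H' t x = 0 := by
    intro t ht x hx
    have h1 := hd t (Ioo_subset_Icc_self ht) x
    have h2 : (fun s => H s x) =ᶠ[𝓝 t] fun _ => 0 := by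
      filter_upwards [Icc_mem_nhds ht.1 ht.2] with s hsab
      exact hs s hsab x hx
    exact (h1.congr_of_eventuallyEq h2.symm).unique (hasDerivAt_const t 0)
  have hbi : ∀ B : ℝ, Integrable ((closedBall (0 : E) R).indicator fun _ => B) ν := fun B =>
    (integrable_indicator_iff measurableSet_closedBall).2
      (integrableOn_const (isCompact_closedBall 0 R).measure_lt_top.ne)
  have hbd : ∀ t ∈ Icc a b, ∀ x, ‖H t x‖ ≤ (closedBall (0 : E) R).indicator (fun _ => B) x := by
    intro t ht x
    by_cases hx : x ∈ closedBall (0 : E) R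
    · rw [indicator_of_mem hx]
      exact hB (t, x) ⟨ht, hx⟩
    · rw [indicator_of_notMem hx, hs t ht x (by simpa using hx), norm_zero]
  refine ⟨?_, fun t ht => ?_⟩
  · intro t ht
    refine tendsto_integral_filter_of_dominated_convergence _ ?_ ?_ (hbi B) ?_
    · filter_upwards [self_mem_nhdsWithin] with s hs
      exact (hct s hs).aestronglyMeasurable
    · filter_upwards [self_mem_nhdsWithin] with s hs
      exact Eventually.of_forall (hbd s hs)
    · exact Eventually.of_forall fun x => (hd t ht x).continuousAt.continuousWithinAt
  · have htI := Ioo_subset_Icc_self ht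
    refine hasDerivAt_integral_of_dominated_loc_of_deriv_le (s := Ioo a b)
      (bound := (closedBall (0 : E) R).indicator fun _ => B')
      (Ioo_mem_nhds ht.1 ht.2) ?_ ?_ (hct' t htI).aestronglyMeasurable ?_ (hbi B') ?_
    · filter_upwards [Ioo_mem_nhds ht.1 ht.2] with s hs
      exact (hct s (Ioo_subset_Icc_self hs)).aestronglyMeasurable
    · exact (hbi B).mono' (hct t htI).aestronglyMeasurable (Eventually.of_forall (hbd t htI))
    · refine Eventually.of_forall fun x s hsab => ?_
      by_cases hx : x ∈ closedBall (0 : E) R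
      · rw [indicator_of_mem hx]
        exact hB' (s, x) ⟨Ioo_subset_Icc_self hsab, hx⟩
      · rw [indicator_of_notMem hx, hs' s hsab x (by simpa using hx), norm_zero]
    · exact Eventually.of_forall fun x s hsab => hd s (Ioo_subset_Icc_self hsab) x

end HalfPlane

namespace HalfPlane
open MeasureTheory Filter Set Metric Function Topology

/-! ### The transport identity -/

variable {ω : ℝ → ℝ × ℝ → ℝ} {u : ℝ → ℝ × ℝ → ℝ × ℝ}

lemma IsEulerSol.continuous_slice (h : IsEulerSol ω u) (t : ℝ) : Continuous (ω t) :=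
  h.smooth.continuous.comp (Continuous.prodMk_right t)

lemma IsEulerSol.profile (h : IsEulerSol ω u) (t : ℝ) : IsProfile (ω t) :=
  ⟨IsEulerSol.continuous_slice h t, h.compactSupp t, h.suppIn t⟩

lemma IsEulerSol.velocity_eq (h : IsEulerSol ω u) (t : ℝ) : u t = vel (ω t) :=
  funext (h.biotSavart t)

lemma IsEulerSol.transport_everywhere (h : IsEulerSol ω u) {t : ℝ} (ht : 0 ≤ t) (x : ℝ × ℝ) :
    deriv (fun s => ω s x) t + fderiv ℝ (ω t) x (u t x) = 0 := by
  by_cases hx : x ∈ Hplane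
  · exact h.transport t ht x hx
  · have h1 : (fun s => ω s x) = fun _ => 0 := funext fun s => (IsEulerSol.profile h s).eq_zero hx
    have h2 : fderiv ℝ (ω t) x = 0 :=
      image_eq_zero_of_notMem_tsupport fun h' => hx (h.suppIn t (tsupport_fderiv_subset ℝ h'))
    simp [h1, h2]

/-- The weak transport identity for `∫ Φ f(ω)`. -/
lemma IsEulerSol.hasDerivAt_integral (h : IsEulerSol ω u) {Φ : ℝ → ℝ × ℝ → ℝ} {f : ℝ → ℝ}
    (hf : ContDiff ℝ 1 f) (hf0 : f 0 = 0) {a b R : ℝ} (ha : 0 ≤ a)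
    (hΦ : ∀ t ∈ Icc a b, ∀ x, ContDiffAt ℝ 1 (uncurry Φ) (t, x))
    (hs : ∀ t ∈ Icc a b, ∀ x, R < ‖x‖ → Φ t x * f (ω t x) = 0) :
    ContinuousOn (fun t => ∫ x, Φ t x * f (ω t x)) (Icc a b) ∧
      ∀ t ∈ Ioo a b,
        Integrable (fun x => f (ω t x) * (deriv (fun s => Φ s x) t + fderiv ℝ (Φ t) x (u t x))) ∧
        HasDerivAt (fun t => ∫ x, Φ t x * f (ω t x))
          (∫ x, f (ω t x) * (deriv (fun s => Φ s x) t + fderiv ℝ (Φ t) x (u t x))) t := by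
  set H : ℝ → ℝ × ℝ → ℝ := fun t x => Φ t x * f (ω t x) with hH
  have hω1 : ContDiff ℝ 1 (uncurry ω) := h.smooth.of_le (by exact_mod_cast le_top)
  have hHc : ∀ t ∈ Icc a b, ∀ x, ContDiffAt ℝ 1 (uncurry H) (t, x) := fun t ht x =>
    (hΦ t ht x).mul (hf.contDiffAt.comp (t, x) hω1.contDiffAt)
  set H' : ℝ → ℝ × ℝ → ℝ := fun t x => fderiv ℝ (uncurry H) (t, x) (1, 0) with hH'
  have hpt : ∀ {F : ℝ → ℝ × ℝ → ℝ} {t : ℝ} {x : ℝ × ℝ}, ContDiffAt ℝ 1 (uncurry F) (t, x) →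
      HasDerivAt (fun s => F s x) (fderiv ℝ (uncurry F) (t, x) (1, 0)) t := by
    intro F t x hF
    have h1 : HasDerivAt (fun s : ℝ => (s, x)) ((1 : ℝ), (0 : ℝ × ℝ)) t :=
      (hasDerivAt_id t).prodMk (hasDerivAt_const t x)
    exact (hF.differentiableAt one_ne_zero).hasFDerivAt.comp_hasDerivAt t h1
  have hpx : ∀ {F : ℝ → ℝ × ℝ → ℝ} {t : ℝ} {x : ℝ × ℝ}, ContDiffAt ℝ 1 (uncurry F) (t, x) →
      ContDiffAt ℝ 1 (F t) x := by
    intro F t x hF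
    have h1 : ContDiffAt ℝ 1 (fun y : ℝ × ℝ => (t, y)) x := by fun_prop
    exact ContDiffAt.comp (g := uncurry F) (f := fun y : ℝ × ℝ => (t, y)) x hF h1
  have hcont : ∀ {F : ℝ → ℝ × ℝ → ℝ}, (∀ t ∈ Icc a b, ∀ x, ContDiffAt ℝ 1 (uncurry F) (t, x)) →
      ContinuousOn (uncurry fun t x => fderiv ℝ (uncurry F) (t, x) (1, 0))
        (Icc a b ×ˢ univ) := by
    intro F hF z hz
    have h1 : ContDiffAt ℝ 0 (fderiv ℝ (uncurry F)) z :=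
      (hF z.1 hz.1 z.2).fderiv_right (by simp)
    exact (h1.continuousAt.clm_apply continuousAt_const).continuousWithinAt
  obtain ⟨c1, c2⟩ := hasDerivAt_integral_of_support (ν := (volume : Measure (ℝ × ℝ)))
    (H := H) (H' := H') (a := a) (b := b) (R := R)
    (fun t ht x => hpt (hHc t ht x))
    (fun z hz => (hHc z.1 hz.1 z.2).continuousAt.continuousWithinAt) (hcont hHc) hs
  refine ⟨c1, fun t ht => ?_⟩
  have htI := Ioo_subset_Icc_self ht
  obtain ⟨d1, d2⟩ := c2 t ht
  have hsupp : support (H t) ⊆ support (ω t) := by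
    intro x hx hx'
    exact hx (by simp [hH, hx', hf0])
  have hg : ContDiff ℝ 1 (H t) := contDiff_iff_contDiffAt.2 fun x => hpx (hHc t htI x)
  obtain ⟨e1, e2⟩ := (IsEulerSol.profile h t).integral_fderiv_vel hg
    ((h.compactSupp t).mono hsupp) ((closure_mono hsupp).trans (h.suppIn t))
  rw [← IsEulerSol.velocity_eq h t] at e1 e2
  have key : ∀ x, f (ω t x) * (deriv (fun s => Φ s x) t + fderiv ℝ (Φ t) x (u t x)) =
      H' t x + fderiv ℝ (H t) x (u t x) := by
    intro x
    have p1 := (hpt (hΦ t htI x)).differentiableAt.hasDerivAt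
    have p2 : HasDerivAt (fun s => ω s x) (deriv (fun s => ω s x) t) t :=
      (hpt (F := ω) (hω1.contDiffAt (x := (t, x)))).differentiableAt.hasDerivAt
    have pf : HasDerivAt f (deriv f (ω t x)) (ω t x) :=
      (hf.differentiable one_ne_zero _).hasDerivAt
    have p3 := (p1.mul (pf.comp t p2)).unique (hpt (hHc t htI x))
    have q1 := ((hpx (hΦ t htI x)).differentiableAt one_ne_zero).hasFDerivAt
    have q2 := ((hpx (F := ω) (hω1.contDiffAt (x := (t, x)))).differentiableAt
      one_ne_zero).hasFDerivAt
    have q3 := (q1.mul (pf.comp_hasFDerivAt x q2)).fderiv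
    have q4 : fderiv ℝ (H t) x = _ := q3
    have p4 := IsEulerSol.transport_everywhere h (ha.trans htI.1) x
    rw [q4, hH']
    simp only
    rw [← p3]
    simp only [add_apply, smul_apply, smul_eq_mul, comp_apply]
    linear_combination (- Φ t x * deriv f (ω t x)) * p4
  have hk : (fun x => f (ω t x) * (deriv (fun s => Φ s x) t + fderiv ℝ (Φ t) x (u t x))) =
      fun x => H' t x + fderiv ℝ (H t) x (u t x) := funext key
  rw [hk]
  refine ⟨d1.add e1, ?_⟩
  rw [integral_add d1 e1, e2, add_zero]
  exact d2

end HalfPlane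

namespace HalfPlane
open MeasureTheory Filter Set Metric Function Topology

/-! ### Truncations and weights -/

/-- The `C¹` function `s ↦ max(s, 0)²`. -/
noncomputable def posSq (s : ℝ) : ℝ := max s 0 ^ 2

lemma posSq_nonneg (s : ℝ) : 0 ≤ posSq s := sq_nonneg _

lemma posSq_eq_zero {s : ℝ} : posSq s = 0 ↔ s ≤ 0 := by
  simp [posSq]

lemma hasDerivAt_posSq (s : ℝ) : HasDerivAt posSq (2 * max s 0) s := by
  rw [hasDerivAt_iff_isLittleO_nhds_zero, Asymptotics.isLittleO_iff]
  intro c hc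
  filter_upwards [Metric.ball_mem_nhds (0 : ℝ) hc] with h hh
  rw [mem_ball_zero_iff] at hh
  have key : |posSq (s + h) - posSq s - h * (2 * max s 0)| ≤ |h| * |h| := by
    rw [← abs_mul, abs_of_nonneg (mul_self_nonneg h), abs_le]
    unfold posSq
    rcases le_total (s + h) 0 with h1 | h1 <;> rcases le_total s 0 with h2 | h2 <;>
      simp only [max_eq_left, max_eq_right, h1, h2] <;> constructor <;> nlinarith
  rw [smul_eq_mul, Real.norm_eq_abs, Real.norm_eq_abs]
  rw [Real.norm_eq_abs] at hh
  exact key.trans (mul_le_mul_of_nonneg_right hh.le (abs_nonneg h))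

lemma contDiff_posSq : ContDiff ℝ 1 posSq := by
  rw [contDiff_one_iff_deriv]
  refine ⟨fun s => (hasDerivAt_posSq s).differentiableAt, ?_⟩
  rw [show deriv posSq = fun s => 2 * max s 0 from funext fun s => (hasDerivAt_posSq s).deriv]
  fun_prop

/-- A smooth version of the Euclidean norm. -/
noncomputable def radius (x : ℝ × ℝ) : ℝ := √(1 + x.1 ^ 2 + x.2 ^ 2)

lemma radius_arg_pos (x : ℝ × ℝ) : 0 < 1 + x.1 ^ 2 + x.2 ^ 2 := by positivity

lemma contDiff_radius : ContDiff ℝ 1 radius := by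
  unfold radius
  exact ContDiff.sqrt (by fun_prop) fun x => (radius_arg_pos x).ne'

lemma norm_le_radius (x : ℝ × ℝ) : ‖x‖ ≤ radius x := by
  rw [Prod.norm_def]
  refine max_le ?_ ?_ <;> rw [Real.norm_eq_abs] <;> apply Real.abs_le_sqrt <;>
    nlinarith [sq_nonneg x.1, sq_nonneg x.2]

lemma abs_fderiv_radius_le (x v : ℝ × ℝ) : |fderiv ℝ radius x v| ≤ 2 * ‖v‖ := by
  have h1 : HasFDerivAt (fun x : ℝ × ℝ => 1 + x.1 ^ 2 + x.2 ^ 2)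
      ((2 * x.1) • ContinuousLinearMap.fst ℝ ℝ ℝ +
        (2 * x.2) • ContinuousLinearMap.snd ℝ ℝ ℝ) x := by
    have a := ((hasFDerivAt_fst (𝕜 := ℝ) (p := x)).pow 2)
    have b := ((hasFDerivAt_snd (𝕜 := ℝ) (p := x)).pow 2)
    refine ((a.const_add 1).add b).congr_fderiv ?_
    ext <;> simp
  have h2 := (h1.sqrt (radius_arg_pos x).ne').fderiv
  have h3 : fderiv ℝ radius x = _ := h2
  rw [h3]
  have hr : √(1 + x.1 ^ 2 + x.2 ^ 2) = radius x := rfl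
  have hp : 0 < radius x := Real.sqrt_pos.2 (radius_arg_pos x)
  have e : ((1 / (2 * √(1 + x.1 ^ 2 + x.2 ^ 2))) • ((2 * x.1) • ContinuousLinearMap.fst ℝ ℝ ℝ +
      (2 * x.2) • ContinuousLinearMap.snd ℝ ℝ ℝ)) v = (x.1 * v.1 + x.2 * v.2) / radius x := by
    rw [hr]
    simp
    field_simp
  rw [e, abs_div, abs_of_pos hp, div_le_iff₀ hp]
  have n1 := (norm_fst_le x).trans (norm_le_radius x)
  have n2 := (norm_snd_le x).trans (norm_le_radius x)
  have m1 := norm_fst_le v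
  have m2 := norm_snd_le v
  rw [Real.norm_eq_abs] at n1 n2 m1 m2
  calc |x.1 * v.1 + x.2 * v.2| ≤ |x.1| * |v.1| + |x.2| * |v.2| := by
        rw [← abs_mul, ← abs_mul]; exact abs_add_le _ _
    _ ≤ radius x * ‖v‖ + radius x * ‖v‖ := by gcongr
    _ = _ := by ring

/-! ### A velocity bound -/

lemma exists_vel_bound : ∃ C : ℝ, 0 < C ∧ ∀ w : ℝ × ℝ → ℝ, IsProfile w → ∀ W : ℝ,
    (∀ y, |w y| ≤ W) → ∀ x ∈ Hplane, ‖vel w x‖ ≤ C * (W + 1 + ∫ y, |w y| ^ (3 / 2 : ℝ)) := by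
  set A := ∫ z in ball (0 : ℝ × ℝ) 1, ‖z‖ ^ (-(1 : ℝ)) with hA
  set B := ∫ z : ℝ × ℝ, (1 + ‖z‖) ^ (-(3 : ℝ)) with hB
  have hA0 : 0 ≤ A := integral_nonneg fun z => by positivity
  have hB0 : 0 ≤ B := integral_nonneg fun z => by positivity
  refine ⟨A + 8 * B + 1, by positivity, fun w hw W hW x hx => ?_⟩
  have hW0 : 0 ≤ W := (abs_nonneg _).trans (hW 0)
  have i1 : Integrable (fun z : ℝ × ℝ =>
      (ball (0 : ℝ × ℝ) 1).indicator (fun z => ‖z‖ ^ (-(1 : ℝ))) z) :=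
    (integrable_indicator_iff measurableSet_ball).2 (integrableOn_norm_rpow_ball one_lt_two 1)
  have i2 : Integrable (fun z : ℝ × ℝ => (1 + ‖z‖) ^ (-(3 : ℝ))) :=
    integrable_one_add_norm (by rw [finrank_plane]; norm_num)
  have i3 : Integrable fun y => |w y| ^ (3 / 2 : ℝ) := by
    refine Continuous.integrable_of_hasCompactSupport ?_ ?_
    · exact (hw.cont.abs).rpow_const fun _ => Or.inr (by norm_num)
    · refine hw.compactSupp.comp_left (g := fun s : ℝ => |s| ^ (3 / 2 : ℝ)) ?_
      simp
  have hpt : ∀ y, |w y| * ‖x - y‖ ^ (-1 : ℝ) ≤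
      W * (ball (0 : ℝ × ℝ) 1).indicator (fun z => ‖z‖ ^ (-(1 : ℝ))) (x - y) +
        |w y| ^ (3 / 2 : ℝ) + 8 * (1 + ‖x - y‖) ^ (-(3 : ℝ)) := by
    intro y
    have p1 : 0 ≤ |w y| ^ (3 / 2 : ℝ) := by positivity
    have p2 : 0 ≤ 8 * (1 + ‖x - y‖) ^ (-(3 : ℝ)) := by positivity
    by_cases hz : x - y ∈ ball (0 : ℝ × ℝ) 1
    · rw [indicator_of_mem hz]
      have := mul_le_mul_of_nonneg_right (hW y) (by positivity : 0 ≤ ‖x - y‖ ^ (-(1 : ℝ)))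
      linarith
    · rw [indicator_of_notMem hz, mul_zero, zero_add]
      rw [mem_ball_zero_iff, not_lt] at hz
      have hy := Real.young_inequality_of_nonneg (abs_nonneg (w y))
        (by positivity : 0 ≤ ‖x - y‖ ^ (-1 : ℝ))
        (show (3 / 2 : ℝ).HolderConjugate 3 from by
          rw [Real.holderConjugate_iff]; norm_num)
      have q1 : (‖x - y‖ ^ (-1 : ℝ)) ^ (3 : ℝ) ≤ 8 * (1 + ‖x - y‖) ^ (-(3 : ℝ)) := by
        rw [Real.rpow_neg (by positivity : 0 ≤ 1 + ‖x - y‖), Real.rpow_neg_one]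
        norm_cast
        rw [inv_pow, ← div_eq_mul_inv, inv_le_comm₀ (by positivity) (by positivity), inv_div,
          div_le_iff₀ (by norm_num)]
        have : (1 + ‖x - y‖) ≤ 2 * ‖x - y‖ := by linarith
        calc (1 + ‖x - y‖) ^ 3 ≤ (2 * ‖x - y‖) ^ 3 := by gcongr
          _ = _ := by ring
      have q2 : 0 ≤ (‖x - y‖ ^ (-1 : ℝ)) ^ (3 : ℝ) := by positivity
      linarith
  have j1 := (i1.comp_sub_left x).const_mul W
  have j2 := (i2.comp_sub_left x).const_mul 8
  have j3 : Integrable fun y => W * (ball (0 : ℝ × ℝ) 1).indicator (fun z => ‖z‖ ^ (-(1 : ℝ)))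
      (x - y) + |w y| ^ (3 / 2 : ℝ) := j1.add i3
  have hint := integral_mono_of_nonneg (Eventually.of_forall fun y => by positivity)
    (j3.add j2) (Eventually.of_forall hpt)
  refine (hw.norm_vel_le hx).trans (hint.trans ?_)
  have e : ∫ y, (W * (ball (0 : ℝ × ℝ) 1).indicator (fun z => ‖z‖ ^ (-(1 : ℝ))) (x - y) +
        |w y| ^ (3 / 2 : ℝ) + 8 * (1 + ‖x - y‖) ^ (-(3 : ℝ))) =
      W * A + (∫ y, |w y| ^ (3 / 2 : ℝ)) + 8 * B := by
    have k1 := integral_sub_left_eq_self (μ := (volume : Measure (ℝ × ℝ)))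
      ((ball (0 : ℝ × ℝ) 1).indicator (fun z => ‖z‖ ^ (-(1 : ℝ)))) x
    have k2 := integral_sub_left_eq_self (μ := (volume : Measure (ℝ × ℝ)))
      (fun z : ℝ × ℝ => (1 + ‖z‖) ^ (-(3 : ℝ))) x
    rw [integral_indicator measurableSet_ball] at k1
    rw [integral_add j3 j2, integral_add j1 i3, integral_const_mul, integral_const_mul,
      k1, k2]
  have hN : 0 ≤ ∫ y, |w y| ^ (3 / 2 : ℝ) := integral_nonneg fun y => by positivity
  refine e.le.trans ?_
  nlinarith [mul_nonneg hA0 hN, mul_nonneg hB0 hN, mul_nonneg hB0 hW0, hN, hW0, hA0, hB0]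

end HalfPlane

namespace HalfPlane
open MeasureTheory Filter Set Metric Function Topology

/-! ### Propagation of supports -/

variable {ω : ℝ → ℝ × ℝ → ℝ} {u : ℝ → ℝ × ℝ → ℝ × ℝ}

/-- The support of `w` lies in the sublevel set `radius ≤ ρ`. -/
def SuppLe (ρ : ℝ) (w : ℝ × ℝ → ℝ) : Prop := ∀ x, w x ≠ 0 → radius x ≤ ρ

lemma SuppLe.mono {ρ ρ' : ℝ} {w : ℝ × ℝ → ℝ} (h : SuppLe ρ w) (hρ : ρ ≤ ρ') : SuppLe ρ' w :=
  fun x hx => (h x hx).trans hρ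

lemma SuppLe.eq_zero {ρ : ℝ} {w : ℝ × ℝ → ℝ} (h : SuppLe ρ w) {x : ℝ × ℝ} (hx : ρ < ‖x‖) :
    w x = 0 := by
  by_contra h'
  exact absurd ((norm_le_radius x).trans (h x h')) (not_le.2 hx)

lemma IsProfile.exists_suppLe {w : ℝ × ℝ → ℝ} (hw : IsProfile w) : ∃ ρ, SuppLe ρ w := by
  obtain ⟨ρ, hρ⟩ := (hw.compactSupp.isCompact.image contDiff_radius.continuous).bddAbove
  exact ⟨ρ, fun x hx => hρ ⟨x, subset_tsupport _ hx, rfl⟩⟩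

lemma eqOn_of_hasDerivAt_zero {f : ℝ → ℝ} {a b : ℝ} (hc : ContinuousOn f (Icc a b))
    (hd : ∀ t ∈ Ioo a b, HasDerivAt f 0 t) {s t : ℝ} (hs : s ∈ Icc a b) (ht : t ∈ Icc a b) :
    f t = f s := by
  have h1 : MonotoneOn f (Icc a b) := monotoneOn_of_deriv_nonneg (convex_Icc a b) hc
    (fun x hx => (hd x (by simpa using hx)).differentiableAt.differentiableWithinAt)
    (fun x hx => (hd x (by simpa using hx)).deriv.ge)
  have h2 : AntitoneOn f (Icc a b) := antitoneOn_of_deriv_nonpos (convex_Icc a b) hc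
    (fun x hx => (hd x (by simpa using hx)).differentiableAt.differentiableWithinAt)
    (fun x hx => (hd x (by simpa using hx)).deriv.le)
  rcases le_total s t with h | h
  · exact le_antisymm (h2 hs ht h) (h1 hs ht h)
  · exact le_antisymm (h1 ht hs h) (h2 ht hs h)

lemma IsEulerSol.integral_comp_eq (h : IsEulerSol ω u) {f : ℝ → ℝ}
    (hf : ContDiff ℝ 1 f) (hf0 : f 0 = 0) {a b R : ℝ} (ha : 0 ≤ a)
    (hR : ∀ t ∈ Icc a b, SuppLe R (ω t)) {s t : ℝ} (hs : s ∈ Icc a b) (ht : t ∈ Icc a b) :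
    ∫ x, f (ω t x) = ∫ x, f (ω s x) := by
  obtain ⟨h1, h2⟩ := IsEulerSol.hasDerivAt_integral h (Φ := fun _ _ => 1) hf hf0 (b := b) (R := R)
    ha (fun t _ x => contDiffAt_const) (fun t ht x hx => by
      rw [(hR t ht).eq_zero hx, hf0, mul_zero])
  simp only [one_mul] at h1 h2
  refine eqOn_of_hasDerivAt_zero h1 (fun τ hτ => ?_) hs ht
  have := (h2 τ hτ).2
  simpa using this

lemma contDiff_abs_rpow {q : ℝ} (hq : 1 < q) : ContDiff ℝ 1 fun s : ℝ => |s| ^ q :=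
  contDiff_norm_rpow hq

lemma IsProfile.eq_zero_of_integral {w : ℝ × ℝ → ℝ} (hw : IsProfile w) {f : ℝ × ℝ → ℝ → ℝ}
    (hc : Continuous (uncurry f)) (hf0 : ∀ x, f x 0 = 0) (hf : ∀ x s, 0 ≤ f x s)
    (hi : ∫ x, f x (w x) ≤ 0) (x : ℝ × ℝ) : f x (w x) = 0 := by
  by_contra hne
  have hcont : Continuous fun x => f x (w x) := hc.comp (continuous_id.prodMk hw.cont)
  have := hcont.integral_pos_of_hasCompactSupport_nonneg_nonzero (μ := volume)
    (hw.compactSupp.mono fun x hx hx' => hx (by simp [hx', hf0])) (fun x => hf x _) hne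
  linarith

lemma IsEulerSol.abs_le_of_suppLe (h : IsEulerSol ω u) {a b R W : ℝ} (ha : 0 ≤ a)
    (hR : ∀ t ∈ Icc a b, SuppLe R (ω t)) {s t : ℝ} (hs : s ∈ Icc a b) (ht : t ∈ Icc a b)
    (σ : ℝ) (hW : 0 ≤ W) (hsW : ∀ x, σ * ω s x ≤ W) (x : ℝ × ℝ) : σ * ω t x ≤ W := by
  have hf : ContDiff ℝ 1 fun r : ℝ => posSq (σ * r - W) := contDiff_posSq.comp (by fun_prop)
  have h1 := IsEulerSol.integral_comp_eq h hf (by simpa [posSq_eq_zero] using hW) ha hR hs ht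
  have h2 : ∫ x, posSq (σ * ω s x - W) = 0 := by
    rw [← integral_zero (ℝ × ℝ) ℝ]
    congr 1
    funext x
    rw [posSq_eq_zero]
    linarith [hsW x]
  have h3 := (IsEulerSol.profile h t).eq_zero_of_integral (f := fun _ r => posSq (σ * r - W))
    (hf.continuous.comp continuous_snd) (fun _ => by simpa [posSq_eq_zero] using hW)
    (fun _ _ => posSq_nonneg _) (h1.trans h2).le x
  simp only [posSq_eq_zero] at h3
  linarith

lemma IsEulerSol.suppLe_of_velocity (h : IsEulerSol ω u) {a b R C ρ : ℝ} (ha : 0 ≤ a)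
    (hR : ∀ t ∈ Icc a b, SuppLe R (ω t)) (hC : ∀ t ∈ Icc a b, ∀ x ∈ Hplane, ‖u t x‖ ≤ C)
    {s t : ℝ} (hs : s ∈ Icc a b) (ht : t ∈ Icc a b) (hρ : SuppLe ρ (ω s)) :
    SuppLe (ρ + 2 * C * |t - s|) (ω t) := by
  have hC0 : 0 ≤ C := (norm_nonneg _).trans (hC s hs (0, 1) (by simp [Hplane]))
  have main : ∀ κ : ℝ, (κ = 2 * C ∧ s ≤ t ∨ κ = -(2 * C) ∧ t ≤ s) →
      ∫ x, posSq (radius x - ρ - κ * (t - s)) * ω t x ^ 2 ≤ 0 := by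
    intro κ hκ
    obtain ⟨h1, h2⟩ := IsEulerSol.hasDerivAt_integral h (f := fun r => r ^ 2)
      (Φ := fun τ x => posSq (radius x - ρ - κ * (τ - s))) (by fun_prop) (by simp)
      (a := a) (b := b) (R := R) ha
      (fun t _ x => by
        refine contDiff_posSq.contDiffAt.comp (t, x) ?_
        have := contDiff_radius
        fun_prop)
      (fun t ht x hx => by rw [(hR t ht).eq_zero hx]; simp)
    have h0 : ∫ x, posSq (radius x - ρ - κ * (s - s)) * ω s x ^ 2 = 0 := by
      rw [← integral_zero (ℝ × ℝ) ℝ]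
      congr 1
      funext x
      by_cases hx : ω s x = 0
      · simp [hx]
      · rw [posSq_eq_zero.2, zero_mul]
        linarith [hρ x hx]
    have hder : ∀ τ ∈ Ioo a b, ∀ x, deriv (fun τ => posSq (radius x - ρ - κ * (τ - s))) τ +
        fderiv ℝ (fun x => posSq (radius x - ρ - κ * (τ - s))) x (u τ x) =
        2 * max (radius x - ρ - κ * (τ - s)) 0 * (fderiv ℝ radius x (u τ x) - κ) := by
      intro τ _ x
      have e1 : HasDerivAt (fun τ => radius x - ρ - κ * (τ - s)) (-κ) τ := by
        have := (((hasDerivAt_id τ).sub_const s).const_mul κ).const_sub (radius x - ρ)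
        simpa using this
      have e2 : HasFDerivAt (fun x => radius x - ρ - κ * (τ - s)) (fderiv ℝ radius x) x :=
        (((contDiff_radius.differentiable one_ne_zero x).hasFDerivAt).sub_const _).sub_const _
      have e3 := ((hasDerivAt_posSq _).comp τ e1).deriv
      have e4 := ((hasDerivAt_posSq _).comp_hasFDerivAt x e2).fderiv
      have e3' : deriv (fun τ => posSq (radius x - ρ - κ * (τ - s))) τ = _ := e3
      have e4' : fderiv ℝ (fun x => posSq (radius x - ρ - κ * (τ - s))) x = _ := e4
      rw [e3', e4']
      simp only [smul_apply, smul_eq_mul]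
      ring
    have hu : ∀ τ ∈ Ioo a b, ∀ x ∈ Hplane, |fderiv ℝ radius x (u τ x)| ≤ 2 * C :=
      fun τ hτ x hx => (abs_fderiv_radius_le x (u τ x)).trans
        (mul_le_mul_of_nonneg_left (hC τ (Ioo_subset_Icc_self hτ) x hx) zero_le_two)
    rw [← h0]
    rcases hκ with ⟨hk, hst⟩ | ⟨hk, hst⟩
    · refine antitoneOn_of_deriv_nonpos (convex_Icc a b) h1
        (fun x hx => (h2 x (by simpa using hx)).2.differentiableAt.differentiableWithinAt)
        (fun τ hτ => ?_) hs ht hst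
      rw [interior_Icc] at hτ
      rw [(h2 τ hτ).2.deriv]
      refine integral_nonpos fun x => ?_
      simp only [Pi.zero_apply]
      rw [hder τ hτ x]
      by_cases hx : x ∈ Hplane
      · have b1 := (abs_le.1 (hu τ hτ x hx)).2
        exact mul_nonpos_of_nonneg_of_nonpos (sq_nonneg _)
          (mul_nonpos_of_nonneg_of_nonpos (by positivity) (by linarith))
      · rw [(IsEulerSol.profile h τ).eq_zero hx]
        simp
    · refine monotoneOn_of_deriv_nonneg (convex_Icc a b) h1
        (fun x hx => (h2 x (by simpa using hx)).2.differentiableAt.differentiableWithinAt)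
        (fun τ hτ => ?_) ht hs hst
      rw [interior_Icc] at hτ
      rw [(h2 τ hτ).2.deriv]
      refine integral_nonneg fun x => ?_
      simp only [Pi.zero_apply]
      rw [hder τ hτ x]
      by_cases hx : x ∈ Hplane
      · have b1 := (abs_le.1 (hu τ hτ x hx)).1
        exact mul_nonneg (sq_nonneg _) (mul_nonneg (by positivity) (by linarith))
      · rw [(IsEulerSol.profile h τ).eq_zero hx]
        simp
  have fin : ∀ κ : ℝ, (κ = 2 * C ∧ s ≤ t ∨ κ = -(2 * C) ∧ t ≤ s) →
      SuppLe (ρ + κ * (t - s)) (ω t) := by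
    intro κ hκ x hx
    have h3 := (IsEulerSol.profile h t).eq_zero_of_integral
      (f := fun x r => posSq (radius x - ρ - κ * (t - s)) * r ^ 2)
      (by
        have := contDiff_radius.continuous
        have := contDiff_posSq.continuous
        fun_prop) (fun _ => by simp)
      (fun _ _ => mul_nonneg (posSq_nonneg _) (sq_nonneg _)) (main κ hκ) x
    rcases mul_eq_zero.1 h3 with h4 | h4
    · rw [posSq_eq_zero] at h4
      linarith
    · exact absurd (pow_eq_zero_iff two_ne_zero |>.1 h4) hx
  rcases le_total s t with hst | hst
  · rw [abs_of_nonneg (sub_nonneg.2 hst)]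
    exact fin _ (Or.inl ⟨rfl, hst⟩)
  · rw [abs_of_nonpos (sub_nonpos.2 hst), mul_neg, ← neg_mul]
    exact fin _ (Or.inr ⟨rfl, hst⟩)

/-- Quantitative propagation from a given time, with speed depending only on the data there. -/
lemma IsEulerSol.suppLe_of_uniform (h : IsEulerSol ω u) {C₀ : ℝ}
    (hC₀ : ∀ w : ℝ × ℝ → ℝ, IsProfile w → ∀ W : ℝ, (∀ y, |w y| ≤ W) → ∀ x ∈ Hplane,
      ‖vel w x‖ ≤ C₀ * (W + 1 + ∫ y, |w y| ^ (3 / 2 : ℝ)))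
    {a b R W ρ : ℝ} (ha : 0 ≤ a) (hR : ∀ t ∈ Icc a b, SuppLe R (ω t))
    {s t : ℝ} (hs : s ∈ Icc a b) (ht : t ∈ Icc a b) (hW : ∀ x, |ω s x| ≤ W)
    (hρ : SuppLe ρ (ω s)) :
    SuppLe (ρ + 2 * (C₀ * (W + 1 + ∫ y, |ω s y| ^ (3 / 2 : ℝ))) * |t - s|) (ω t) := by
  have hW0 : 0 ≤ W := (abs_nonneg _).trans (hW 0)
  refine IsEulerSol.suppLe_of_velocity h ha hR (fun τ hτ x hx => ?_) hs ht hρ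
  have hWτ : ∀ x, |ω τ x| ≤ W := fun x => by
    have p1 := IsEulerSol.abs_le_of_suppLe h ha hR hs hτ 1 hW0
      (fun x => by linarith [(abs_le.1 (hW x)).2]) x
    have p2 := IsEulerSol.abs_le_of_suppLe h ha hR hs hτ (-1) hW0
      (fun x => by linarith [(abs_le.1 (hW x)).1]) x
    rw [abs_le]
    constructor <;> linarith
  have := hC₀ _ (IsEulerSol.profile h τ) W hWτ x hx
  rwa [← IsEulerSol.velocity_eq h, IsEulerSol.integral_comp_eq h
    (contDiff_abs_rpow (by norm_num : (1 : ℝ) < 3 / 2)) (by simp) ha hR hs hτ] at this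

end HalfPlane

namespace HalfPlane
open MeasureTheory Filter Set Metric Function Topology

variable {ω : ℝ → ℝ × ℝ → ℝ} {u : ℝ → ℝ × ℝ → ℝ × ℝ}

lemma IsEulerSol.exists_speed (h : IsEulerSol ω u) (ρ : ℝ) {W : ℝ} (hW : 0 ≤ W) :
    ∃ V : ℝ, 0 ≤ V ∧ ∀ {a b R : ℝ}, 0 ≤ a → (∀ t ∈ Icc a b, SuppLe R (ω t)) →
      ∀ {s t : ℝ}, s ∈ Icc a b → t ∈ Icc a b → (∀ x, |ω s x| ≤ W) → SuppLe ρ (ω s) →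
      SuppLe (ρ + V * |t - s|) (ω t) := by
  obtain ⟨C₀, hC₀, hvel⟩ := exists_vel_bound
  set N := W ^ (3 / 2 : ℝ) * volume.real (closedBall (0 : ℝ × ℝ) ρ) with hN
  refine ⟨2 * (C₀ * (W + 1 + N)), by positivity, fun ha hR s t hs ht hWs hρ => ?_⟩
  refine (IsEulerSol.suppLe_of_uniform h hvel ha hR hs ht hWs hρ).mono ?_
  have hle : ∫ y, |ω s y| ^ (3 / 2 : ℝ) ≤ N := by
    have h1 : ∫ y in closedBall (0 : ℝ × ℝ) ρ, |ω s y| ^ (3 / 2 : ℝ) =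
        ∫ y, |ω s y| ^ (3 / 2 : ℝ) := by
      refine setIntegral_eq_integral_of_forall_compl_eq_zero fun x hx => ?_
      rw [hρ.eq_zero (by simpa using hx)]
      simp
    rw [← h1]
    refine (Real.le_norm_self _).trans (norm_setIntegral_le_of_norm_le_const
      (measure_closedBall_lt_top) fun x _ => ?_)
    rw [Real.norm_eq_abs, abs_of_nonneg (by positivity)]
    exact Real.rpow_le_rpow (abs_nonneg _) (hWs x) (by norm_num)
  gcongr

/-- The supports of `ω` are uniformly bounded at nonnegative times near `t`. -/
def LocUnif (ω : ℝ → ℝ × ℝ → ℝ) (t : ℝ) : Prop :=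
  ∃ R, ∀ᶠ s in 𝓝[Ici 0] t, SuppLe R (ω s)

lemma exists_suppLe_of_isCompact {K : Set ℝ} (hK : IsCompact K) (hK0 : K ⊆ Ici 0)
    (h : ∀ t ∈ K, LocUnif ω t) : ∃ R, ∀ t ∈ K, SuppLe R (ω t) := by
  refine hK.induction_on (p := fun S => ∃ R, ∀ t ∈ S, SuppLe R (ω t)) ⟨0, by simp⟩
    (fun S T hST ⟨R, hR⟩ => ⟨R, fun t ht => hR t (hST ht)⟩) ?_ ?_
  · rintro S T ⟨R, hR⟩ ⟨R', hR'⟩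
    refine ⟨max R R', ?_⟩
    rintro t (ht | ht)
    · exact (hR t ht).mono (le_max_left _ _)
    · exact (hR' t ht).mono (le_max_right _ _)
  · intro t ht
    obtain ⟨R, hR⟩ := h t ht
    exact ⟨_, nhdsWithin_mono t hK0 hR, R, fun s hs => hs⟩

lemma isClosed_suppLe (hω : Continuous (uncurry ω)) (ρ : ℝ) : IsClosed {t | SuppLe ρ (ω t)} := by
  have : {t | SuppLe ρ (ω t)} = ⋂ x : {x : ℝ × ℝ // ρ < radius x}, {t | ω t x = 0} := by
    ext t
    simp only [mem_ofPred_eq, mem_iInter, SuppLe]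
    constructor
    · intro h x
      by_contra hx
      exact absurd (h x hx) (not_le.2 x.2)
    · intro h x hx
      by_contra hx'
      exact hx (h ⟨x, not_le.1 hx'⟩)
  rw [this]
  refine isClosed_iInter fun x => ?_
  exact isClosed_eq (hω.comp (Continuous.prodMk_left x.1)) continuous_const

lemma IsEulerSol.locUnif (h : IsEulerSol ω u) {t : ℝ} (ht : 0 ≤ t) : LocUnif ω t := by
  have hωc : Continuous (uncurry ω) := h.smooth.continuous
  set B : Set ℝ := {t | 0 ≤ t ∧ ¬ LocUnif ω t} with hB
  have hBc : IsClosed B := by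
    rw [← isOpen_compl_iff, isOpen_iff_mem_nhds]
    intro s hs
    by_cases hs0 : 0 ≤ s
    · have hsl : LocUnif ω s := by
        by_contra h'
        exact hs ⟨hs0, h'⟩
      obtain ⟨R, hR⟩ := hsl
      have := eventually_eventually_nhdsWithin.2 hR
      rw [eventually_nhdsWithin_iff] at this
      filter_upwards [this] with r hr hrB
      exact hrB.2 ⟨R, hr hrB.1⟩
    · filter_upwards [Iio_mem_nhds (not_le.1 hs0)] with r hr hrB
      exact absurd hrB.1 (not_le.2 hr)
  by_contra hcon
  have hne : Nonempty B := ⟨⟨t, ht, hcon⟩⟩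
  have : CompleteSpace B := hBc.completeSpace_coe
  obtain ⟨n, hn⟩ := nonempty_interior_of_iUnion_of_closed (X := B)
    (f := fun n : ℕ => {t : B | SuppLe n (ω t)})
    (fun n => (isClosed_suppLe hωc n).preimage continuous_subtype_val) (by
      refine eq_univ_of_forall fun s => ?_
      obtain ⟨ρ, hρ⟩ := (IsEulerSol.profile h s).exists_suppLe
      obtain ⟨n, hn⟩ := exists_nat_ge ρ
      exact mem_iUnion.2 ⟨n, hρ.mono hn⟩)
  obtain ⟨⟨t0, ht0⟩, hint⟩ := hn
  obtain ⟨δ, hδ, hball⟩ := Metric.mem_nhds_iff.1 (mem_interior_iff_mem_nhds.1 hint)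
  have hBn : ∀ s ∈ B, |s - t0| < δ → SuppLe n (ω s) := fun s hs hd =>
    hball (show (⟨s, hs⟩ : B) ∈ ball _ δ from hd)
  obtain ⟨W, hW⟩ := ((isCompact_Icc (a := t0 - δ) (b := t0 + δ)).prod
    (isCompact_closedBall (0 : ℝ × ℝ) n)).exists_bound_of_continuousOn hωc.continuousOn
  have hW' : ∀ s ∈ B, |s - t0| < δ → ∀ x, |ω s x| ≤ max W 0 := by
    intro s hs hd x
    by_cases hx : ω s x = 0
    · rw [hx, abs_zero]; exact le_max_right _ _
    · rw [abs_lt] at hd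
      refine (hW (s, x) ⟨⟨by linarith, by linarith⟩, ?_⟩).trans (le_max_left _ _)
      rw [mem_closedBall_zero_iff]
      exact (norm_le_radius x).trans (hBn s hs (abs_lt.2 hd) x hx)
  obtain ⟨V, hV0, hV⟩ := IsEulerSol.exists_speed h n (le_max_right W 0)
  refine ht0.2 ⟨n + V * δ, ?_⟩
  rw [eventually_nhdsWithin_iff]
  filter_upwards [Metric.ball_mem_nhds t0 hδ] with t htδ ht
  rw [mem_ball, Real.dist_eq] at htδ
  by_cases htB : t ∈ B
  · exact (hBn t htB htδ).mono (by nlinarith)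
  obtain ⟨a, ha, hamin⟩ := (isCompact_uIcc (a := t0) (b := t)).inter_left hBc
    |>.exists_isMinOn ⟨t0, ht0, left_mem_uIcc⟩
    (f := fun a => |t - a|) (by fun_prop)
  have haI := ha.2
  have hat0 : |a - t0| < δ := (abs_sub_left_of_mem_uIcc haI).trans_lt htδ
  have hat : |t - a| ≤ |t - t0| := by
    have := abs_sub_right_of_mem_uIcc haI
    linarith
  have hnear : ∀ s ∈ uIcc a t, s ≠ a → LocUnif ω s := by
    intro s hs hsa
    by_contra hsl
    have hs0 : 0 ≤ s := by
      rcases mem_uIcc.1 hs with h' | h'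
      · exact ha.1.1.trans h'.1
      · exact le_trans ht h'.1
    have hsI : s ∈ uIcc t0 t := by
      rw [mem_uIcc] at haI hs ⊢
      rcases haI with h' | h' <;> rcases hs with h'' | h'' <;>
        first
          | exact Or.inl ⟨by linarith, by linarith⟩
          | exact Or.inr ⟨by linarith, by linarith⟩
    have hmin : |t - a| ≤ |t - s| := hamin ⟨⟨hs0, hsl⟩, hsI⟩
    apply hsa
    rw [mem_uIcc] at hs
    rcases hs with h' | h'
    · rw [abs_of_nonneg (by linarith), abs_of_nonneg (by linarith)] at hmin
      linarith
    · rw [abs_of_nonpos (by linarith), abs_of_nonpos (by linarith)] at hmin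
      linarith
  have hta : t ≠ a := fun h' => htB (h' ▸ ha.1)
  obtain ⟨ρt, hρt⟩ := (IsEulerSol.profile h t).exists_suppLe
  obtain ⟨Wt, hWt⟩ := (IsEulerSol.profile h t).exists_bound
  obtain ⟨Vt, hVt0, hVt⟩ := IsEulerSol.exists_speed h ρt ((abs_nonneg _).trans (hWt 0))
  have huni : ∀ s ∈ uIcc a t, SuppLe (max (ρt + Vt * |t - a|) n) (ω s) := by
    intro s hs
    by_cases hsa : s = a
    · rw [hsa]
      exact (hBn a ha.1 hat0).mono (le_max_right _ _)
    have hsub : uIcc s t ⊆ uIcc a t := uIcc_subset_uIcc hs right_mem_uIcc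
    have hnot : ∀ r ∈ uIcc s t, r ≠ a := by
      intro r hr hra
      rw [hra] at hr
      apply hsa
      rw [mem_uIcc] at hr hs
      rcases hr with h' | h' <;> rcases hs with h'' | h'' <;>
        exact le_antisymm (by linarith) (by linarith)
    have hpos : uIcc s t ⊆ Ici 0 := by
      intro r hr
      rcases mem_uIcc.1 (hsub hr) with h' | h'
      · exact ha.1.1.trans h'.1
      · exact le_trans ht h'.1
    obtain ⟨R, hR⟩ := exists_suppLe_of_isCompact (ω := ω) isCompact_uIcc hpos
      fun r hr => hnear r (hsub hr) (hnot r hr)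
    have := hVt (a := min s t) (b := max s t) (hpos ⟨le_rfl, min_le_max⟩) hR (s := t) (t := s)
      right_mem_uIcc left_mem_uIcc hWt hρt
    refine this.mono (le_trans ?_ (le_max_left _ _))
    have hle : |s - t| ≤ |t - a| := by
      rw [abs_sub_comm]; exact abs_sub_right_of_mem_uIcc hs
    gcongr
  have := hV (a := min a t) (b := max a t) (le_min ha.1.1 ht) huni (s := a) (t := t)
      left_mem_uIcc right_mem_uIcc (hW' a ha.1 hat0) (hBn a ha.1 hat0)
  refine this.mono ?_
  have : |t - a| ≤ δ := hat.trans htδ.le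
  gcongr

/-- The vorticity support is bounded uniformly on compact time intervals. -/
lemma IsEulerSol.exists_suppLe_Icc (h : IsEulerSol ω u) (T : ℝ) :
    ∃ R, ∀ t ∈ Icc 0 T, SuppLe R (ω t) :=
  exists_suppLe_of_isCompact isCompact_Icc (fun _ ht => ht.1)
    fun _ ht => IsEulerSol.locUnif h ht.1

end HalfPlane

namespace HalfPlane
open MeasureTheory Filter Set Metric Function Topology

variable {ω : ℝ → ℝ × ℝ → ℝ} {u : ℝ → ℝ × ℝ → ℝ × ℝ}

/-! ### Global consequences -/

lemma IsEulerSol.integral_comp_eq_initial (h : IsEulerSol ω u) {f : ℝ → ℝ}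
    (hf : ContDiff ℝ 1 f) (hf0 : f 0 = 0) {t : ℝ} (ht : 0 ≤ t) :
    ∫ x, f (ω t x) = ∫ x, f (ω 0 x) := by
  obtain ⟨R, hR⟩ := IsEulerSol.exists_suppLe_Icc h t
  exact IsEulerSol.integral_comp_eq h hf hf0 le_rfl hR (left_mem_Icc.2 ht) (right_mem_Icc.2 ht)

lemma IsEulerSol.integral_eq_initial (h : IsEulerSol ω u) {t : ℝ} (ht : 0 ≤ t) :
    ∫ x, ω t x = ∫ x, ω 0 x :=
  IsEulerSol.integral_comp_eq_initial h (f := fun r => r) contDiff_id rfl ht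

lemma IsEulerSol.nonneg (h : IsEulerSol ω u) (h0 : ∀ x, 0 ≤ ω 0 x) {t : ℝ} (ht : 0 ≤ t)
    (x : ℝ × ℝ) : 0 ≤ ω t x := by
  obtain ⟨R, hR⟩ := IsEulerSol.exists_suppLe_Icc h t
  have := IsEulerSol.abs_le_of_suppLe h le_rfl hR (left_mem_Icc.2 ht) (right_mem_Icc.2 ht) (-1)
    le_rfl (fun x => by linarith [h0 x]) x
  linarith

lemma IsEulerSol.exists_bound (h : IsEulerSol ω u) (h0 : ∀ x, 0 ≤ ω 0 x) :
    ∃ W : ℝ, 0 ≤ W ∧ ∀ t, 0 ≤ t → ∀ x, |ω t x| ≤ W := by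
  obtain ⟨W, hW⟩ := (IsEulerSol.profile h 0).exists_bound
  have hW0 : 0 ≤ W := (abs_nonneg _).trans (hW 0)
  refine ⟨W, hW0, fun t ht x => ?_⟩
  obtain ⟨R, hR⟩ := IsEulerSol.exists_suppLe_Icc h t
  rw [abs_of_nonneg (IsEulerSol.nonneg h h0 ht x)]
  have := IsEulerSol.abs_le_of_suppLe h le_rfl hR (left_mem_Icc.2 ht) (right_mem_Icc.2 ht) 1
    hW0 (fun x => by linarith [(abs_le.1 (hW x)).2]) x
  linarith

lemma IsEulerSol.exists_velocity_bound (h : IsEulerSol ω u) (h0 : ∀ x, 0 ≤ ω 0 x) :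
    ∃ C : ℝ, 0 ≤ C ∧ ∀ t, 0 ≤ t → ∀ x ∈ Hplane, ‖u t x‖ ≤ C := by
  obtain ⟨W, hW0, hW⟩ := IsEulerSol.exists_bound h h0
  obtain ⟨C, hC, hv⟩ := exists_vel_bound
  refine ⟨C * (W + 1 + ∫ y, |ω 0 y| ^ (3 / 2 : ℝ)), ?_, fun t ht x hx => ?_⟩
  · have : 0 ≤ ∫ y, |ω 0 y| ^ (3 / 2 : ℝ) := integral_nonneg fun y => by positivity
    positivity
  · have := hv _ (IsEulerSol.profile h t) W (hW t ht) x hx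
    rwa [← IsEulerSol.velocity_eq h, IsEulerSol.integral_comp_eq_initial h
      (contDiff_abs_rpow (by norm_num : (1 : ℝ) < 3 / 2)) (by simp) ht] at this

lemma IsEulerSol.exists_linear_support (h : IsEulerSol ω u) (h0 : ∀ x, 0 ≤ ω 0 x) :
    ∃ B : ℝ, 0 < B ∧ ∀ t, 1 ≤ t → ∀ x, ω t x ≠ 0 → ‖x‖ ≤ B * t := by
  obtain ⟨C, hC0, hC⟩ := IsEulerSol.exists_velocity_bound h h0
  obtain ⟨ρ, hρ⟩ := (IsEulerSol.profile h 0).exists_suppLe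
  refine ⟨|ρ| + 2 * C + 1, by positivity, fun t ht x hx => ?_⟩
  have ht0 : 0 ≤ t := zero_le_one.trans ht
  obtain ⟨R, hR⟩ := IsEulerSol.exists_suppLe_Icc h t
  have := IsEulerSol.suppLe_of_velocity h le_rfl hR (fun s hs => hC s hs.1) (left_mem_Icc.2 ht0)
    (right_mem_Icc.2 ht0) hρ x hx
  rw [sub_zero, abs_of_nonneg ht0] at this
  nlinarith [norm_le_radius x, le_abs_self ρ, abs_nonneg ρ]

lemma IsEulerSol.exists_support_bound (h : IsEulerSol ω u) (T : ℝ) :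
    ∃ R, ∀ t ∈ Icc 0 T, ∀ x, R < ‖x‖ → ω t x = 0 := by
  obtain ⟨R, hR⟩ := IsEulerSol.exists_suppLe_Icc h T
  exact ⟨R, fun t ht x hx => (hR t ht).eq_zero hx⟩

/-- The weak transport identity at positive times. -/
lemma IsEulerSol.hasDerivAt_weighted (h : IsEulerSol ω u) {Φ : ℝ → ℝ × ℝ → ℝ}
    (hΦ : ∀ t, 0 < t → ∀ x, ContDiffAt ℝ 1 (uncurry Φ) (t, x)) {t : ℝ} (ht : 0 < t) :
    Integrable (fun x => ω t x * (deriv (fun s => Φ s x) t + fderiv ℝ (Φ t) x (u t x))) ∧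
      HasDerivAt (fun t => ∫ x, Φ t x * ω t x)
        (∫ x, ω t x * (deriv (fun s => Φ s x) t + fderiv ℝ (Φ t) x (u t x))) t := by
  obtain ⟨R, hR⟩ := IsEulerSol.exists_support_bound h (2 * t)
  exact (IsEulerSol.hasDerivAt_integral h (f := fun r => r) (Φ := Φ) contDiff_id rfl
    (a := t / 2) (b := 2 * t) (R := R) (by positivity)
    (fun s hs x => hΦ s (by linarith [hs.1]) x)
    (fun s hs x hx => by rw [hR s ⟨by linarith [hs.1], hs.2⟩ x hx, mul_zero])).2 t
    ⟨by linarith, by linarith⟩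

end HalfPlane

namespace HalfPlane
open MeasureTheory Filter Set Metric Function Topology

/-! ### Momentum of a vorticity profile -/

variable {w : ℝ × ℝ → ℝ}

lemma volume_plane_prod :
    (volume : Measure ((ℝ × ℝ) × (ℝ × ℝ))) = (volume : Measure (ℝ × ℝ)).prod volume := rfl

lemma IsProfile.integrable_mul (hw : IsProfile w) {ξ : ℝ × ℝ → ℝ} (hξ : Continuous ξ) :
    Integrable fun x => ξ x * w x :=
  (hξ.mul hw.cont).integrable_of_hasCompactSupport hw.compactSupp.mul_left

lemma IsProfile.integrable_kernel (hw : IsProfile w) {ξ : ℝ × ℝ → ℝ} (hξ : Continuous ξ)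
    {F : (ℝ × ℝ) → (ℝ × ℝ) → ℝ} (hm : Measurable (uncurry F)) {c : ℝ} (hc : 0 < c)
    (hF : ∀ x ∈ Hplane, ∀ y ∈ Hplane, x ≠ y → |F x y| ≤ c * ‖x - y‖ ^ (-1 : ℝ)) :
    Integrable fun z : (ℝ × ℝ) × (ℝ × ℝ) => ξ z.1 * w z.1 * w z.2 * F z.1 z.2 := by
  refine hw.integrable_prod_kernel (A := fun x => c * (ξ x * w x))
    ((hw.integrable_mul hξ).const_mul c) ?_ (fun x hx => by rw [hw.eq_zero hx]; simp) ?_ ?_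
  · refine Measurable.aestronglyMeasurable ?_
    have := hw.cont.measurable
    have := hξ.measurable
    have : Measurable fun z : (ℝ × ℝ) × (ℝ × ℝ) => F z.1 z.2 := hm
    fun_prop
  · intro x hx y hy hxy
    simp only [abs_mul, abs_of_pos hc]
    have := mul_le_mul_of_nonneg_left (hF x hx y hy hxy)
      (by positivity : 0 ≤ |ξ x| * |w x| * |w y|)
    linarith
  · rintro x y (h | h)
    · simp only [(mul_eq_zero.1 h).resolve_left hc.ne', zero_mul]
    · simp only [h, mul_zero, zero_mul]


lemma IsProfile.integral_clm_vel (hw : IsProfile w) {ξ : ℝ × ℝ → ℝ} (hξ : Continuous ξ)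
    {ℓ : (ℝ × ℝ) →L[ℝ] ℝ} (hℓ : ∀ v, |ℓ v| ≤ ‖v‖) :
    ∫ x, w x * (ξ x * ℓ (vel w x)) =
      ∫ z : (ℝ × ℝ) × (ℝ × ℝ), ξ z.1 * w z.1 * w z.2 * ℓ (Kker z.1 z.2) := by
  have hi : Integrable fun z : (ℝ × ℝ) × (ℝ × ℝ) => ξ z.1 * w z.1 * w z.2 * ℓ (Kker z.1 z.2) :=
    hw.integrable_kernel hξ (F := fun x y => ℓ (Kker x y))
      (ℓ.continuous.measurable.comp measurable_Kker) one_pos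
      fun x hx y hy hxy => by
        rw [one_mul]; exact (hℓ _).trans (norm_Kker_le hx hy hxy)
  rw [volume_plane_prod, integral_prod _ hi]
  refine integral_congr_ae (Eventually.of_forall fun x => ?_)
  simp only
  by_cases hx : x ∈ Hplane
  · rw [hw.vel_eq, ← ℓ.integral_comp_comm (hw.integrable_smul_Kker hx), ← integral_const_mul,
      ← integral_const_mul]
    refine integral_congr_ae (Eventually.of_forall fun y => ?_)
    simp only [map_smul, smul_eq_mul]
    ring
  · simp [hw.eq_zero hx]

lemma planeKer_neg (z : ℝ × ℝ) : planeKer (-z) = -planeKer z := by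
  have h : nrm (-z) = nrm z := by simp [nrm]
  rw [planeKer, planeKer, h]
  ext <;> simp [perp]

lemma nrm_sub_pbar_comm (x y : ℝ × ℝ) : nrm (x - pbar y) = nrm (y - pbar x) := by
  simp only [nrm, pbar, Prod.fst_sub, Prod.snd_sub]
  congr 1
  ring

lemma Kker_snd_swap (x y : ℝ × ℝ) : (Kker y x).2 = -(Kker x y).2 := by
  have h1 : y - x = -(x - y) := by abel
  rw [Kker_eq, Kker_eq, h1, planeKer_neg, planeKer, planeKer, planeKer, nrm_sub_pbar_comm y x]
  simp [perp, pbar]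
  ring

lemma integral_antisymm {F : (ℝ × ℝ) × (ℝ × ℝ) → ℝ} (h : ∀ z, F z.swap = -F z) :
    ∫ z, F z = 0 := by
  have h1 : ∫ z : (ℝ × ℝ) × (ℝ × ℝ), F z.swap = ∫ z, F z := integral_prod_swap F
  simp only [h, integral_neg] at h1
  linarith

lemma IsProfile.integral_vel_snd (hw : IsProfile w) : ∫ x, w x * (vel w x).2 = 0 := by
  have h1 := hw.integral_clm_vel (ξ := fun _ => 1) continuous_const
    (ℓ := ContinuousLinearMap.snd ℝ ℝ ℝ) (fun v => norm_snd_le v)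
  simp only [one_mul, ContinuousLinearMap.coe_snd'] at h1
  rw [h1]
  refine integral_antisymm fun z => ?_
  simp only [Prod.fst_swap, Prod.snd_swap, Kker_snd_swap z.1 z.2]
  ring

/-- The contribution of the image vorticity to the horizontal velocity. -/
noncomputable def imageKer (x y : ℝ × ℝ) : ℝ := (x.2 + y.2) / (2 * Real.pi * nrm (x - pbar y) ^ 2)

lemma Kker_fst (x y : ℝ × ℝ) : (Kker x y).1 = (planeKer (x - y)).1 + imageKer x y := by
  rw [Kker_eq, imageKer, planeKer, planeKer]
  simp [perp, pbar]
  ring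

lemma measurable_imageKer : Measurable (uncurry imageKer) := by
  unfold imageKer
  have := measurable_nrm
  have := measurable_pbar
  simp only [uncurry_def]
  fun_prop

lemma abs_imageKer_le {x y : ℝ × ℝ} (hx : x ∈ Hplane) (hy : y ∈ Hplane) (hxy : x ≠ y) :
    |imageKer x y| ≤ 1 * ‖x - y‖ ^ (-1 : ℝ) := by
  have h0 : 0 < ‖x - y‖ := norm_pos_iff.2 (sub_ne_zero.2 hxy)
  have h2 := norm_planeKer_le (x - pbar y)
  have h3 : ‖x - pbar y‖ ^ (-1 : ℝ) ≤ ‖x - y‖ ^ (-1 : ℝ) :=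
    Real.rpow_le_rpow_of_nonpos h0 (norm_sub_le_norm_sub_pbar hx hy) (by norm_num)
  have h4 : imageKer x y = -(planeKer (x - pbar y)).1 := by
    rw [imageKer, planeKer]
    simp [perp, pbar]
    ring
  have h5 := norm_fst_le (planeKer (x - pbar y))
  rw [h4, abs_neg]
  rw [Real.norm_eq_abs] at h5
  have : 0 ≤ ‖x - pbar y‖ ^ (-1 : ℝ) := by positivity
  linarith

lemma imageKer_nonneg {x y : ℝ × ℝ} (hx : x ∈ Hplane) (hy : y ∈ Hplane) : 0 ≤ imageKer x y := by
  have hx' : 0 < x.2 := hx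
  have hy' : 0 < y.2 := hy
  unfold imageKer
  positivity

lemma IsProfile.integrable_imageKer (hw : IsProfile w) {ξ : ℝ × ℝ → ℝ} (hξ : Continuous ξ) :
    Integrable fun z : (ℝ × ℝ) × (ℝ × ℝ) => ξ z.1 * w z.1 * w z.2 * imageKer z.1 z.2 :=
  hw.integrable_kernel hξ measurable_imageKer one_pos fun _ hx _ hy hxy => abs_imageKer_le hx hy hxy

/-- The weighted horizontal momentum is bounded below by the image contribution up to the
oscillation of the weight. -/
lemma IsProfile.integral_vel_fst_ge (hw : IsProfile w) (hw0 : ∀ x, 0 ≤ w x) {ξ : ℝ × ℝ → ℝ}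
    (hξ : Continuous ξ) {L : ℝ} (hL : 0 ≤ L) (hlip : ∀ x y, |ξ x - ξ y| ≤ L * ‖x - y‖) :
    (∫ z : (ℝ × ℝ) × (ℝ × ℝ), ξ z.1 * w z.1 * w z.2 * imageKer z.1 z.2) - L * (∫ x, w x) ^ 2 ≤
      ∫ x, w x * (ξ x * (vel w x).1) := by
  have h1 := hw.integral_clm_vel hξ
    (ℓ := ContinuousLinearMap.fst ℝ ℝ ℝ) (fun v => norm_fst_le v)
  simp only [ContinuousLinearMap.coe_fst'] at h1
  have hpm : Measurable (uncurry fun x y : ℝ × ℝ => (planeKer (x - y)).1) :=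
    (measurable_planeKer.comp (measurable_fst.sub measurable_snd)).fst
  have hi := hw.integrable_kernel hξ (F := fun x y => (planeKer (x - y)).1) hpm one_pos
    fun x _ y _ _ => by
      have a := norm_fst_le (planeKer (x - y))
      have b := norm_planeKer_le (x - y)
      have c : 0 ≤ ‖x - y‖ ^ (-1 : ℝ) := by positivity
      rw [Real.norm_eq_abs] at a
      linarith
  have hJ := hw.integrable_imageKer hξ
  rw [h1]
  have e1 : ∫ z : (ℝ × ℝ) × (ℝ × ℝ), ξ z.1 * w z.1 * w z.2 * (Kker z.1 z.2).1 =
      (∫ z : (ℝ × ℝ) × (ℝ × ℝ), ξ z.1 * w z.1 * w z.2 * (planeKer (z.1 - z.2)).1) +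
      ∫ z : (ℝ × ℝ) × (ℝ × ℝ), ξ z.1 * w z.1 * w z.2 * imageKer z.1 z.2 := by
    rw [← integral_add hi hJ]
    refine integral_congr_ae (Eventually.of_forall fun z => ?_)
    simp only [Kker_fst]
    ring
  have hsw : ∫ z : (ℝ × ℝ) × (ℝ × ℝ), ξ z.2 * w z.1 * w z.2 * (planeKer (z.1 - z.2)).1 =
      -∫ z : (ℝ × ℝ) × (ℝ × ℝ), ξ z.1 * w z.1 * w z.2 * (planeKer (z.1 - z.2)).1 := by
    have h2 := integral_prod_swap (μ := (volume : Measure (ℝ × ℝ)))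
      (ν := (volume : Measure (ℝ × ℝ)))
      (fun z : (ℝ × ℝ) × (ℝ × ℝ) => ξ z.1 * w z.1 * w z.2 * (planeKer (z.1 - z.2)).1)
    rw [volume_plane_prod, ← h2, ← integral_neg]
    refine integral_congr_ae (Eventually.of_forall fun z => ?_)
    have h3 : z.2 - z.1 = -(z.1 - z.2) := by abel
    simp only [Prod.fst_swap, Prod.snd_swap, h3, planeKer_neg,
      Prod.fst_neg]
    ring
  have hi2 : Integrable fun z : (ℝ × ℝ) × (ℝ × ℝ) =>
      ξ z.2 * w z.1 * w z.2 * (planeKer (z.1 - z.2)).1 := by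
    have := hi.swap.neg
    refine this.congr (Eventually.of_forall fun z => ?_)
    have h3 : z.2 - z.1 = -(z.1 - z.2) := by abel
    simp only [Pi.neg_apply, comp_apply, Prod.fst_swap, Prod.snd_swap, h3, planeKer_neg,
      Prod.fst_neg]
    ring
  have hdiff : |(∫ z : (ℝ × ℝ) × (ℝ × ℝ), ξ z.1 * w z.1 * w z.2 * (planeKer (z.1 - z.2)).1) -
      ∫ z : (ℝ × ℝ) × (ℝ × ℝ), ξ z.2 * w z.1 * w z.2 * (planeKer (z.1 - z.2)).1| ≤
      L * (∫ x, w x) ^ 2 := by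
    rw [← integral_sub hi hi2, ← Real.norm_eq_abs, sq, ← integral_prod_mul, ← integral_const_mul]
    refine norm_integral_le_of_norm_le ((hw.integrable.mul_prod hw.integrable).const_mul L)
      (Eventually.of_forall fun z => ?_)
    have b := (norm_fst_le _).trans (norm_planeKer_le (z.1 - z.2))
    rw [Real.norm_eq_abs] at b ⊢
    have e : ξ z.1 * w z.1 * w z.2 * (planeKer (z.1 - z.2)).1 -
        ξ z.2 * w z.1 * w z.2 * (planeKer (z.1 - z.2)).1 =
        w z.1 * w z.2 * ((ξ z.1 - ξ z.2) * (planeKer (z.1 - z.2)).1) := by ring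
    have p := mul_nonneg (hw0 z.1) (hw0 z.2)
    rw [e, abs_mul, abs_of_nonneg p, abs_mul]
    have c : |ξ z.1 - ξ z.2| * |(planeKer (z.1 - z.2)).1| ≤ L := by
      by_cases hz : ‖z.1 - z.2‖ = 0
      · have := hlip z.1 z.2
        rw [hz, mul_zero] at this
        rw [abs_nonpos_iff.1 (abs_nonpos_iff.2 (abs_nonpos_iff.1 this))]
        simpa using hL
      · calc _ ≤ (L * ‖z.1 - z.2‖) * (2⁻¹ * ‖z.1 - z.2‖ ^ (-1 : ℝ)) := by
              gcongr
              exact hlip _ _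
          _ = L * 2⁻¹ := by
              rw [Real.rpow_neg_one]
              field_simp
          _ ≤ L := by linarith
    nlinarith
  rw [hsw, abs_le] at hdiff
  have := mul_nonneg hL (sq_nonneg (∫ x, w x))
  rw [e1]
  linarith [hdiff.1]

end HalfPlane

namespace HalfPlane
open MeasureTheory Filter Set Metric Function Topology

variable {ω : ℝ → ℝ × ℝ → ℝ} {u : ℝ → ℝ × ℝ → ℝ × ℝ} {w : ℝ × ℝ → ℝ}

/-- Conservation of the vertical impulse. -/
lemma IsEulerSol.integral_snd_eq (h : IsEulerSol ω u) {t : ℝ} (ht : 0 ≤ t) :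
    ∫ x : ℝ × ℝ, x.2 * ω t x = ∫ x : ℝ × ℝ, x.2 * ω 0 x := by
  obtain ⟨R, hR⟩ := IsEulerSol.exists_support_bound h t
  obtain ⟨h1, h2⟩ := IsEulerSol.hasDerivAt_integral h (f := fun r => r) (Φ := fun _ x => x.2)
    contDiff_id rfl (a := 0) (b := t) (R := R) le_rfl
    (fun s _ x => by fun_prop)
    (fun s hs x hx => by rw [hR s hs x hx, mul_zero])
  refine eqOn_of_hasDerivAt_zero h1 (fun τ hτ => ?_) (left_mem_Icc.2 ht) (right_mem_Icc.2 ht)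
  have h3 := (h2 τ hτ).2
  have h4 : ∀ x v : ℝ × ℝ, fderiv ℝ (fun x : ℝ × ℝ => x.2) x v = v.2 := fun x v => by
    rw [(hasFDerivAt_snd (𝕜 := ℝ) (p := x)).fderiv]; rfl
  simp only [deriv_const, zero_add, h4, IsEulerSol.velocity_eq h τ,
    (IsEulerSol.profile h τ).integral_vel_snd] at h3
  exact h3

lemma integral_mul_one_add_norm_inv (hw : IsProfile w) (hw0 : ∀ x, 0 ≤ w x) {W : ℝ}
    (hW : ∀ y, |w y| ≤ W) {A : ℝ × ℝ → ℝ} (hA : Integrable A) (hA0 : ∀ x, 0 ≤ A x) :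
    Integrable (fun z : (ℝ × ℝ) × (ℝ × ℝ) => A z.1 * w z.2 * (1 + ‖z.1 - z.2‖ ^ (-1 : ℝ))) ∧
    ∫ z : (ℝ × ℝ) × (ℝ × ℝ), A z.1 * w z.2 * (1 + ‖z.1 - z.2‖ ^ (-1 : ℝ)) ≤
      (∫ x, A x) * ((∫ z in ball (0 : ℝ × ℝ) 1, ‖z‖ ^ (-1 : ℝ)) * W + 2 * ∫ x, w x) := by
  have i1 : Integrable fun z : (ℝ × ℝ) × (ℝ × ℝ) => A z.1 * w z.2 := hA.mul_prod hw.integrable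
  have i2 := integrable_prod_norm_rpow zero_le_one one_lt_two hA hw.integrable hW
  have hi : Integrable (fun z : (ℝ × ℝ) × (ℝ × ℝ) =>
      A z.1 * w z.2 * (1 + ‖z.1 - z.2‖ ^ (-1 : ℝ))) := by
    refine (i1.add i2).congr (Eventually.of_forall fun z => ?_)
    simp only [Pi.add_apply, abs_of_nonneg (hA0 _), abs_of_nonneg (hw0 _)]
    ring
  refine ⟨hi, ?_⟩
  rw [volume_plane_prod] at hi ⊢
  rw [integral_prod _ hi, ← integral_mul_const]
  refine integral_mono hi.integral_prod_left (hA.mul_const _) fun x => ?_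
  simp only
  obtain ⟨j1, j2⟩ := integrable_mul_norm_rpow zero_le_one one_lt_two hw.integrable hW x
  simp only [abs_of_nonneg (hw0 _)] at j1 j2
  have e : ∫ y, A x * w y * (1 + ‖x - y‖ ^ (-1 : ℝ)) =
      A x * ((∫ y, w y) + ∫ y, w y * ‖x - y‖ ^ (-1 : ℝ)) := by
    rw [← integral_add hw.integrable j1, ← integral_const_mul]
    refine integral_congr_ae (Eventually.of_forall fun y => ?_)
    simp only
    ring
  rw [e]
  exact mul_le_mul_of_nonneg_left (by linarith) (hA0 x)

lemma integral_weight_le (hw : IsProfile w) (hw0 : ∀ x, 0 ≤ w x) {W : ℝ}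
    (hW : ∀ y, |w y| ≤ W) :
    Integrable (fun z : (ℝ × ℝ) × (ℝ × ℝ) =>
      w z.1 * w z.2 * ((1 + (z.1.2 + z.2.2)) * (1 + ‖z.1 - z.2‖ ^ (-1 : ℝ)))) ∧
    ∫ z : (ℝ × ℝ) × (ℝ × ℝ),
      w z.1 * w z.2 * ((1 + (z.1.2 + z.2.2)) * (1 + ‖z.1 - z.2‖ ^ (-1 : ℝ))) ≤
      ((∫ x, w x) + 2 * ∫ x : ℝ × ℝ, x.2 * w x) *
        ((∫ z in ball (0 : ℝ × ℝ) 1, ‖z‖ ^ (-1 : ℝ)) * W + 2 * ∫ x, w x) := by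
  have hsnd : ∀ x : ℝ × ℝ, 0 ≤ x.2 * w x := fun x => by
    by_cases hx : x ∈ Hplane
    · exact mul_nonneg (le_of_lt hx) (hw0 x)
    · rw [hw.eq_zero hx, mul_zero]
  have i2 : Integrable fun x : ℝ × ℝ => x.2 * w x := hw.integrable_mul continuous_snd
  obtain ⟨a1, a2⟩ := integral_mul_one_add_norm_inv hw hw0 hW hw.integrable hw0
  obtain ⟨b1, b2⟩ := integral_mul_one_add_norm_inv hw hw0 hW i2 hsnd
  have hsw := integral_prod_swap (μ := (volume : Measure (ℝ × ℝ)))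
      (ν := (volume : Measure (ℝ × ℝ)))
    (fun z : (ℝ × ℝ) × (ℝ × ℝ) => z.1.2 * w z.1 * w z.2 * (1 + ‖z.1 - z.2‖ ^ (-1 : ℝ)))
  have hsi : Integrable fun z : (ℝ × ℝ) × (ℝ × ℝ) =>
      z.swap.1.2 * w z.swap.1 * w z.swap.2 * (1 + ‖z.swap.1 - z.swap.2‖ ^ (-1 : ℝ)) := b1.swap
  have e : (fun z : (ℝ × ℝ) × (ℝ × ℝ) =>
      w z.1 * w z.2 * ((1 + (z.1.2 + z.2.2)) * (1 + ‖z.1 - z.2‖ ^ (-1 : ℝ)))) =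
      fun z => (w z.1 * w z.2 * (1 + ‖z.1 - z.2‖ ^ (-1 : ℝ)) +
        z.1.2 * w z.1 * w z.2 * (1 + ‖z.1 - z.2‖ ^ (-1 : ℝ))) +
        z.swap.1.2 * w z.swap.1 * w z.swap.2 * (1 + ‖z.swap.1 - z.swap.2‖ ^ (-1 : ℝ)) := by
    funext z
    simp only [Prod.fst_swap, Prod.snd_swap, norm_sub_rev z.2 z.1]
    ring
  rw [e]
  refine ⟨(a1.add b1).add hsi, ?_⟩
  have hab : Integrable fun z : (ℝ × ℝ) × (ℝ × ℝ) =>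
    w z.1 * w z.2 * (1 + ‖z.1 - z.2‖ ^ (-1 : ℝ)) +
        z.1.2 * w z.1 * w z.2 * (1 + ‖z.1 - z.2‖ ^ (-1 : ℝ)) := a1.add b1
  rw [integral_add hab hsi, integral_add a1 b1]
  rw [← volume_plane_prod] at hsw
  rw [hsw]
  linarith

lemma log_cube_le {σ r a : ℝ} (hσ : 0 < σ) (hr : 0 < r) (ha : 0 < a) (h : a ≤ σ ^ 2) :
    Real.log (1 + a / r ^ 2) ^ 3 ≤ 432 * (σ / (r ^ 2 + a)) * ((1 + σ) * (1 + r⁻¹)) ^ 2 := by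
  have hL0 : 0 ≤ Real.log (1 + a / r ^ 2) := Real.log_nonneg (by
    have : 0 < a / r ^ 2 := by positivity
    linarith)
  have hri : 0 < r⁻¹ := by positivity
  rcases le_or_gt a (r ^ 2) with har | har
  · have h1 : Real.log (1 + a / r ^ 2) ≤ a / r ^ 2 := by
      have := Real.log_le_sub_one_of_pos (show 0 < 1 + a / r ^ 2 by positivity)
      linarith
    have h2 : a / r ^ 2 ≤ 1 := (div_le_one (by positivity)).2 har
    have h3 : Real.log (1 + a / r ^ 2) ^ 3 ≤ a / r ^ 2 := by
      calc _ ≤ (a / r ^ 2) ^ 3 := by gcongr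
        _ = (a / r ^ 2) * (a / r ^ 2) ^ 2 := by ring
        _ ≤ (a / r ^ 2) * 1 := by
          gcongr
          exact pow_le_one₀ (by positivity) h2
        _ = _ := mul_one _
    have h4 : a / r ^ 2 ≤ 2 * (σ ^ 2 / (r ^ 2 + a)) := by
      rw [← mul_div_assoc, div_le_div_iff₀ (by positivity) (by positivity)]
      nlinarith [mul_pos ha ha, mul_le_mul h har ha.le (sq_nonneg σ)]
    have h5 : 1 ≤ (1 + r⁻¹) ^ 2 := one_le_pow₀ (by linarith)
    have h6 : σ ≤ ((1 + σ) * (1 + r⁻¹)) ^ 2 := by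
      rw [mul_pow]
      nlinarith [sq_nonneg σ]
    calc _ ≤ 2 * (σ ^ 2 / (r ^ 2 + a)) := h3.trans h4
      _ = 2 * (σ / (r ^ 2 + a)) * σ := by ring
      _ ≤ 432 * (σ / (r ^ 2 + a)) * ((1 + σ) * (1 + r⁻¹)) ^ 2 := by
        gcongr
        norm_num
  · set q := √a / r with hq
    have hsa : √a ^ 2 = a := Real.sq_sqrt ha.le
    have hsq : √a ≤ σ := Real.sqrt_le_iff.2 ⟨hσ.le, h⟩
    have hrq : r ≤ √a := Real.le_sqrt_of_sq_le har.le
    have hq0 : 0 < q := by positivity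
    have hq1 : 1 ≤ q := (one_le_div hr).2 hrq
    have hqσ : q ≤ σ / r := by rw [hq]; gcongr
    have hL : Real.log (1 + a / r ^ 2) ≤ 2 * (3 * (1 + q) ^ (1 / 3 : ℝ)) := by
      have e1 : 1 + a / r ^ 2 ≤ (1 + q) ^ 2 := by
        have : q ^ 2 = a / r ^ 2 := by rw [hq, div_pow, hsa]
        nlinarith
      have e2 := Real.log_le_log (by positivity) e1
      rw [Real.log_pow] at e2
      have e3 := Real.log_le_rpow_div (show 0 ≤ 1 + q by positivity)
        (show (0 : ℝ) < 1 / 3 by norm_num)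
      push_cast at e2
      have e4 : (1 + q) ^ (1 / 3 : ℝ) / (1 / 3) = 3 * (1 + q) ^ (1 / 3 : ℝ) := by ring
      linarith
    have hL3 : Real.log (1 + a / r ^ 2) ^ 3 ≤ 432 * (σ / r) := by
      calc _ ≤ (2 * (3 * (1 + q) ^ (1 / 3 : ℝ))) ^ 3 := by gcongr
        _ = 216 * ((1 + q) ^ (1 / 3 : ℝ)) ^ 3 := by ring
        _ = 216 * (1 + q) := by
          rw [← Real.rpow_natCast, ← Real.rpow_mul (by positivity)]
          norm_num
        _ ≤ 432 * (σ / r) := by linarith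
    have hX : σ⁻¹ ≤ 2 * (σ / (r ^ 2 + a)) := by
      rw [← mul_div_assoc, inv_le_comm₀ hσ (by positivity), inv_div, div_le_iff₀ (by positivity)]
      nlinarith
    have hY : 4 * (σ ^ 2 * r⁻¹) ≤ ((1 + σ) * (1 + r⁻¹)) ^ 2 := by
      rw [mul_pow]
      have y1 : σ ^ 2 ≤ (1 + σ) ^ 2 := by gcongr; linarith
      have y2 : 4 * r⁻¹ ≤ (1 + r⁻¹) ^ 2 := by nlinarith [sq_nonneg (1 - r⁻¹)]
      calc 4 * (σ ^ 2 * r⁻¹) = σ ^ 2 * (4 * r⁻¹) := by ring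
        _ ≤ _ := by gcongr
    calc _ ≤ 432 * (σ / r) := hL3
      _ = 108 * σ⁻¹ * (4 * (σ ^ 2 * r⁻¹)) := by field_simp; norm_num
      _ ≤ 108 * (2 * (σ / (r ^ 2 + a))) * (((1 + σ) * (1 + r⁻¹)) ^ 2) := by gcongr
      _ ≤ _ := by
        have : 0 ≤ (σ / (r ^ 2 + a)) * (((1 + σ) * (1 + r⁻¹)) ^ 2) := by positivity
        nlinarith

lemma log_le_add {σ r a η : ℝ} (hσ : 0 < σ) (hr : 0 < r) (ha : 0 < a) (h : a ≤ σ ^ 2)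
    (hη : 0 < η) :
    Real.log (1 + a / r ^ 2) ≤
      η * ((1 + σ) * (1 + r⁻¹)) + 432 / η ^ 2 * (σ / (r ^ 2 + a)) := by
  have hc := log_cube_le hσ hr ha h
  set L := Real.log (1 + a / r ^ 2)
  set Y := (1 + σ) * (1 + r⁻¹)
  set X := σ / (r ^ 2 + a)
  have hY : 0 < Y := by positivity
  have hX : 0 < X := by positivity
  rcases le_or_gt L (η * Y) with h1 | h1
  · have : 0 ≤ 432 / η ^ 2 * X := by positivity
    linarith
  · have hL : 0 < L := lt_trans (by positivity) h1
    have h2 : Y ^ 2 ≤ L ^ 2 / η ^ 2 := by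
      rw [le_div_iff₀ (by positivity), ← mul_pow]
      have : Y * η = η * Y := mul_comm _ _
      rw [this]
      gcongr
    have h3 : L ^ 3 ≤ 432 * X * (L ^ 2 / η ^ 2) := hc.trans (by gcongr)
    have h4 : L ≤ 432 / η ^ 2 * X := by
      have : L ^ 2 * L ≤ L ^ 2 * (432 / η ^ 2 * X) := by
        calc L ^ 2 * L = L ^ 3 := by ring
          _ ≤ _ := h3
          _ = _ := by ring
      exact le_of_mul_le_mul_left this (by positivity)
    have : 0 ≤ η * Y := by positivity
    linarith

end HalfPlane

namespace HalfPlane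
open MeasureTheory Filter Set Metric Function Topology

variable {ω : ℝ → ℝ × ℝ → ℝ} {u : ℝ → ℝ × ℝ → ℝ × ℝ} {w : ℝ × ℝ → ℝ}

/-! ### The regularized Green function -/

/-- The field `z / (|z|² + ε)`. -/
noncomputable def radKer (ε : ℝ) (z : ℝ × ℝ) : ℝ × ℝ := (z.1 ^ 2 + z.2 ^ 2 + ε)⁻¹ • z

/-- The Euclidean inner product. -/
def dotp (a b : ℝ × ℝ) : ℝ := a.1 * b.1 + a.2 * b.2

lemma abs_dotp_le (a b : ℝ × ℝ) : |dotp a b| ≤ 2 * (‖a‖ * ‖b‖) := by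
  have h1 := norm_fst_le a
  have h2 := norm_snd_le a
  have h3 := norm_fst_le b
  have h4 := norm_snd_le b
  rw [Real.norm_eq_abs] at h1 h2 h3 h4
  calc |dotp a b| ≤ |a.1| * |b.1| + |a.2| * |b.2| := by
        rw [← abs_mul, ← abs_mul]; exact abs_add_le _ _
    _ ≤ ‖a‖ * ‖b‖ + ‖a‖ * ‖b‖ := by gcongr
    _ = _ := by ring

lemma norm_sq_le (z : ℝ × ℝ) : ‖z‖ ^ 2 ≤ z.1 ^ 2 + z.2 ^ 2 := by
  rw [← nrm_sq]
  gcongr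
  exact norm_le_nrm z

lemma norm_radKer_le {ε : ℝ} (hε : 0 ≤ ε) (z : ℝ × ℝ) : ‖radKer ε z‖ ≤ ‖z‖ ^ (-1 : ℝ) := by
  rw [Real.rpow_neg_one]
  by_cases hz : z = 0
  · simp [hz, radKer]
  have hz' : 0 < ‖z‖ := norm_pos_iff.2 hz
  have h := norm_sq_le z
  have hq : 0 < z.1 ^ 2 + z.2 ^ 2 + ε := by nlinarith
  rw [radKer, norm_smul, Real.norm_of_nonneg (by positivity), inv_mul_le_iff₀ hq,
    ← div_eq_mul_inv, le_div_iff₀ hz']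
  nlinarith

lemma norm_radKer_sub_le {ε : ℝ} (hε : 0 < ε) {z : ℝ × ℝ} (hz : z ≠ 0) :
    ‖radKer ε z - radKer 0 z‖ ≤ ε ^ (1 / 4 : ℝ) * ‖z‖ ^ (-(3 / 2) : ℝ) := by
  have hs : 0 < ‖z‖ := norm_pos_iff.2 hz
  have h := norm_sq_le z
  set s := ‖z‖ with hsdef
  set q := z.1 ^ 2 + z.2 ^ 2 with hqdef
  have hq : 0 < q := by nlinarith
  have e : radKer ε z - radKer 0 z = (-(ε / (q * (q + ε)))) • z := by
    rw [radKer, radKer, ← sub_smul, add_zero, ← hqdef]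
    congr 1
    field_simp
    ring
  have hr1 : ε / (s ^ 2 + ε) ≤ (ε / s ^ 2) ^ (1 / 4 : ℝ) := by
    calc ε / (s ^ 2 + ε) ≤ (ε / (s ^ 2 + ε)) ^ (1 / 4 : ℝ) := by
          refine Real.self_le_rpow_of_le_one (by positivity) ?_ (by norm_num)
          rw [div_le_one (by positivity)]
          nlinarith
      _ ≤ _ := by
          gcongr
          linarith
  have hr2 : (ε / s ^ 2) ^ (1 / 4 : ℝ) * s⁻¹ = ε ^ (1 / 4 : ℝ) * s ^ (-(3 / 2) : ℝ) := by
    rw [Real.div_rpow hε.le (by positivity), ← Real.rpow_natCast s 2, ← Real.rpow_mul hs.le,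
      div_eq_mul_inv, ← Real.rpow_neg hs.le, mul_assoc, ← Real.rpow_neg_one s, ← Real.rpow_add hs]
    norm_num
  rw [e, norm_smul, norm_neg, Real.norm_of_nonneg (by positivity), ← hsdef, ← hr2]
  calc ε / (q * (q + ε)) * s ≤ ε / (s ^ 2 * (s ^ 2 + ε)) * s := by gcongr
    _ = ε / (s ^ 2 + ε) * s⁻¹ := by field_simp
    _ ≤ _ := by gcongr

/-- The gradient in the first variable of the regularized Green function. -/
noncomputable def gradGreen (ε : ℝ) (x y : ℝ × ℝ) : ℝ × ℝ :=
  radKer ε (x - pbar y) - radKer ε (x - y)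

/-- The regularized Green function of the half-plane. -/
noncomputable def green (ε : ℝ) (x y : ℝ × ℝ) : ℝ :=
  (Real.log ((x.1 - y.1) ^ 2 + (x.2 + y.2) ^ 2 + ε) -
    Real.log ((x.1 - y.1) ^ 2 + (x.2 - y.2) ^ 2 + ε)) / 2

lemma green_comm (ε : ℝ) (x y : ℝ × ℝ) : green ε x y = green ε y x := by
  rw [green, green, add_comm y.2, show (y.1 - x.1) ^ 2 = (x.1 - y.1) ^ 2 by ring,
    show (y.2 - x.2) ^ 2 = (x.2 - y.2) ^ 2 by ring]

lemma contDiff_green {ε : ℝ} (hε : 0 < ε) :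
    ContDiff ℝ 1 fun z : (ℝ × ℝ) × (ℝ × ℝ) => green ε z.1 z.2 := by
  unfold green
  refine ContDiff.div_const (ContDiff.sub (ContDiff.log (by fun_prop) fun z => ?_)
    (ContDiff.log (by fun_prop) fun z => ?_)) _ <;> positivity

lemma fderiv_green {ε : ℝ} (hε : 0 < ε) (x y v : ℝ × ℝ) :
    fderiv ℝ (fun x => green ε x y) x v = dotp (gradGreen ε x y) v := by
  have a := (hasFDerivAt_fst (𝕜 := ℝ) (p := x)).sub_const y.1
  have b := (hasFDerivAt_snd (𝕜 := ℝ) (p := x)).add_const y.2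
  have c := (hasFDerivAt_snd (𝕜 := ℝ) (p := x)).sub_const y.2
  have h1 := (((a.pow 2).add (b.pow 2)).add_const ε).log
    (by simp only [Pi.add_apply]; positivity)
  have h2 := (((a.pow 2).add (c.pow 2)).add_const ε).log
    (by simp only [Pi.add_apply]; positivity)
  have h3 := (h1.sub h2).mul_const (1 / 2)
  have h4 : HasFDerivAt (fun x => green ε x y) _ x :=
    h3.congr_of_eventuallyEq (Eventually.of_forall fun x => by simp [green, div_eq_mul_inv])
  rw [h4.fderiv]
  simp [dotp, gradGreen, radKer, pbar]
  ring

lemma dotp_gradGreen_zero (x y v : ℝ × ℝ) :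
    dotp (gradGreen 0 x y) v = 2 * Real.pi * ((Kker x y).1 * v.2 - (Kker x y).2 * v.1) := by
  rw [Kker_eq, planeKer, planeKer, nrm_sq, nrm_sq]
  have := Real.pi_ne_zero
  simp [dotp, gradGreen, radKer, pbar, perp]
  field_simp
  ring

lemma measurable_gradGreen (ε : ℝ) :
    Measurable fun z : (ℝ × ℝ) × (ℝ × ℝ) => gradGreen ε z.1 z.2 := by
  unfold gradGreen radKer
  have := measurable_pbar
  fun_prop

lemma norm_gradGreen_le {ε : ℝ} (hε : 0 ≤ ε) {x y : ℝ × ℝ} (hx : x ∈ Hplane) (hy : y ∈ Hplane)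
    (hxy : x ≠ y) : ‖gradGreen ε x y‖ ≤ 2 * ‖x - y‖ ^ (-1 : ℝ) := by
  have h0 : 0 < ‖x - y‖ := norm_pos_iff.2 (sub_ne_zero.2 hxy)
  have h3 : ‖x - pbar y‖ ^ (-1 : ℝ) ≤ ‖x - y‖ ^ (-1 : ℝ) :=
    Real.rpow_le_rpow_of_nonpos h0 (norm_sub_le_norm_sub_pbar hx hy) (by norm_num)
  have := norm_sub_le (radKer ε (x - pbar y)) (radKer ε (x - y))
  have := norm_radKer_le hε (x - pbar y)
  have := norm_radKer_le hε (x - y)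
  rw [gradGreen]
  linarith

lemma norm_gradGreen_sub_le {ε : ℝ} (hε : 0 < ε) {x y : ℝ × ℝ} (hx : x ∈ Hplane)
    (hy : y ∈ Hplane) (hxy : x ≠ y) :
    ‖gradGreen ε x y - gradGreen 0 x y‖ ≤ 2 * ε ^ (1 / 4 : ℝ) * ‖x - y‖ ^ (-(3 / 2) : ℝ) := by
  have h0 : 0 < ‖x - y‖ := norm_pos_iff.2 (sub_ne_zero.2 hxy)
  have hb := norm_sub_le_norm_sub_pbar hx hy
  have h3 : ‖x - pbar y‖ ^ (-(3 / 2) : ℝ) ≤ ‖x - y‖ ^ (-(3 / 2) : ℝ) :=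
    Real.rpow_le_rpow_of_nonpos h0 hb (by norm_num)
  have h4 := norm_radKer_sub_le hε (z := x - pbar y) (norm_pos_iff.1 (h0.trans_le hb))
  have h5 := norm_radKer_sub_le hε (sub_ne_zero.2 hxy)
  have h6 := norm_sub_le (radKer ε (x - pbar y) - radKer 0 (x - pbar y))
    (radKer ε (x - y) - radKer 0 (x - y))
  have h7 := mul_le_mul_of_nonneg_left h3 (by positivity : 0 ≤ ε ^ (1 / 4 : ℝ))
  have e : gradGreen ε x y - gradGreen 0 x y = (radKer ε (x - pbar y) - radKer 0 (x - pbar y)) -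
    (radKer ε (x - y) - radKer 0 (x - y)) := by
    simp only [gradGreen]; abel
  rw [e]
  linarith

lemma IsProfile.integral_dotp_gradGreen_zero (hw : IsProfile w) {x : ℝ × ℝ} (hx : x ∈ Hplane) :
    Integrable (fun y => w y * dotp (gradGreen 0 x y) (vel w x)) ∧
      ∫ y, w y * dotp (gradGreen 0 x y) (vel w x) = 0 := by
  have hi := hw.integrable_smul_Kker hx
  have h1 : Integrable fun y => w y * (Kker x y).1 := hi.fst
  have h2 : Integrable fun y => w y * (Kker x y).2 := hi.snd
  have e1 : (vel w x).1 = ∫ y, w y * (Kker x y).1 := by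
    rw [hw.vel_eq]
    exact ((ContinuousLinearMap.fst ℝ ℝ ℝ).integral_comp_comm hi).symm
  have e2 : (vel w x).2 = ∫ y, w y * (Kker x y).2 := by
    rw [hw.vel_eq]
    exact ((ContinuousLinearMap.snd ℝ ℝ ℝ).integral_comp_comm hi).symm
  have e : (fun y => w y * dotp (gradGreen 0 x y) (vel w x)) = fun y =>
      (w y * (Kker x y).1) * (2 * Real.pi * (vel w x).2) -
      (w y * (Kker x y).2) * (2 * Real.pi * (vel w x).1) := by
    funext y
    rw [dotp_gradGreen_zero]
    ring
  rw [e]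
  refine ⟨(h1.mul_const _).sub (h2.mul_const _), ?_⟩
  rw [integral_sub (h1.mul_const _) (h2.mul_const _), integral_mul_const, integral_mul_const,
    ← e1, ← e2]
  ring

lemma IsProfile.measurable_vel (hw : IsProfile w) : Measurable (vel w) := by
  have : StronglyMeasurable fun z : (ℝ × ℝ) × (ℝ × ℝ) => w z.2 • Kker z.1 z.2 :=
    (((hw.cont.measurable.comp measurable_snd)).smul measurable_Kker).stronglyMeasurable
  exact this.integral_prod_right.measurable

lemma IsProfile.integral_dotp_gradGreen_le (hw : IsProfile w) (hw0 : ∀ x, 0 ≤ w x) {W C : ℝ}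
    (hW : ∀ y, |w y| ≤ W) (hC0 : 0 ≤ C) (hC : ∀ x ∈ Hplane, ‖vel w x‖ ≤ C) {ε : ℝ} (hε : 0 < ε) :
    Integrable (fun z : (ℝ × ℝ) × (ℝ × ℝ) =>
      w z.1 * w z.2 * dotp (gradGreen ε z.1 z.2) (vel w z.1)) ∧
    |∫ z : (ℝ × ℝ) × (ℝ × ℝ), w z.1 * w z.2 * dotp (gradGreen ε z.1 z.2) (vel w z.1)| ≤
      4 * C * (∫ x, w x) * ((∫ z in ball (0 : ℝ × ℝ) 1, ‖z‖ ^ (-(3 / 2) : ℝ)) * W + ∫ x, w x) *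
        ε ^ (1 / 4 : ℝ) := by
  have hvm := hw.measurable_vel
  have hgm : ∀ ε, Measurable (uncurry fun x y : ℝ × ℝ => dotp (gradGreen ε x y) (vel w x)) := by
    intro ε
    have := measurable_gradGreen ε
    simp only [dotp, uncurry_def]
    fun_prop
  have hi : Integrable (fun z : (ℝ × ℝ) × (ℝ × ℝ) =>
      w z.1 * w z.2 * dotp (gradGreen ε z.1 z.2) (vel w z.1)) := by
    have := hw.integrable_kernel (ξ := fun _ => 1) continuous_const (hgm ε)
      (c := 4 * C + 1) (by positivity) (fun x hx y hy hxy => by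
        have a := abs_dotp_le (gradGreen ε x y) (vel w x)
        have b := norm_gradGreen_le hε.le hx hy hxy
        have p : 0 ≤ ‖x - y‖ ^ (-1 : ℝ) := by positivity
        calc _ ≤ 2 * ((2 * ‖x - y‖ ^ (-1 : ℝ)) * C) := a.trans (by gcongr; exact hC x hx)
          _ ≤ _ := by nlinarith)
    simpa only [one_mul] using this
  refine ⟨hi, ?_⟩
  set S := (∫ z in ball (0 : ℝ × ℝ) 1, ‖z‖ ^ (-(3 / 2) : ℝ)) * W + ∫ x, w x with hS
  rw [volume_plane_prod] at hi ⊢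
  rw [integral_prod _ hi, ← Real.norm_eq_abs]
  have hrw : 4 * C * (∫ x, w x) * S * ε ^ (1 / 4 : ℝ) =
      ∫ x, w x * (4 * C * S * ε ^ (1 / 4 : ℝ)) := by
    rw [integral_mul_const]; ring
  rw [hrw]
  refine norm_integral_le_of_norm_le (hw.integrable.mul_const _) (Eventually.of_forall fun x => ?_)
  simp only
  by_cases hx : x ∈ Hplane
  swap
  · simp [hw.eq_zero hx]
  obtain ⟨z1, z2⟩ := hw.integral_dotp_gradGreen_zero hx
  obtain ⟨j1, j2⟩ := integrable_mul_norm_rpow (q := 3 / 2) (by norm_num) (by norm_num)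
    hw.integrable hW x
  simp only [abs_of_nonneg (hw0 _)] at j1 j2
  have hbd : ∀ᵐ y, ‖w y * dotp (gradGreen ε x y - gradGreen 0 x y) (vel w x)‖ ≤
      (w y * ‖x - y‖ ^ (-(3 / 2) : ℝ)) * (4 * C * ε ^ (1 / 4 : ℝ)) := by
    have : ∀ᵐ y : ℝ × ℝ, y ≠ x := by simp [ae_iff]
    filter_upwards [this] with y hy
    by_cases hyH : y ∈ Hplane
    swap
    · simp [hw.eq_zero hyH]
    have a := abs_dotp_le (gradGreen ε x y - gradGreen 0 x y) (vel w x)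
    have b := norm_gradGreen_sub_le hε hx hyH hy.symm
    rw [norm_mul, Real.norm_of_nonneg (hw0 y), Real.norm_eq_abs, mul_assoc]
    refine mul_le_mul_of_nonneg_left ?_ (hw0 y)
    calc _ ≤ 2 * ((2 * ε ^ (1 / 4 : ℝ) * ‖x - y‖ ^ (-(3 / 2) : ℝ)) * C) :=
          a.trans (by gcongr; exact hC x hx)
      _ = _ := by ring
  have hdi : Integrable fun y => w y * dotp (gradGreen ε x y - gradGreen 0 x y) (vel w x) := by
    refine (j1.mul_const _).mono' ?_ hbd
    refine Measurable.aestronglyMeasurable ?_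
    have m1 := (measurable_gradGreen ε).comp (measurable_prodMk_left (x := x))
    have m2 := (measurable_gradGreen 0).comp (measurable_prodMk_left (x := x))
    have := hw.cont.measurable
    simp only [comp_def] at m1 m2
    simp only [dotp, Prod.fst_sub, Prod.snd_sub]
    fun_prop
  have e : ∫ y, w x * w y * dotp (gradGreen ε x y) (vel w x) =
      w x * ∫ y, w y * dotp (gradGreen ε x y - gradGreen 0 x y) (vel w x) := by
    have : (fun y => w x * w y * dotp (gradGreen ε x y) (vel w x)) = fun y =>
        w x * (w y * dotp (gradGreen ε x y - gradGreen 0 x y) (vel w x) +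
          w y * dotp (gradGreen 0 x y) (vel w x)) := by
      funext y
      simp only [dotp, Prod.fst_sub, Prod.snd_sub]
      ring
    rw [this, integral_const_mul, integral_add hdi z1, z2, add_zero]
  rw [e, norm_mul, Real.norm_of_nonneg (hw0 x)]
  refine mul_le_mul_of_nonneg_left ?_ (hw0 x)
  refine (norm_integral_le_of_norm_le (j1.mul_const _) hbd).trans ?_
  rw [integral_mul_const]
  calc _ ≤ S * (4 * C * ε ^ (1 / 4 : ℝ)) := by gcongr
    _ = _ := by ring

end HalfPlane

namespace HalfPlane
open MeasureTheory Filter Set Metric Function Topology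

variable {ω : ℝ → ℝ × ℝ → ℝ} {u : ℝ → ℝ × ℝ → ℝ × ℝ} {w : ℝ × ℝ → ℝ}

/-! ### Conservation of the regularized energy up to a small error -/

/-- The time derivative of the vorticity. -/
noncomputable def timeDeriv (ω : ℝ → ℝ × ℝ → ℝ) (t : ℝ) (x : ℝ × ℝ) : ℝ :=
  fderiv ℝ (uncurry ω) (t, x) (1, 0)

lemma IsEulerSol.contDiff_uncurry (h : IsEulerSol ω u) : ContDiff ℝ 1 (uncurry ω) :=
  h.smooth.of_le (by exact_mod_cast le_top)

lemma IsEulerSol.contDiff_slice (h : IsEulerSol ω u) (t : ℝ) : ContDiff ℝ 1 (ω t) :=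
  (IsEulerSol.contDiff_uncurry h).comp (contDiff_prodMk_right t)

lemma IsEulerSol.hasDerivAt_timeDeriv (h : IsEulerSol ω u) (t : ℝ) (x : ℝ × ℝ) :
    HasDerivAt (fun s => ω s x) (timeDeriv ω t x) t := by
  have h1 : HasDerivAt (fun s : ℝ => (s, x)) ((1 : ℝ), (0 : ℝ × ℝ)) t :=
    (hasDerivAt_id t).prodMk (hasDerivAt_const t x)
  exact (((IsEulerSol.contDiff_uncurry h).differentiable one_ne_zero)
    (t, x)).hasFDerivAt.comp_hasDerivAt t h1

lemma IsEulerSol.continuous_timeDeriv (h : IsEulerSol ω u) :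
    Continuous (uncurry (timeDeriv ω)) :=
  ((IsEulerSol.contDiff_uncurry h).continuous_fderiv one_ne_zero).clm_apply continuous_const

lemma IsEulerSol.timeDeriv_eq (h : IsEulerSol ω u) {t : ℝ} (ht : 0 ≤ t) (x : ℝ × ℝ) :
    timeDeriv ω t x = - fderiv ℝ (ω t) x (u t x) := by
  have := IsEulerSol.transport_everywhere h ht x
  rw [(IsEulerSol.hasDerivAt_timeDeriv h t x).deriv] at this
  linarith

lemma IsEulerSol.timeDeriv_eq_zero (h : IsEulerSol ω u) {t : ℝ} (ht : 0 ≤ t) {x : ℝ × ℝ}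
    (hx : x ∉ tsupport (ω t)) : timeDeriv ω t x = 0 := by
  have : fderiv ℝ (ω t) x = 0 :=
    image_eq_zero_of_notMem_tsupport fun h' => hx (tsupport_fderiv_subset ℝ h')
  rw [IsEulerSol.timeDeriv_eq h ht, this]
  simp

lemma IsEulerSol.integral_mul_timeDeriv (h : IsEulerSol ω u) {t : ℝ} (ht : 0 ≤ t)
    {G : ℝ × ℝ → ℝ} (hG : ContDiff ℝ 1 G) :
    ∫ x, G x * timeDeriv ω t x = ∫ x, ω t x * fderiv ℝ G x (u t x) := by
  have hω := IsEulerSol.contDiff_slice h t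
  have hsupp : support (fun x => G x * ω t x) ⊆ support (ω t) := by
    intro x hx hx'
    exact hx (by simp [hx'])
  obtain ⟨e1, e2⟩ := (IsEulerSol.profile h t).integral_fderiv_vel (hG.mul hω)
    ((h.compactSupp t).mono hsupp) ((closure_mono hsupp).trans (h.suppIn t))
  rw [← IsEulerSol.velocity_eq h t] at e1 e2
  have hi : Integrable fun x => G x * timeDeriv ω t x := by
    refine Continuous.integrable_of_hasCompactSupport ?_ ?_
    · exact hG.continuous.mul
        ((IsEulerSol.continuous_timeDeriv h).comp (Continuous.prodMk_right t))
    · exact HasCompactSupport.intro (h.compactSupp t) fun x hx => by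
        rw [IsEulerSol.timeDeriv_eq_zero h ht hx, mul_zero]
  have key : ∀ x, ω t x * fderiv ℝ G x (u t x) =
      fderiv ℝ (fun x => G x * ω t x) x (u t x) + G x * timeDeriv ω t x := by
    intro x
    rw [fderiv_fun_mul (hG.differentiable one_ne_zero x) (hω.differentiable one_ne_zero x),
      IsEulerSol.timeDeriv_eq h ht]
    simp only [add_apply, smul_apply, smul_eq_mul]
    ring
  simp_rw [key]
  rw [integral_add e1 hi, e2, zero_add]

/-- The regularized energy. -/
noncomputable def energy (ω : ℝ → ℝ × ℝ → ℝ) (ε t : ℝ) : ℝ :=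
  ∫ z : (ℝ × ℝ) × (ℝ × ℝ), green ε z.1 z.2 * (ω t z.1 * ω t z.2)

lemma contDiff_green_left {ε : ℝ} (hε : 0 < ε) (y : ℝ × ℝ) : ContDiff ℝ 1 fun x => green ε x y := by
  unfold green
  refine ContDiff.div_const (ContDiff.sub (ContDiff.log (by fun_prop) fun z => ?_)
    (ContDiff.log (by fun_prop) fun z => ?_)) _ <;> positivity

lemma integral_green_swap {ε : ℝ} {a b : ℝ × ℝ → ℝ} (hi : Integrable fun z : (ℝ × ℝ) × (ℝ × ℝ) =>
      green ε z.1 z.2 * (a z.1 * b z.2)) :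
    Integrable (fun z : (ℝ × ℝ) × (ℝ × ℝ) => green ε z.1 z.2 * (b z.1 * a z.2)) ∧
    ∫ z : (ℝ × ℝ) × (ℝ × ℝ), green ε z.1 z.2 * (b z.1 * a z.2) =
      ∫ z : (ℝ × ℝ) × (ℝ × ℝ), green ε z.1 z.2 * (a z.1 * b z.2) := by
  have e : (fun z : (ℝ × ℝ) × (ℝ × ℝ) => green ε z.1 z.2 * (b z.1 * a z.2)) =
      fun z => (fun z : (ℝ × ℝ) × (ℝ × ℝ) => green ε z.1 z.2 * (a z.1 * b z.2)) z.swap := by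
    funext z
    simp only [Prod.fst_swap, Prod.snd_swap]
    rw [green_comm ε z.2, mul_comm (b _)]
  rw [e]
  rw [volume_plane_prod] at hi ⊢
  exact ⟨hi.swap, integral_prod_swap (fun z : (ℝ × ℝ) × (ℝ × ℝ) =>
    green ε z.1 z.2 * (a z.1 * b z.2))⟩

lemma IsEulerSol.integral_green_timeDeriv (h : IsEulerSol ω u) (h0 : ∀ x, 0 ≤ ω 0 x) {ε : ℝ}
    (hε : 0 < ε) {t : ℝ} (ht : 0 ≤ t) :
    ∫ z : (ℝ × ℝ) × (ℝ × ℝ), green ε z.1 z.2 *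
      (timeDeriv ω t z.1 * ω t z.2 + ω t z.1 * timeDeriv ω t z.2) =
    2 * ∫ z : (ℝ × ℝ) × (ℝ × ℝ),
      ω t z.1 * ω t z.2 * dotp (gradGreen ε z.1 z.2) (vel (ω t) z.1) := by
  obtain ⟨W, -, hW⟩ := IsEulerSol.exists_bound h h0
  obtain ⟨C, hC0, hC⟩ := IsEulerSol.exists_velocity_bound h h0
  have hC' := hC t ht
  rw [IsEulerSol.velocity_eq h t] at hC'
  have hI := ((IsEulerSol.profile h t).integral_dotp_gradGreen_le
    (IsEulerSol.nonneg h h0 ht) (hW t ht) hC0 hC' hε).1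
  have hω := IsEulerSol.continuous_slice h t
  have hd : Continuous (timeDeriv ω t) :=
    (IsEulerSol.continuous_timeDeriv h).comp (Continuous.prodMk_right t)
  have hg := (contDiff_green hε).continuous
  have i1 : Integrable (fun z : (ℝ × ℝ) × (ℝ × ℝ) =>
      green ε z.1 z.2 * (timeDeriv ω t z.1 * ω t z.2)) := by
    refine Continuous.integrable_of_hasCompactSupport
      (hg.mul ((hd.comp continuous_fst).mul (hω.comp continuous_snd))) ?_
    refine HasCompactSupport.intro ((h.compactSupp t).isCompact.prod (h.compactSupp t).isCompact)
      fun z hz => ?_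
    by_cases h1 : z.1 ∈ tsupport (ω t)
    · rw [image_eq_zero_of_notMem_tsupport fun h2 => hz ⟨h1, h2⟩]
      simp
    · rw [IsEulerSol.timeDeriv_eq_zero h ht h1]
      simp
  obtain ⟨i2, e2⟩ := integral_green_swap i1
  simp_rw [mul_add]
  rw [integral_add i1 i2, e2, ← two_mul]
  congr 1
  rw [volume_plane_prod] at i1 hI ⊢
  refine (integral_prod_symm _ i1).trans (Eq.trans ?_ (integral_prod_symm _ hI).symm)
  refine integral_congr_ae (Eventually.of_forall fun y => ?_)
  simp only
  have hy := contDiff_green_left hε y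
  have := IsEulerSol.integral_mul_timeDeriv h ht hy
  simp_rw [fderiv_green hε] at this
  rw [IsEulerSol.velocity_eq h t] at this
  have e3 : ∫ x, green ε x y * (timeDeriv ω t x * ω t y) =
      (∫ x, green ε x y * timeDeriv ω t x) * ω t y := by
    rw [← integral_mul_const]
    exact integral_congr_ae (Eventually.of_forall fun x => by simp only; ring)
  rw [e3, this, ← integral_mul_const]
  exact integral_congr_ae (Eventually.of_forall fun x => by simp only; ring)

lemma IsEulerSol.hasDerivAt_energy (h : IsEulerSol ω u) (h0 : ∀ x, 0 ≤ ω 0 x) {ε : ℝ}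
    (hε : 0 < ε) (T : ℝ) :
    ContinuousOn (energy ω ε) (Icc 0 T) ∧ ∀ t ∈ Ioo 0 T,
      HasDerivAt (energy ω ε) (2 * ∫ z : (ℝ × ℝ) × (ℝ × ℝ),
        ω t z.1 * ω t z.2 * dotp (gradGreen ε z.1 z.2) (vel (ω t) z.1)) t := by
  obtain ⟨R, hR⟩ := IsEulerSol.exists_support_bound h T
  have hg := (contDiff_green hε).continuous
  have hω := (IsEulerSol.contDiff_uncurry h).continuous
  have hd := IsEulerSol.continuous_timeDeriv h
  have hω1 : Continuous fun q : ℝ × ((ℝ × ℝ) × (ℝ × ℝ)) => ω q.1 q.2.1 :=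
    hω.comp (continuous_fst.prodMk (continuous_fst.comp continuous_snd))
  have hω2 : Continuous fun q : ℝ × ((ℝ × ℝ) × (ℝ × ℝ)) => ω q.1 q.2.2 :=
    hω.comp (continuous_fst.prodMk (continuous_snd.comp continuous_snd))
  have hd1 : Continuous fun q : ℝ × ((ℝ × ℝ) × (ℝ × ℝ)) => timeDeriv ω q.1 q.2.1 :=
    hd.comp (continuous_fst.prodMk (continuous_fst.comp continuous_snd))
  have hd2 : Continuous fun q : ℝ × ((ℝ × ℝ) × (ℝ × ℝ)) => timeDeriv ω q.1 q.2.2 :=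
    hd.comp (continuous_fst.prodMk (continuous_snd.comp continuous_snd))
  have hg' : Continuous fun q : ℝ × ((ℝ × ℝ) × (ℝ × ℝ)) => green ε q.2.1 q.2.2 :=
    hg.comp continuous_snd
  obtain ⟨c1, c2⟩ := hasDerivAt_integral_of_support
    (ν := (volume : Measure ((ℝ × ℝ) × (ℝ × ℝ)))) (a := 0) (b := T) (R := R)
    (H := fun t z => green ε z.1 z.2 * (ω t z.1 * ω t z.2))
    (H' := fun t z => green ε z.1 z.2 *
      (timeDeriv ω t z.1 * ω t z.2 + ω t z.1 * timeDeriv ω t z.2))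
    (fun t _ z => ((IsEulerSol.hasDerivAt_timeDeriv h t z.1).mul
      (IsEulerSol.hasDerivAt_timeDeriv h t z.2)).const_mul _)
    (hg'.mul (hω1.mul hω2)).continuousOn
    (hg'.mul ((hd1.mul hω2).add (hω1.mul hd2))).continuousOn
    (fun t ht z hz => by
      rcases lt_max_iff.1 (hz.trans_eq (Prod.norm_def z)) with h1 | h1 <;>
        simp [hR t ht _ h1])
  refine ⟨c1, fun t ht => ?_⟩
  rw [← IsEulerSol.integral_green_timeDeriv h h0 hε ht.1.le]
  exact (c2 t ht).2

lemma IsEulerSol.exists_energy_sub_le (h : IsEulerSol ω u) (h0 : ∀ x, 0 ≤ ω 0 x) :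
    ∃ A : ℝ, ∀ ε, 0 < ε → ∀ t, 0 ≤ t →
      |energy ω ε t - energy ω ε 0| ≤ A * ε ^ (1 / 4 : ℝ) * t := by
  obtain ⟨W, -, hW⟩ := IsEulerSol.exists_bound h h0
  obtain ⟨C, hC0, hC⟩ := IsEulerSol.exists_velocity_bound h h0
  refine ⟨2 * (4 * C * (∫ x, ω 0 x) *
    ((∫ z in ball (0 : ℝ × ℝ) 1, ‖z‖ ^ (-(3 / 2) : ℝ)) * W + ∫ x, ω 0 x)), fun ε hε t ht => ?_⟩
  rcases ht.eq_or_lt with rfl | ht'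
  · simp
  obtain ⟨c1, c2⟩ := IsEulerSol.hasDerivAt_energy h h0 hε t
  obtain ⟨s, hs, hs'⟩ := exists_hasDerivAt_eq_slope _ _ ht' c1 c2
  have hC' := hC s hs.1.le
  rw [IsEulerSol.velocity_eq h s] at hC'
  have hb := ((IsEulerSol.profile h s).integral_dotp_gradGreen_le
    (IsEulerSol.nonneg h h0 hs.1.le) (hW s hs.1.le) hC0 hC' hε).2
  rw [IsEulerSol.integral_eq_initial h hs.1.le] at hb
  rw [eq_div_iff (by linarith)] at hs'
  rw [← hs', abs_mul, abs_mul, sub_zero, abs_of_pos ht', abs_two]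
  refine mul_le_mul_of_nonneg_right ?_ ht
  linarith

end HalfPlane

namespace HalfPlane
open MeasureTheory Filter Set Metric Function Topology

variable {ω : ℝ → ℝ × ℝ → ℝ} {u : ℝ → ℝ × ℝ → ℝ × ℝ} {w : ℝ × ℝ → ℝ}

/-! ### A uniform lower bound for the horizontal momentum -/

lemma green_pos {ε : ℝ} (hε : 0 < ε) {x y : ℝ × ℝ} (hx : x ∈ Hplane) (hy : y ∈ Hplane) :
    0 < green ε x y := by
  have hx' : 0 < x.2 := hx
  have hy' : 0 < y.2 := hy
  have := Real.log_lt_log (show 0 < (x.1 - y.1) ^ 2 + (x.2 - y.2) ^ 2 + ε by positivity)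
    (show (x.1 - y.1) ^ 2 + (x.2 - y.2) ^ 2 + ε < (x.1 - y.1) ^ 2 + (x.2 + y.2) ^ 2 + ε by
      nlinarith [mul_pos hx' hy'])
  unfold green
  linarith

lemma green_anti {ε ε' : ℝ} (hε : 0 < ε) (h : ε ≤ ε') {x y : ℝ × ℝ} (hx : x ∈ Hplane)
    (hy : y ∈ Hplane) : green ε' x y ≤ green ε x y := by
  have hx' : 0 < x.2 := hx
  have hy' : 0 < y.2 := hy
  have hε' : 0 < ε' := hε.trans_le h
  have hB : (x.1 - y.1) ^ 2 + (x.2 - y.2) ^ 2 ≤ (x.1 - y.1) ^ 2 + (x.2 + y.2) ^ 2 := by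
    nlinarith [mul_pos hx' hy']
  unfold green
  set A := (x.1 - y.1) ^ 2 + (x.2 + y.2) ^ 2 with hA
  set B := (x.1 - y.1) ^ 2 + (x.2 - y.2) ^ 2 with hB'
  have hB0 : 0 ≤ B := by positivity
  have hA0 : 0 ≤ A := by positivity
  have := Real.log_le_log (show 0 < (A + ε') * (B + ε) by positivity)
    (show (A + ε') * (B + ε) ≤ (A + ε) * (B + ε') by
      nlinarith [mul_nonneg (sub_nonneg.2 hB) (sub_nonneg.2 h)])
  rw [Real.log_mul (by positivity) (by positivity),
    Real.log_mul (by positivity) (by positivity)] at this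
  linarith

lemma green_le {ε : ℝ} (hε : 0 < ε) {x y : ℝ × ℝ} (hx : x ∈ Hplane) (hy : y ∈ Hplane)
    (hxy : x ≠ y) : green ε x y ≤ Real.log (1 + 4 * x.2 * y.2 / nrm (x - y) ^ 2) / 2 := by
  have hx' : 0 < x.2 := hx
  have hy' : 0 < y.2 := hy
  have hn : 0 < nrm (x - y) := (norm_pos_iff.2 (sub_ne_zero.2 hxy)).trans_le (norm_le_nrm _)
  have hn2 : nrm (x - y) ^ 2 = (x.1 - y.1) ^ 2 + (x.2 - y.2) ^ 2 := nrm_sq _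
  have hA : (x.1 - y.1) ^ 2 + (x.2 + y.2) ^ 2 = nrm (x - y) ^ 2 + 4 * x.2 * y.2 := by
    rw [hn2]; ring
  unfold green
  rw [hA, ← hn2]
  set B := nrm (x - y) ^ 2 with hB
  have hB0 : 0 < B := by positivity
  have hm := mul_pos hx' hy'
  rw [← Real.log_div (by positivity) (by positivity)]
  refine div_le_div_of_nonneg_right (Real.log_le_log (by positivity) ?_) zero_le_two
  rw [div_le_iff₀ (by positivity)]
  have : (1 + 4 * x.2 * y.2 / B) * (B + ε) =
    B + 4 * x.2 * y.2 + ε + 4 * x.2 * y.2 / B * ε := by field_simp; ring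
  rw [this]
  have : 0 ≤ 4 * x.2 * y.2 / B * ε := by positivity
  linarith

lemma green_le_imageKer {ε η : ℝ} (hε : 0 < ε) (hη : 0 < η) {x y : ℝ × ℝ} (hx : x ∈ Hplane)
    (hy : y ∈ Hplane) (hxy : x ≠ y) :
    green ε x y ≤ η * ((1 + (x.2 + y.2)) * (1 + ‖x - y‖ ^ (-1 : ℝ))) +
      864 * Real.pi / η ^ 2 * imageKer x y := by
  have hx' : 0 < x.2 := hx
  have hy' : 0 < y.2 := hy
  have h0 : 0 < ‖x - y‖ := norm_pos_iff.2 (sub_ne_zero.2 hxy)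
  have hn : 0 < nrm (x - y) := h0.trans_le (norm_le_nrm _)
  have h1 := green_le hε hx hy hxy
  have h2 := log_le_add (σ := x.2 + y.2) (a := 4 * x.2 * y.2) (by positivity) hn (by positivity)
    (by nlinarith [sq_nonneg (x.2 - y.2)]) hη
  have h3 : nrm (x - pbar y) ^ 2 = nrm (x - y) ^ 2 + 4 * x.2 * y.2 := by
    rw [nrm_sq, nrm_sq]; simp [pbar]; ring
  have h4 : 432 / η ^ 2 * ((x.2 + y.2) / (nrm (x - y) ^ 2 + 4 * x.2 * y.2)) =
      864 * Real.pi / η ^ 2 * imageKer x y := by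
    rw [imageKer, h3]
    have := Real.pi_pos
    have : 0 < nrm (x - y) ^ 2 + 4 * x.2 * y.2 := by positivity
    field_simp
    norm_num
  have h5 : (nrm (x - y))⁻¹ ≤ ‖x - y‖ ^ (-1 : ℝ) := by
    rw [Real.rpow_neg_one]
    exact inv_anti₀ h0 (norm_le_nrm _)
  have h6 : η * ((1 + (x.2 + y.2)) * (1 + (nrm (x - y))⁻¹)) ≤
      η * ((1 + (x.2 + y.2)) * (1 + ‖x - y‖ ^ (-1 : ℝ))) := by gcongr
  have h7 : 0 ≤ Real.log (1 + 4 * x.2 * y.2 / nrm (x - y) ^ 2) := by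
    refine Real.log_nonneg ?_
    have : 0 ≤ 4 * x.2 * y.2 / nrm (x - y) ^ 2 := by positivity
    linarith
  linarith

lemma IsProfile.hasCompactSupport_mul_prod (hw : IsProfile w) {F : (ℝ × ℝ) × (ℝ × ℝ) → ℝ} :
    HasCompactSupport fun z : (ℝ × ℝ) × (ℝ × ℝ) => F z * (w z.1 * w z.2) := by
  refine HasCompactSupport.intro (hw.compactSupp.isCompact.prod hw.compactSupp.isCompact)
    fun z hz => ?_
  by_cases h1 : z.1 ∈ tsupport w
  · rw [image_eq_zero_of_notMem_tsupport fun h2 => hz ⟨h1, h2⟩]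
    simp
  · rw [image_eq_zero_of_notMem_tsupport h1]
    simp

lemma IsProfile.continuous_green_mul (hw : IsProfile w) {ε : ℝ} (hε : 0 < ε) :
    Continuous fun z : (ℝ × ℝ) × (ℝ × ℝ) => green ε z.1 z.2 * (w z.1 * w z.2) :=
  (contDiff_green hε).continuous.mul
    ((hw.cont.comp continuous_fst).mul (hw.cont.comp continuous_snd))

lemma IsProfile.integrable_green_mul (hw : IsProfile w) {ε : ℝ} (hε : 0 < ε) :
    Integrable fun z : (ℝ × ℝ) × (ℝ × ℝ) => green ε z.1 z.2 * (w z.1 * w z.2) :=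
  (hw.continuous_green_mul hε).integrable_of_hasCompactSupport hw.hasCompactSupport_mul_prod

lemma IsProfile.green_mul_nonneg (hw : IsProfile w) (hw0 : ∀ x, 0 ≤ w x) {ε : ℝ} (hε : 0 < ε)
    (z : (ℝ × ℝ) × (ℝ × ℝ)) : 0 ≤ green ε z.1 z.2 * (w z.1 * w z.2) := by
  by_cases h1 : z.1 ∈ Hplane
  · by_cases h2 : z.2 ∈ Hplane
    · exact mul_nonneg (green_pos hε h1 h2).le (mul_nonneg (hw0 _) (hw0 _))
    · simp [hw.eq_zero h2]
  · simp [hw.eq_zero h1]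

lemma IsEulerSol.energy_initial_pos (h : IsEulerSol ω u) (h0 : ∀ x, 0 ≤ ω 0 x) (hne : ω 0 ≠ 0)
    {ε : ℝ} (hε : 0 < ε) : 0 < energy ω ε 0 := by
  have hw := IsEulerSol.profile h 0
  obtain ⟨x, hx⟩ := Function.ne_iff.1 hne
  have hxH : x ∈ Hplane := by
    by_contra hc
    exact hx (hw.eq_zero hc)
  refine (hw.continuous_green_mul hε).integral_pos_of_hasCompactSupport_nonneg_nonzero
    hw.hasCompactSupport_mul_prod (hw.green_mul_nonneg h0 hε) (x := (x, x)) ?_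
  exact mul_ne_zero (green_pos hε hxH hxH).ne' (mul_ne_zero hx hx)

lemma IsProfile.green_mul_anti (hw : IsProfile w) (hw0 : ∀ x, 0 ≤ w x) {ε ε' : ℝ} (hε : 0 < ε)
    (hle : ε ≤ ε') (z : (ℝ × ℝ) × (ℝ × ℝ)) :
    green ε' z.1 z.2 * (w z.1 * w z.2) ≤ green ε z.1 z.2 * (w z.1 * w z.2) := by
  by_cases h1 : z.1 ∈ Hplane
  · by_cases h2 : z.2 ∈ Hplane
    · exact mul_le_mul_of_nonneg_right (green_anti hε hle h1 h2) (mul_nonneg (hw0 _) (hw0 _))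
    · simp [hw.eq_zero h2]
  · simp [hw.eq_zero h1]

lemma IsProfile.integral_green_le (hw : IsProfile w) (hw0 : ∀ x, 0 ≤ w x) {W : ℝ}
    (hW : ∀ y, |w y| ≤ W) {ε η : ℝ} (hε : 0 < ε) (hη : 0 < η) :
    ∫ z : (ℝ × ℝ) × (ℝ × ℝ), green ε z.1 z.2 * (w z.1 * w z.2) ≤
      η * (((∫ x, w x) + 2 * ∫ x : ℝ × ℝ, x.2 * w x) *
        ((∫ z in ball (0 : ℝ × ℝ) 1, ‖z‖ ^ (-1 : ℝ)) * W + 2 * ∫ x, w x)) +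
      864 * Real.pi / η ^ 2 *
        ∫ z : (ℝ × ℝ) × (ℝ × ℝ), 1 * w z.1 * w z.2 * imageKer z.1 z.2 := by
  obtain ⟨i1, l1⟩ := integral_weight_le hw hw0 hW
  have i2 := hw.integrable_imageKer (ξ := fun _ => 1) continuous_const
  have hsum : Integrable fun z : (ℝ × ℝ) × (ℝ × ℝ) =>
      η * (w z.1 * w z.2 * ((1 + (z.1.2 + z.2.2)) * (1 + ‖z.1 - z.2‖ ^ (-1 : ℝ)))) +
      864 * Real.pi / η ^ 2 * (1 * w z.1 * w z.2 * imageKer z.1 z.2) :=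
    (i1.const_mul η).add (i2.const_mul _)
  have hmono : ∫ z : (ℝ × ℝ) × (ℝ × ℝ), green ε z.1 z.2 * (w z.1 * w z.2) ≤
      ∫ z : (ℝ × ℝ) × (ℝ × ℝ),
        (η * (w z.1 * w z.2 * ((1 + (z.1.2 + z.2.2)) * (1 + ‖z.1 - z.2‖ ^ (-1 : ℝ)))) +
      864 * Real.pi / η ^ 2 * (1 * w z.1 * w z.2 * imageKer z.1 z.2)) := by
    refine integral_mono_ae (hw.integrable_green_mul hε) hsum ?_
    filter_upwards [ae_fst_ne_snd] with z hz
    by_cases h1 : z.1 ∈ Hplane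
    · by_cases h2 : z.2 ∈ Hplane
      · have := mul_le_mul_of_nonneg_right (green_le_imageKer hε hη h1 h2 hz)
          (mul_nonneg (hw0 z.1) (hw0 z.2))
        refine this.trans_eq ?_
        ring
      · simp [hw.eq_zero h2]
    · simp [hw.eq_zero h1]
  refine hmono.trans ?_
  rw [integral_add (i1.const_mul η) (i2.const_mul _), integral_const_mul, integral_const_mul]
  gcongr

/-- The image part of the horizontal momentum stays bounded away from zero. -/
lemma IsEulerSol.exists_le_integral_imageKer (h : IsEulerSol ω u) (h0 : ∀ x, 0 ≤ ω 0 x)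
    (hne : ω 0 ≠ 0) : ∃ c : ℝ, 0 < c ∧ ∀ t, 0 ≤ t →
      c ≤ ∫ z : (ℝ × ℝ) × (ℝ × ℝ), 1 * ω t z.1 * ω t z.2 * imageKer z.1 z.2 := by
  obtain ⟨W, hW0, hW⟩ := IsEulerSol.exists_bound h h0
  obtain ⟨A, hA⟩ := IsEulerSol.exists_energy_sub_le h h0
  have hE := IsEulerSol.energy_initial_pos h h0 hne one_pos
  set E := energy ω 1 0 with hEdef
  set Y := ((∫ x, ω 0 x) + 2 * ∫ x : ℝ × ℝ, x.2 * ω 0 x) *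
        ((∫ z in ball (0 : ℝ × ℝ) 1, ‖z‖ ^ (-1 : ℝ)) * W + 2 * ∫ x, ω 0 x) with hY
  set η := E / (4 * (|Y| + 1)) with hηd
  have hη : 0 < η := by positivity
  have hηY : η * Y ≤ E / 4 := by
    rw [hηd, div_mul_eq_mul_div, div_le_div_iff₀ (by positivity) (by positivity)]
    nlinarith [le_abs_self Y]
  have hpi := Real.pi_pos
  refine ⟨E / 4 / (864 * Real.pi / η ^ 2), by positivity, fun t ht => ?_⟩
  have hlim : Tendsto (fun ε : ℝ => A * ε ^ (1 / 4 : ℝ) * t) (𝓝[>] 0) (𝓝 0) := by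
    have h1 : Tendsto (fun ε : ℝ => A * ε ^ (1 / 4 : ℝ) * t) (𝓝 0)
        (𝓝 (A * (0 : ℝ) ^ (1 / 4 : ℝ) * t)) :=
      ((Real.continuousAt_rpow_const 0 _ (Or.inr (by norm_num))).tendsto.const_mul A).mul_const t
    rw [Real.zero_rpow (by norm_num), mul_zero, zero_mul] at h1
    exact h1.mono_left nhdsWithin_le_nhds
  obtain ⟨ε, hε1, hε2⟩ := ((hlim.eventually (gt_mem_nhds (show 0 < E / 2 by positivity))).and
    (Ioc_mem_nhdsGT (one_pos : (0 : ℝ) < 1))).exists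
  have hε : 0 < ε := hε2.1
  have hw := IsEulerSol.profile h 0
  have h1 : E ≤ energy ω ε 0 :=
    integral_mono (hw.integrable_green_mul one_pos) (hw.integrable_green_mul hε)
      (hw.green_mul_anti h0 hε hε2.2)
  have h2 := (abs_le.1 (hA ε hε t ht)).1
  have h3 := (IsEulerSol.profile h t).integral_green_le (IsEulerSol.nonneg h h0 ht) (hW t ht)
    hε hη
  rw [IsEulerSol.integral_eq_initial h ht, IsEulerSol.integral_snd_eq h ht, ← hY] at h3
  have h4 : energy ω ε t = ∫ z : (ℝ × ℝ) × (ℝ × ℝ), green ε z.1 z.2 * (ω t z.1 * ω t z.2) := rfl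
  rw [div_le_iff₀ (by positivity)]
  linarith

end HalfPlane

namespace HalfPlane
open MeasureTheory Filter Set Metric Function Topology

variable {ω : ℝ → ℝ × ℝ → ℝ} {u : ℝ → ℝ × ℝ → ℝ × ℝ} {w : ℝ × ℝ → ℝ}

/-! ### Logarithmic averaging -/

/-- The horizontal rescaled marginals of `ω` converge weakly to `μ`. -/
def HasLimitMeasure (ω : ℝ → ℝ × ℝ → ℝ) (μ : Measure ℝ) : Prop :=
  ∀ g : ℝ → ℝ, Continuous g → (∃ B, ∀ s, |g s| ≤ B) →
    Tendsto (fun t : ℝ => ∫ x : ℝ × ℝ, g (x.1 / t) * ω t x) atTop (𝓝 (∫ s, g s ∂μ))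

lemma IsEulerSol.integral_rescVort (h : IsEulerSol ω u) (φ : ℝ × ℝ → ℝ) {t : ℝ} (ht : 0 < t) :
    ∫ y in Hplane, φ y * rescVort ω t y = ∫ x, φ (t⁻¹ • x) * ω t x := by
  have hzero : ∀ y, y ∉ Hplane → φ y * rescVort ω t y = 0 := by
    intro y hy
    have : t • y ∉ Hplane := fun h' => hy (by
      have h2 : 0 < t * y.2 := h'
      exact (mul_pos_iff_of_pos_left ht).1 h2)
    rw [rescVort, (IsEulerSol.profile h t).eq_zero this]
    simp
  have := Measure.integral_comp_smul (volume : Measure (ℝ × ℝ)) (fun x => φ (t⁻¹ • x) * ω t x) t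
  rw [setIntegral_Hplane hzero]
  simp only [finrank_plane, inv_smul_smul₀ ht.ne', smul_eq_mul] at this
  have h1 : ∀ y, φ y * rescVort ω t y = t ^ 2 * (φ y * ω t (t • y)) := fun y => by
    rw [rescVort]; ring
  simp_rw [h1]
  rw [integral_const_mul, this, abs_of_pos (by positivity), mul_inv_cancel_left₀ (by positivity)]

lemma IsEulerSol.hasLimitMeasure (h : IsEulerSol ω u) {μ : Measure ℝ}
    (hconv : ∀ φ : ℝ × ℝ → ℝ, Continuous φ → (∃ B, ∀ z, |φ z| ≤ B) →
      Tendsto (fun t : ℝ => ∫ y in Hplane, φ y * rescVort ω t y) atTop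
        (𝓝 (∫ s, φ (s, 0) ∂μ))) : HasLimitMeasure ω μ := by
  intro g hg ⟨B, hB⟩
  refine (hconv (fun z => g z.1) (by fun_prop) ⟨B, fun z => hB _⟩).congr' ?_
  filter_upwards [eventually_gt_atTop 0] with t ht
  rw [IsEulerSol.integral_rescVort h _ ht]
  simp [div_eq_inv_mul]

lemma not_tendsto_of_deriv_le {F F' : ℝ → ℝ} {δ L : ℝ} (hδ : 0 < δ)
    (hF : ∀ᶠ t in atTop, HasDerivAt F (F' t) t ∧ F' t ≤ -δ / t) :
    ¬ Tendsto F atTop (𝓝 L) := by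
  intro hL
  obtain ⟨T, hT⟩ := eventually_atTop.1 (hF.and (eventually_gt_atTop (0 : ℝ)))
  have hd : ∀ t ∈ Ici T, HasDerivAt (fun t => F t + δ * Real.log t) (F' t + δ * t⁻¹) t :=
    fun t ht => (hT t ht).1.1.add ((Real.hasDerivAt_log (hT t ht).2.ne').const_mul δ)
  have ha : AntitoneOn (fun t => F t + δ * Real.log t) (Ici T) := by
    refine antitoneOn_of_deriv_nonpos (convex_Ici T)
      (fun t ht => (hd t ht).continuousAt.continuousWithinAt)
      (fun t ht => (hd t (interior_subset ht)).differentiableAt.differentiableWithinAt)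
      fun t ht => ?_
    have ht' := interior_subset ht
    rw [(hd t ht').deriv]
    have := (hT t ht').1.2
    rw [neg_div, div_eq_mul_inv] at this
    linarith
  have h1 : Tendsto (fun t => F t + δ * Real.log t) atTop atTop :=
    hL.add_atTop (Real.tendsto_log_atTop.const_mul_atTop hδ)
  obtain ⟨t, ht1, ht2⟩ := ((h1.eventually_gt_atTop (F T + δ * Real.log T)).and
    (eventually_ge_atTop T)).exists
  exact absurd (ha self_mem_Ici ht2 ht2) (not_le.2 ht1)

/-- The weighted horizontal momentum. -/
noncomputable def momentum (ω : ℝ → ℝ × ℝ → ℝ) (g : ℝ → ℝ) (t : ℝ) : ℝ :=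
  ∫ x : ℝ × ℝ, ω t x * (g (x.1 / t) * (vel (ω t) x).1)

lemma IsProfile.integrable_mul_comp_div (hw : IsProfile w) {g : ℝ → ℝ} (hg : Continuous g)
    (t : ℝ) : Integrable fun x : ℝ × ℝ => g (x.1 / t) * w x :=
  hw.integrable_mul (by fun_prop)

lemma IsEulerSol.hasDerivAt_primitive (h : IsEulerSol ω u) {g : ℝ → ℝ} (hg : Continuous g)
    {t : ℝ} (ht : 0 < t) :
    Integrable (fun x : ℝ × ℝ => ω t x * (g (x.1 / t) * (vel (ω t) x).1)) ∧
    HasDerivAt (fun t => ∫ x : ℝ × ℝ, (∫ s in (0 : ℝ)..(x.1 / t), g s) * ω t x)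
      (t⁻¹ * (momentum ω g t - ∫ x : ℝ × ℝ, (x.1 / t * g (x.1 / t)) * ω t x)) t := by
  set φ : ℝ → ℝ := fun r => ∫ s in (0 : ℝ)..r, g s with hφ
  have hφd : ∀ r, HasDerivAt φ (g r) r := fun r => hg.integral_hasStrictDerivAt 0 r |>.hasDerivAt
  have hφc : ContDiff ℝ 1 φ := by
    refine contDiff_one_iff_deriv.2 ⟨fun r => (hφd r).differentiableAt, ?_⟩
    rwa [show deriv φ = g from funext fun r => (hφd r).deriv]
  obtain ⟨i1, d1⟩ := IsEulerSol.hasDerivAt_weighted h (Φ := fun t x => φ (x.1 / t))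
    (fun s hs x => by
      have : ContDiffAt ℝ 1 (fun q : ℝ × (ℝ × ℝ) => q.2.1 / q.1) (s, x) :=
        ContDiffAt.div (by fun_prop) (by fun_prop) hs.ne'
      exact hφc.contDiffAt.comp (s, x) this) ht
  have hw := IsEulerSol.profile h t
  have i2 : Integrable fun x : ℝ × ℝ => (x.1 / t * g (x.1 / t)) * ω t x :=
    hw.integrable_mul (by fun_prop)
  have e1 : ∀ x : ℝ × ℝ, deriv (fun s => φ (x.1 / s)) t = g (x.1 / t) * (-x.1 / t ^ 2) := by
    intro x
    have := ((hasDerivAt_id t).inv ht.ne').const_mul x.1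
    have h2 : HasDerivAt (fun s : ℝ => x.1 / s) (-x.1 / t ^ 2) t := by
      refine (this.congr_deriv (by simp only [id]; ring)).congr_of_eventuallyEq ?_
      exact Eventually.of_forall fun s => div_eq_mul_inv _ _
    exact ((hφd (x.1 / t)).comp t h2).deriv
  have e2 : ∀ x v : ℝ × ℝ, fderiv ℝ (fun x : ℝ × ℝ => φ (x.1 / t)) x v =
      g (x.1 / t) * (v.1 / t) := by
    intro x v
    have h1 : HasFDerivAt (fun x : ℝ × ℝ => x.1 / t) (t⁻¹ • ContinuousLinearMap.fst ℝ ℝ ℝ) x := by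
      simp_rw [div_eq_inv_mul]
      exact hasFDerivAt_fst.const_mul t⁻¹
    have := ((hφd (x.1 / t)).comp_hasFDerivAt x h1).fderiv
    have h3 : fderiv ℝ (fun x : ℝ × ℝ => φ (x.1 / t)) x = _ := this
    rw [h3]
    simp only [smul_apply, ContinuousLinearMap.coe_fst', smul_eq_mul]
    rw [div_eq_inv_mul v.1]
  simp only [e1, e2, IsEulerSol.velocity_eq h t] at i1 d1
  have e3 : ∀ x : ℝ × ℝ, ω t x * (g (x.1 / t) * (vel (ω t) x).1) =
      t * (ω t x * (g (x.1 / t) * (-x.1 / t ^ 2) + g (x.1 / t) * ((vel (ω t) x).1 / t))) +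
        (x.1 / t * g (x.1 / t)) * ω t x := by
    intro x
    field_simp
    ring
  have i3 := i1.const_mul t
  refine ⟨by simp_rw [e3]; exact i3.add i2, ?_⟩
  convert d1 using 1
  unfold momentum
  simp_rw [e3]
  rw [integral_add i3 i2, integral_const_mul, add_sub_cancel_right, inv_mul_cancel_left₀ ht.ne']

lemma exists_bound_primitive {g : ℝ → ℝ} (hg : Continuous g) (hgc : HasCompactSupport g) :
    ∃ B, ∀ r, |∫ s in (0 : ℝ)..r, g s| ≤ B := by
  have hi := (hg.integrable_of_hasCompactSupport (μ := volume) hgc).norm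
  refine ⟨∫ s, ‖g s‖, fun r => ?_⟩
  exact (intervalIntegral.norm_integral_le_integral_norm_uIoc).trans
    (setIntegral_le_integral hi (Eventually.of_forall fun _ => norm_nonneg _))

lemma exists_bound_id_mul {g : ℝ → ℝ} (hg : Continuous g) (hgc : HasCompactSupport g) :
    ∃ B, ∀ s, |s * g s| ≤ B := by
  obtain ⟨B, hB⟩ := (hgc.mul_left (f := fun s : ℝ => s)).exists_bound_of_continuous (by fun_prop)
  exact ⟨B, hB⟩

lemma IsEulerSol.integral_id_mul_le (h : IsEulerSol ω u) {μ : Measure ℝ}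
    (hμ : HasLimitMeasure ω μ) {g : ℝ → ℝ} (hg : Continuous g) (hgc : HasCompactSupport g)
    {b : ℝ → ℝ} {β : ℝ} (hb : Tendsto b atTop (𝓝 β)) (hle : ∀ᶠ t in atTop, momentum ω g t ≤ b t) :
    ∫ s, s * g s ∂μ ≤ β := by
  by_contra! hlt
  set δ := ((∫ s, s * g s ∂μ) - β) / 2 with hδd
  have hδ : 0 < δ := by rw [hδd]; linarith
  have hφ : Continuous fun r => ∫ s in (0 : ℝ)..r, g s :=
    intervalIntegral.continuous_primitive (fun _ _ => hg.intervalIntegrable _ _) 0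
  have h1 := hμ (fun s => s * g s) (by fun_prop) (exists_bound_id_mul hg hgc)
  refine not_tendsto_of_deriv_le hδ ?_ (hμ _ hφ (exists_bound_primitive hg hgc))
    (F' := fun t => t⁻¹ * (momentum ω g t - ∫ x : ℝ × ℝ, (x.1 / t * g (x.1 / t)) * ω t x))
  have h2 := (hb.sub h1).eventually (gt_mem_nhds (show β - ∫ s, s * g s ∂μ < -δ by linarith))
  filter_upwards [h2, hle, eventually_gt_atTop 0] with t h3 h4 ht
  refine ⟨(IsEulerSol.hasDerivAt_primitive h hg ht).2, ?_⟩
  rw [div_eq_inv_mul]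
  gcongr
  linarith

lemma IsEulerSol.le_integral_id_mul (h : IsEulerSol ω u) {μ : Measure ℝ}
    (hμ : HasLimitMeasure ω μ) {g : ℝ → ℝ} (hg : Continuous g) (hgc : HasCompactSupport g)
    {b : ℝ → ℝ} {β : ℝ} (hb : Tendsto b atTop (𝓝 β)) (hle : ∀ᶠ t in atTop, b t ≤ momentum ω g t) :
    β ≤ ∫ s, s * g s ∂μ := by
  have hm : ∀ t, momentum ω (fun s => - g s) t = - momentum ω g t := by
    intro t
    unfold momentum
    rw [← integral_neg]
    congr 1
    funext x
    ring
  have := IsEulerSol.integral_id_mul_le h hμ (g := fun s => - g s) hg.neg hgc.neg hb.neg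
    (hle.mono fun t ht => by rw [hm]; linarith)
  simp only [mul_neg, integral_neg] at this
  linarith

end HalfPlane

namespace HalfPlane
open MeasureTheory Filter Set Metric Function Topology

variable {ω : ℝ → ℝ × ℝ → ℝ} {u : ℝ → ℝ × ℝ → ℝ × ℝ} {w : ℝ × ℝ → ℝ} {μ : Measure ℝ}

/-! ### Trapezoidal cutoffs and first consequences -/

/-- The trapezoidal cutoff equal to `1` on `[a, b]` and to `0` at distance `δ` from it. -/
noncomputable def trap (a b δ s : ℝ) : ℝ := max 0 (1 - max 0 (max (a - s) (s - b)) / δ)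

lemma continuous_trap (a b δ : ℝ) : Continuous (trap a b δ) := by
  unfold trap; fun_prop

lemma trap_nonneg (a b δ s : ℝ) : 0 ≤ trap a b δ s := le_max_left _ _

lemma trap_le_one {a b δ : ℝ} (hδ : 0 < δ) (s : ℝ) : trap a b δ s ≤ 1 := by
  refine max_le zero_le_one ?_
  have : 0 ≤ max 0 (max (a - s) (s - b)) / δ := div_nonneg (le_max_left _ _) hδ.le
  linarith

lemma trap_eq_one {a b δ s : ℝ} (hs : s ∈ Icc a b) : trap a b δ s = 1 := by
  have : max 0 (max (a - s) (s - b)) = 0 :=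
    max_eq_left (max_le (sub_nonpos.2 hs.1) (sub_nonpos.2 hs.2))
  simp [trap, this]

lemma mem_Ioo_of_trap_ne_zero {a b δ s : ℝ} (hδ : 0 < δ) (hs : trap a b δ s ≠ 0) :
    s ∈ Ioo (a - δ) (b + δ) := by
  by_contra hc
  have h1 : δ ≤ max 0 (max (a - s) (s - b)) := by
    rw [mem_Ioo, not_and_or, not_lt, not_lt] at hc
    rcases hc with hc | hc
    · exact le_max_of_le_right (le_max_of_le_left (by linarith))
    · exact le_max_of_le_right (le_max_of_le_right (by linarith))
  refine hs (max_eq_left ?_)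
  have := (one_le_div hδ).2 h1
  linarith

lemma hasCompactSupport_trap {a b δ : ℝ} (hδ : 0 < δ) : HasCompactSupport (trap a b δ) :=
  HasCompactSupport.intro (isCompact_Icc (a := a - δ) (b := b + δ)) fun _ hs => by
    by_contra hc
    exact hs (Ioo_subset_Icc_self (mem_Ioo_of_trap_ne_zero hδ hc))

lemma abs_trap_sub_le {a b δ : ℝ} (hδ : 0 < δ) (s s' : ℝ) :
    |trap a b δ s - trap a b δ s'| ≤ |s - s'| / δ := by
  have hm : ∀ p q : ℝ, |max 0 p - max 0 q| ≤ |p - q| := fun p q => by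
    rw [max_comm 0 p, max_comm 0 q]
    exact abs_max_sub_max_le_abs _ _ 0
  unfold trap
  refine (hm _ _).trans ?_
  rw [sub_sub_sub_cancel_left, ← sub_div, abs_div, abs_of_pos hδ]
  refine div_le_div_of_nonneg_right ?_ hδ.le
  refine (hm _ _).trans ((abs_max_sub_max_le_max _ _ _ _).trans (max_le ?_ ?_))
  · rw [show a - s' - (a - s) = s - s' by ring]
  · rw [show s' - b - (s - b) = -(s - s') by ring, abs_neg]

lemma abs_trap_div_sub_le {a b δ t : ℝ} (hδ : 0 < δ) (ht : 0 < t) (x y : ℝ × ℝ) :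
    |trap a b δ (x.1 / t) - trap a b δ (y.1 / t)| ≤ (δ * t)⁻¹ * ‖x - y‖ := by
  refine (abs_trap_sub_le hδ _ _).trans ?_
  rw [← sub_div, abs_div, abs_of_pos ht, div_div, div_eq_inv_mul, mul_comm t]
  gcongr
  exact norm_fst_le (x - y)

lemma integrable_trap [IsFiniteMeasure μ] {a b δ : ℝ} (hδ : 0 < δ) :
    Integrable (trap a b δ) μ :=
  (continuous_trap a b δ).integrable_of_hasCompactSupport (hasCompactSupport_trap hδ)

lemma integrable_id_mul_trap [IsFiniteMeasure μ] {a b δ : ℝ} (hδ : 0 < δ) :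
    Integrable (fun s => s * trap a b δ s) μ :=
  (continuous_id.mul (continuous_trap a b δ)).integrable_of_hasCompactSupport
    ((hasCompactSupport_trap hδ).mul_left (f := fun s : ℝ => s))

lemma measureReal_le_integral_trap [IsFiniteMeasure μ] {a b δ : ℝ} (hδ : 0 < δ) :
    μ.real (Icc a b) ≤ ∫ s, trap a b δ s ∂μ := by
  rw [← integral_indicator_one measurableSet_Icc]
  refine integral_mono ((integrable_const 1).indicator measurableSet_Icc) (integrable_trap hδ)
    fun s => ?_
  by_cases hs : s ∈ Icc a b
  · simp [hs, trap_eq_one hs]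
  · simpa [hs] using trap_nonneg a b δ s

lemma integral_trap_le_measureReal [IsFiniteMeasure μ] {a b δ : ℝ} (hδ : 0 < δ) :
    ∫ s, trap a b δ s ∂μ ≤ μ.real (Icc (a - δ) (b + δ)) := by
  rw [← integral_indicator_one measurableSet_Icc]
  refine integral_mono (integrable_trap hδ) ((integrable_const 1).indicator measurableSet_Icc)
    fun s => ?_
  by_cases hs : s ∈ Icc (a - δ) (b + δ)
  · simpa [hs] using trap_le_one hδ s
  · have : trap a b δ s = 0 := by
      by_contra hc
      exact hs (Ioo_subset_Icc_self (mem_Ioo_of_trap_ne_zero hδ hc))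
    simp [hs, this]

lemma IsEulerSol.momentum_trap_ge (h : IsEulerSol ω u) (h0 : ∀ x, 0 ≤ ω 0 x) {a b δ t : ℝ}
    (hδ : 0 < δ) (ht : 0 < t) :
    (∫ z : (ℝ × ℝ) × (ℝ × ℝ),
      trap a b δ (z.1.1 / t) * ω t z.1 * ω t z.2 * imageKer z.1 z.2) -
      (δ * t)⁻¹ * (∫ x, ω 0 x) ^ 2 ≤ momentum ω (trap a b δ) t := by
  rw [← IsEulerSol.integral_eq_initial h ht.le]
  exact (IsEulerSol.profile h t).integral_vel_fst_ge (IsEulerSol.nonneg h h0 ht.le)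
    (ξ := fun x => trap a b δ (x.1 / t)) ((continuous_trap a b δ).comp (by fun_prop))
    (by positivity) (abs_trap_div_sub_le hδ ht)

lemma tendsto_inv_mul_mul {δ : ℝ} (hδ : 0 < δ) (c : ℝ) :
    Tendsto (fun t : ℝ => (δ * t)⁻¹ * c) atTop (𝓝 0) := by
  simpa using (tendsto_inv_atTop_zero.comp (tendsto_id.const_mul_atTop hδ)).mul_const c

lemma IsEulerSol.integral_id_mul_trap_nonneg (h : IsEulerSol ω u) (h0 : ∀ x, 0 ≤ ω 0 x)
    (hμ : HasLimitMeasure ω μ) {a b δ : ℝ} (hδ : 0 < δ) : 0 ≤ ∫ s, s * trap a b δ s ∂μ := by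
  have hb : Tendsto (fun t : ℝ => -((δ * t)⁻¹ * (∫ x, ω 0 x) ^ 2)) atTop (𝓝 0) := by
    simpa using (tendsto_inv_mul_mul hδ ((∫ x, ω 0 x) ^ 2)).neg
  refine IsEulerSol.le_integral_id_mul h hμ (continuous_trap a b δ) (hasCompactSupport_trap hδ)
    hb ?_
  filter_upwards [eventually_gt_atTop 0] with t ht
  refine le_trans ?_ (IsEulerSol.momentum_trap_ge h h0 hδ ht)
  have hω := IsEulerSol.nonneg h h0 ht.le
  have hw := IsEulerSol.profile h t
  have : 0 ≤ ∫ z : (ℝ × ℝ) × (ℝ × ℝ),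
      trap a b δ (z.1.1 / t) * ω t z.1 * ω t z.2 * imageKer z.1 z.2 := by
    refine integral_nonneg fun z => ?_
    by_cases h1 : z.1 ∈ Hplane
    · by_cases h2 : z.2 ∈ Hplane
      · exact mul_nonneg (mul_nonneg (mul_nonneg (trap_nonneg _ _ _ _) (hω _)) (hω _))
          (imageKer_nonneg h1 h2)
      · simp [hw.eq_zero h2]
    · simp [hw.eq_zero h1]
  linarith

lemma IsEulerSol.exists_pos_le_integral (h : IsEulerSol ω u) (h0 : ∀ x, 0 ≤ ω 0 x)
    (hne : ω 0 ≠ 0) (hμ : HasLimitMeasure ω μ) : ∃ b, 0 < ∫ s, s * trap (-b) b 1 s ∂μ := by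
  obtain ⟨c, hc, hJ⟩ := IsEulerSol.exists_le_integral_imageKer h h0 hne
  obtain ⟨B, -, hB⟩ := IsEulerSol.exists_linear_support h h0
  refine ⟨B, hc.trans_le ?_⟩
  have hb : Tendsto (fun t : ℝ => c - (1 * t)⁻¹ * (∫ x, ω 0 x) ^ 2) atTop (𝓝 c) := by
    simpa using (tendsto_inv_mul_mul one_pos ((∫ x, ω 0 x) ^ 2)).const_sub c
  refine IsEulerSol.le_integral_id_mul h hμ (continuous_trap _ _ _)
    (hasCompactSupport_trap one_pos) hb ?_
  filter_upwards [eventually_ge_atTop 1] with t ht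
  have ht0 : 0 < t := zero_lt_one.trans_le ht
  refine le_trans ?_ (IsEulerSol.momentum_trap_ge h h0 one_pos ht0)
  refine sub_le_sub_right ((hJ t ht0.le).trans_eq ?_) _
  congr 1
  funext z
  by_cases hz : ω t z.1 = 0
  · simp [hz]
  · have h1 := (norm_fst_le z.1).trans (hB t ht z.1 hz)
    rw [Real.norm_eq_abs, abs_le] at h1
    rw [trap_eq_one]
    rw [mem_Icc, le_div_iff₀ ht0, div_le_iff₀ ht0]
    exact ⟨by linarith, h1.2⟩

lemma IsEulerSol.measure_Iio_zero [IsFiniteMeasure μ] (h : IsEulerSol ω u)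
    (h0 : ∀ x, 0 ≤ ω 0 x) (hμ : HasLimitMeasure ω μ) : μ (Iio 0) = 0 := by
  have key : ∀ a b : ℝ, b < 0 → μ (Icc a b) = 0 := by
    intro a b hb
    have hδ : 0 < -b / 2 := by linarith
    have h1 := IsEulerSol.integral_id_mul_trap_nonneg h h0 hμ (a := a) (b := b) hδ
    have h2 : ∫ s, s * trap a b (-b / 2) s ∂μ ≤ ∫ s, b / 2 * trap a b (-b / 2) s ∂μ := by
      refine integral_mono (integrable_id_mul_trap hδ) ((integrable_trap hδ).const_mul _)
        fun s => ?_
      by_cases hs : trap a b (-b / 2) s = 0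
      · simp [hs]
      · refine mul_le_mul_of_nonneg_right ?_ (trap_nonneg _ _ _ _)
        have := (mem_Ioo_of_trap_ne_zero hδ hs).2
        linarith
    rw [integral_const_mul] at h2
    have h3 := measureReal_le_integral_trap (μ := μ) (a := a) (b := b) hδ
    have h4 : μ.real (Icc a b) ≤ 0 := by nlinarith
    exact (measureReal_eq_zero_iff).1 (le_antisymm h4 measureReal_nonneg)
  refine measure_null_of_locally_null _ fun x hx => ⟨Icc (x - 1) (x / 2), ?_, key _ _ ?_⟩
  · exact mem_nhdsWithin_of_mem_nhds
      (Icc_mem_nhds (by linarith) (by linarith [show x < 0 from hx]))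
  · linarith [show x < 0 from hx]

lemma IsEulerSol.momentum_le (h : IsEulerSol ω u) (h0 : ∀ x, 0 ≤ ω 0 x) {g : ℝ → ℝ}
    (hg : Continuous g) (hg0 : ∀ s, 0 ≤ g s) {t V : ℝ} (ht : 0 < t)
    (hV : ∀ x ∈ Hplane, g (x.1 / t) ≠ 0 → (vel (ω t) x).1 ≤ V) :
    momentum ω g t ≤ V * ∫ x : ℝ × ℝ, g (x.1 / t) * ω t x := by
  rw [← integral_const_mul]
  have hw := IsEulerSol.profile h t
  refine integral_mono (IsEulerSol.hasDerivAt_primitive h hg ht).1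
    ((hw.integrable_mul_comp_div hg t).const_mul V) fun x => ?_
  simp only
  by_cases hx : x ∈ Hplane
  · by_cases hgx : g (x.1 / t) = 0
    · simp [hgx]
    · have := mul_le_mul_of_nonneg_right (hV x hx hgx)
        (mul_nonneg (hg0 (x.1 / t)) (IsEulerSol.nonneg h h0 ht.le x))
      linarith
  · simp [hw.eq_zero hx]

lemma IsEulerSol.measure_Ioi [IsFiniteMeasure μ] (h : IsEulerSol ω u) (h0 : ∀ x, 0 ≤ ω 0 x)
    (hμ : HasLimitMeasure ω μ) {M : ℝ} (hM : ∀ t, 0 ≤ t → ∀ x ∈ Hplane, (u t x).1 ≤ M) :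
    μ (Ioi M) = 0 := by
  have key : ∀ a b : ℝ, M < a → μ (Icc a b) = 0 := by
    intro a b ha
    set δ := (a - M) / 2 with hδd
    have hδ : 0 < δ := by rw [hδd]; linarith
    have hlim := (hμ (trap a b δ) (continuous_trap a b δ)
      ⟨1, fun s => by rw [abs_of_nonneg (trap_nonneg _ _ _ _)]; exact trap_le_one hδ s⟩).const_mul M
    have h1 := IsEulerSol.integral_id_mul_le h hμ (continuous_trap a b δ)
      (hasCompactSupport_trap hδ) hlim (by
        filter_upwards [eventually_gt_atTop 0] with t ht
        exact IsEulerSol.momentum_le h h0 (continuous_trap a b δ) (trap_nonneg a b δ) ht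
          fun x hx _ => by rw [← IsEulerSol.velocity_eq h]; exact hM t ht.le x hx)
    have h2 : ∫ s, (M + δ) * trap a b δ s ∂μ ≤ ∫ s, s * trap a b δ s ∂μ := by
      refine integral_mono ((integrable_trap hδ).const_mul _) (integrable_id_mul_trap hδ)
        fun s => ?_
      by_cases hs : trap a b δ s = 0
      · simp [hs]
      · refine mul_le_mul_of_nonneg_right ?_ (trap_nonneg _ _ _ _)
        have := (mem_Ioo_of_trap_ne_zero hδ hs).1
        linarith
    rw [integral_const_mul] at h2
    have h3 := measureReal_le_integral_trap (μ := μ) (a := a) (b := b) hδ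
    have h4 : μ.real (Icc a b) ≤ 0 := by nlinarith
    exact (measureReal_eq_zero_iff).1 (le_antisymm h4 measureReal_nonneg)
  refine measure_null_of_locally_null _ fun x hx => ⟨Icc ((x + M) / 2) (x + 1), ?_, key _ _ ?_⟩
  · exact mem_nhdsWithin_of_mem_nhds
      (Icc_mem_nhds (by linarith [show M < x from hx]) (by linarith))
  · linarith [show M < x from hx]

end HalfPlane

namespace HalfPlane
open MeasureTheory Filter Set Metric Function Topology

variable {ω : ℝ → ℝ × ℝ → ℝ} {u : ℝ → ℝ × ℝ → ℝ × ℝ} {w : ℝ × ℝ → ℝ} {μ : Measure ℝ}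

/-! ### Interpolation and the local mass bound -/

/-- The kernel `1 / ‖z‖` truncated to a ball. -/
noncomputable def ballKer (ρ : ℝ) : ℝ × ℝ → ℝ := (ball 0 ρ).indicator fun z => ‖z‖ ^ (-1 : ℝ)

lemma ballKer_nonneg (ρ : ℝ) (z : ℝ × ℝ) : 0 ≤ ballKer ρ z :=
  indicator_nonneg (fun _ _ => by positivity) z

lemma measurable_ballKer (ρ : ℝ) : Measurable (ballKer ρ) :=
  Measurable.indicator (by fun_prop) measurableSet_ball

lemma ballKer_rpow {q : ℝ} (hq : 0 < q) (ρ : ℝ) :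
    (fun z => ballKer ρ z ^ q) = (ball 0 ρ).indicator fun z : ℝ × ℝ => ‖z‖ ^ (-q) := by
  funext z
  by_cases hz : z ∈ ball (0 : ℝ × ℝ) ρ
  · rw [ballKer, indicator_of_mem hz, indicator_of_mem hz, ← Real.rpow_mul (norm_nonneg _)]
    simp
  · rw [ballKer, indicator_of_notMem hz, indicator_of_notMem hz, Real.zero_rpow hq.ne']

lemma memLp_ballKer {q : ℝ} (hq0 : 0 < q) (hq : q < 2) (ρ : ℝ) :
    MemLp (ballKer ρ) (ENNReal.ofReal q) := by
  rw [← integrable_norm_rpow_iff (measurable_ballKer ρ).aestronglyMeasurable (by simpa using hq0)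
    ENNReal.ofReal_ne_top, ENNReal.toReal_ofReal hq0.le]
  simp_rw [Real.norm_of_nonneg (ballKer_nonneg ρ _)]
  rw [ballKer_rpow hq0]
  exact (integrable_indicator_iff measurableSet_ball).2 (integrableOn_norm_rpow_ball hq ρ)

lemma integral_ballKer_rpow {q ρ : ℝ} (hq0 : 0 < q) (hq : q < 2) (hρ : 0 < ρ) :
    ∫ z, ballKer ρ z ^ q =
      2 * volume.real (ball (0 : ℝ × ℝ) 1) * (ρ ^ (2 - q) / (2 - q)) := by
  rw [ballKer_rpow hq0, integral_indicator measurableSet_ball]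
  exact setIntegral_norm_rpow_ball hq hρ

lemma norm_rpow_le_ballKer {ρ : ℝ} (hρ : 0 < ρ) (z : ℝ × ℝ) :
    ‖z‖ ^ (-1 : ℝ) ≤ ballKer ρ z + ρ⁻¹ := by
  by_cases hz : z ∈ ball (0 : ℝ × ℝ) ρ
  · rw [ballKer, indicator_of_mem hz]
    have : 0 < ρ⁻¹ := by positivity
    linarith
  · rw [ballKer, indicator_of_notMem hz, zero_add, Real.rpow_neg_one]
    exact inv_anti₀ hρ (by simpa using hz)

/-- `C` is an admissible constant in the interpolation inequality for `f * 1/‖·‖`. -/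
def IsPotentialConst (p C : ℝ) : Prop :=
  ∀ f : ℝ × ℝ → ℝ, Continuous f → HasCompactSupport f → (∀ x, 0 ≤ f x) → ∀ N, 0 < N →
    ∫ x, f x ^ p ≤ N ^ p → ∀ x, Integrable (fun y => f y * ‖x - y‖ ^ (-1 : ℝ)) ∧
      ∫ y, f y * ‖x - y‖ ^ (-1 : ℝ) ≤
        C * N ^ ((p / (p - 1)) / 2) * (∫ y, f y) ^ (1 - (p / (p - 1)) / 2)

/-- The potential `f * 1/‖·‖` is controlled by interpolation between the `L¹` and `Lᵖ` norms. -/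
lemma exists_potential_bound {p : ℝ} (hp : 2 < p) : ∃ C : ℝ, 0 < C ∧ IsPotentialConst p C := by
  have hpq : p.HolderConjugate (p / (p - 1)) := Real.HolderConjugate.conjExponent (by linarith)
  set q := p / (p - 1) with hq
  have hq0 : 0 < q := hpq.symm.pos
  have hq2 : q < 2 := by rw [hq, div_lt_iff₀ (by linarith)]; linarith
  have h2q : 0 < 2 - q := by linarith
  set K := (2 * volume.real (ball (0 : ℝ × ℝ) 1) / (2 - q)) ^ (1 / q) with hK
  have hK0 : 0 ≤ K := by positivity
  refine ⟨K + 1, by positivity, fun f hf hfc hf0 N hN hNf x => ?_⟩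
  obtain ⟨W, hW⟩ := hfc.exists_bound_of_continuous hf
  have hfi : Integrable f := hf.integrable_of_hasCompactSupport hfc
  have hi : Integrable fun y => f y * ‖x - y‖ ^ (-1 : ℝ) := by
    have := (integrable_mul_norm_rpow zero_le_one one_lt_two hfi hW x).1
    simpa only [abs_of_nonneg (hf0 _)] using this
  refine ⟨hi, ?_⟩
  have hF0 : 0 ≤ ∫ y, f y := integral_nonneg hf0
  rcases hF0.eq_or_lt with hF | hF
  · have hz := (integral_eq_zero_iff_of_nonneg hf0 hfi).1 hF.symm
    have : ∫ y, f y * ‖x - y‖ ^ (-1 : ℝ) = 0 := by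
      refine integral_eq_zero_of_ae (hz.mono fun y hy => ?_)
      simp only [Pi.zero_apply] at hy
      simp [hy]
    rw [this]
    positivity
  set F := ∫ y, f y with hFd
  set ρ := (F / N) ^ (q / 2) with hρd
  have hρ : 0 < ρ := by positivity
  have hk : MemLp (fun y => ballKer ρ (x - y)) (ENNReal.ofReal q) :=
    (memLp_ballKer hq0 hq2 ρ).comp_measurePreserving (Measure.measurePreserving_sub_left volume x)
  have hf' : MemLp f (ENNReal.ofReal p) := hf.memLp_of_hasCompactSupport hfc
  have hH := integral_mul_le_Lp_mul_Lq_of_nonneg hpq (Eventually.of_forall hf0)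
    (Eventually.of_forall fun y => ballKer_nonneg ρ (x - y)) hf' hk
  have hki : Integrable fun y => f y * ballKer ρ (x - y) := by
    refine hi.mono' (hf.aestronglyMeasurable.mul
      ((measurable_ballKer ρ).comp (measurable_const.sub measurable_id)).aestronglyMeasurable)
      (Eventually.of_forall fun y => ?_)
    rw [Real.norm_of_nonneg (mul_nonneg (hf0 y) (ballKer_nonneg _ _))]
    exact mul_le_mul_of_nonneg_left (indicator_le_self' (fun _ _ => by positivity) _) (hf0 y)
  have hkq : ∫ y, ballKer ρ (x - y) ^ q =
      2 * volume.real (ball (0 : ℝ × ℝ) 1) / (2 - q) * ρ ^ (2 - q) := by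
    rw [integral_sub_left_eq_self (fun z => ballKer ρ z ^ q) volume x,
      integral_ballKer_rpow hq0 hq2 hρ]
    ring
  have e1 : (∫ y, ballKer ρ (x - y) ^ q) ^ (1 / q) = K * ρ ^ (2 / q - 1) := by
    rw [hkq, Real.mul_rpow (by positivity) (by positivity), ← hK, ← Real.rpow_mul hρ.le]
    congr 2
    field_simp
  have e2 : (∫ y, f y ^ p) ^ (1 / p) ≤ N := by
    refine (Real.rpow_le_rpow (integral_nonneg fun y => Real.rpow_nonneg (hf0 y) _) hNf
      (by positivity)).trans_eq ?_
    rw [← Real.rpow_mul hN.le, mul_one_div_cancel (by linarith), Real.rpow_one]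
  have e3 : N * ρ ^ (2 / q - 1) = N ^ (q / 2) * F ^ (1 - q / 2) := by
    rw [hρd, ← Real.rpow_mul (by positivity), Real.div_rpow hF0 hN.le,
      show q / 2 * (2 / q - 1) = 1 - q / 2 by field_simp, div_eq_mul_inv, ← Real.rpow_neg hN.le,
      mul_left_comm, mul_comm (F ^ _)]
    congr 1
    nth_rw 1 [← Real.rpow_one N]
    rw [← Real.rpow_add hN]
    congr 1
    ring
  have e4 : F * ρ⁻¹ = N ^ (q / 2) * F ^ (1 - q / 2) := by
    rw [hρd, ← Real.rpow_neg (by positivity), Real.div_rpow hF0 hN.le, Real.rpow_neg hN.le,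
      div_inv_eq_mul, mul_comm (N ^ _), ← mul_assoc, Real.rpow_sub hF, Real.rpow_neg hF0,
      Real.rpow_one, ← div_eq_mul_inv]
  calc ∫ y, f y * ‖x - y‖ ^ (-1 : ℝ)
      ≤ ∫ y, (f y * ballKer ρ (x - y) + f y * ρ⁻¹) := by
        refine integral_mono hi (hki.add (hfi.mul_const _)) fun y => ?_
        simp only
        rw [← mul_add]
        exact mul_le_mul_of_nonneg_left (norm_rpow_le_ballKer hρ _) (hf0 y)
    _ = (∫ y, f y * ballKer ρ (x - y)) + F * ρ⁻¹ := by
        rw [integral_add hki (hfi.mul_const _), integral_mul_const]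
    _ ≤ N * (K * ρ ^ (2 / q - 1)) + F * ρ⁻¹ := by
        refine add_le_add_left (hH.trans ?_) _
        rw [e1]
        exact mul_le_mul_of_nonneg_right e2 (by positivity)
    _ = _ := by
        rw [mul_left_comm, e3, e4]
        ring

end HalfPlane

namespace HalfPlane
open MeasureTheory Filter Set Metric Function Topology

variable {ω : ℝ → ℝ × ℝ → ℝ} {u : ℝ → ℝ × ℝ → ℝ × ℝ} {w : ℝ × ℝ → ℝ} {μ : Measure ℝ}

lemma IsProfile.integrable_rpow (hw : IsProfile w) {p : ℝ} (hp : 0 < p) :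
    Integrable fun x => w x ^ p :=
  (hw.cont.rpow_const fun _ => Or.inr hp.le).integrable_of_hasCompactSupport
    (hw.compactSupp.comp_left (g := fun r : ℝ => r ^ p) (Real.zero_rpow hp.ne'))

lemma IsEulerSol.integral_rpow_eq_initial (h : IsEulerSol ω u) (h0 : ∀ x, 0 ≤ ω 0 x) {p t : ℝ}
    (hp : 1 < p) (ht : 0 ≤ t) : ∫ x, ω t x ^ p = ∫ x, ω 0 x ^ p := by
  have := IsEulerSol.integral_comp_eq_initial h (contDiff_abs_rpow hp)
    (by simp [Real.zero_rpow (by linarith : p ≠ 0)]) ht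
  simpa only [abs_of_nonneg (h0 _), abs_of_nonneg (IsEulerSol.nonneg h h0 ht _)] using this

lemma IsEulerSol.vel_fst_le (h : IsEulerSol ω u) (h0 : ∀ x, 0 ≤ ω 0 x) {p C N : ℝ} (hp : 1 < p)
    (hC : IsPotentialConst p C) (hN : 0 < N) (hNp : ∫ x, ω 0 x ^ p ≤ N ^ p) {a b δ t : ℝ}
    (hδ : 0 < δ) (ht : 0 < t) {x : ℝ × ℝ} (hx : x ∈ Hplane) (hgx : trap a b δ (x.1 / t) ≠ 0) :
    (vel (ω t) x).1 ≤ C * N ^ ((p / (p - 1)) / 2) *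
      (∫ y : ℝ × ℝ, trap (a - 2 * δ) (b + 2 * δ) δ (y.1 / t) * ω t y) ^
        (1 - (p / (p - 1)) / 2) + (δ * t)⁻¹ * ∫ y, ω 0 y := by
  have hw := IsEulerSol.profile h t
  have hn := IsEulerSol.nonneg h h0 ht.le
  set η := trap (a - 2 * δ) (b + 2 * δ) δ with hη
  have hηc : Continuous η := continuous_trap _ _ _
  set f : ℝ × ℝ → ℝ := fun y => η (y.1 / t) * ω t y with hf
  have hwc : Continuous (ω t) := hw.cont
  have hfc : Continuous f := by
    have : Continuous fun y : ℝ × ℝ => η (y.1 / t) := by fun_prop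
    exact this.mul hwc
  have hfs : HasCompactSupport f := hw.compactSupp.mul_left
  have hf0 : ∀ y, 0 ≤ f y := fun y => mul_nonneg (trap_nonneg _ _ _ _) (hn y)
  have hfle : ∀ y, f y ≤ ω t y := fun y => mul_le_of_le_one_left (hn y) (trap_le_one hδ _)
  have hfp : IsProfile f :=
    ⟨hfc, hfs, (closure_mono (support_mul_subset_right _ _)).trans hw.suppIn⟩
  have hfN : ∫ y, f y ^ p ≤ N ^ p := by
    refine (integral_mono (hfp.integrable_rpow (by linarith)) (hw.integrable_rpow (by linarith))
      fun y => ?_).trans ((IsEulerSol.integral_rpow_eq_initial h h0 hp ht.le).trans_le hNp)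
    exact Real.rpow_le_rpow (hf0 y) (hfle y) (by linarith)
  obtain ⟨hfi, hfb⟩ := hC f hfc hfs hf0 N hN hfN x
  obtain ⟨W, hW⟩ := hw.exists_bound
  have hmem := mem_Ioo_of_trap_ne_zero hδ hgx
  have hpt : ∀ y, |ω t y| * ‖x - y‖ ^ (-1 : ℝ) ≤
      f y * ‖x - y‖ ^ (-1 : ℝ) + (δ * t)⁻¹ * ω t y := fun y => by
    rw [abs_of_nonneg (hn y)]
    by_cases hy : |x.1 - y.1| < δ * t
    · have h1 : |x.1 / t - y.1 / t| < δ := by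
        rw [← sub_div, abs_div, abs_of_pos ht, div_lt_iff₀ ht]; exact hy
      have h2 := abs_lt.1 h1
      have : η (y.1 / t) = 1 := trap_eq_one ⟨by linarith [hmem.1], by linarith [hmem.2]⟩
      have h3 : 0 ≤ (δ * t)⁻¹ * ω t y := mul_nonneg (by positivity) (hn y)
      simp only [hf, this, one_mul]
      linarith
    · have h1 : δ * t ≤ ‖x - y‖ := (not_lt.1 hy).trans (norm_fst_le (x - y))
      have h2 : ‖x - y‖ ^ (-1 : ℝ) ≤ (δ * t)⁻¹ := by
        rw [Real.rpow_neg_one]; exact inv_anti₀ (by positivity) h1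
      have h3 : 0 ≤ f y * ‖x - y‖ ^ (-1 : ℝ) := mul_nonneg (hf0 y) (by positivity)
      have h4 := mul_le_mul_of_nonneg_left h2 (hn y)
      linarith
  calc (vel (ω t) x).1 ≤ ‖vel (ω t) x‖ :=
        (Real.le_norm_self _).trans (norm_fst_le (vel (ω t) x))
    _ ≤ ∫ y, |ω t y| * ‖x - y‖ ^ (-1 : ℝ) := hw.norm_vel_le hx
    _ ≤ ∫ y, (f y * ‖x - y‖ ^ (-1 : ℝ) + (δ * t)⁻¹ * ω t y) :=
        integral_mono (integrable_mul_norm_rpow zero_le_one one_lt_two hw.integrable hW x).1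
          (hfi.add (hw.integrable.const_mul _)) hpt
    _ = (∫ y, f y * ‖x - y‖ ^ (-1 : ℝ)) + (δ * t)⁻¹ * ∫ y, ω 0 y := by
        rw [integral_add hfi (hw.integrable.const_mul _), integral_const_mul,
          IsEulerSol.integral_eq_initial h ht.le]
    _ ≤ _ := add_le_add_left hfb _

lemma IsEulerSol.mul_measureReal_Icc_le_of_pos [IsFiniteMeasure μ] (h : IsEulerSol ω u)
    (h0 : ∀ x, 0 ≤ ω 0 x) (hμ : HasLimitMeasure ω μ) {p C N : ℝ} (hp : 2 < p) (hC0 : 0 < C)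
    (hC : IsPotentialConst p C) (hN : 0 < N) (hNp : ∫ x, ω 0 x ^ p ≤ N ^ p) {a b δ : ℝ}
    (hδ : 0 < δ) (hδa : δ < a) :
    (a - δ) * μ.real (Icc a b) ≤ C * N ^ ((p / (p - 1)) / 2) *
      μ.real (Icc (a - 3 * δ) (b + 3 * δ)) ^ (1 - (p / (p - 1)) / 2) *
        μ.real (Icc (a - 3 * δ) (b + 3 * δ)) := by
  set γ := 1 - (p / (p - 1)) / 2 with hγ
  have hγ0 : 0 < γ := by
    have : p / (p - 1) < 2 := by rw [div_lt_iff₀ (by linarith)]; linarith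
    rw [hγ]; linarith
  set η := trap (a - 2 * δ) (b + 2 * δ) δ with hη
  have hbd : ∀ c d : ℝ, ∃ B, ∀ s, |trap c d δ s| ≤ B := fun c d =>
    ⟨1, fun s => by rw [abs_of_nonneg (trap_nonneg _ _ _ _)]; exact trap_le_one hδ s⟩
  have hlg := hμ _ (continuous_trap a b δ) (hbd a b)
  have hlη := hμ η (continuous_trap _ _ _) (hbd _ _)
  have hlim := ((((hlη.rpow_const (Or.inr hγ0.le)).const_mul
    (C * N ^ ((p / (p - 1)) / 2))).add (tendsto_inv_mul_mul hδ (∫ y, ω 0 y))).mul hlg)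
  have h1 := IsEulerSol.integral_id_mul_le h hμ (continuous_trap a b δ)
    (hasCompactSupport_trap hδ) hlim (by
      filter_upwards [eventually_gt_atTop 0] with t ht
      exact IsEulerSol.momentum_le h h0 (continuous_trap a b δ) (trap_nonneg a b δ) ht
        fun x hx hgx => IsEulerSol.vel_fst_le h h0 (by linarith) hC hN hNp hδ ht hx hgx)
  rw [add_zero] at h1
  have h2 : ∫ s, (a - δ) * trap a b δ s ∂μ ≤ ∫ s, s * trap a b δ s ∂μ := by
    refine integral_mono ((integrable_trap hδ).const_mul _) (integrable_id_mul_trap hδ)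
      fun s => ?_
    by_cases hs : trap a b δ s = 0
    · simp [hs]
    · exact mul_le_mul_of_nonneg_right (mem_Ioo_of_trap_ne_zero hδ hs).1.le (trap_nonneg _ _ _ _)
  rw [integral_const_mul] at h2
  have h3 := measureReal_le_integral_trap (μ := μ) (a := a) (b := b) hδ
  have h4 : ∫ s, η s ∂μ ≤ μ.real (Icc (a - 3 * δ) (b + 3 * δ)) := by
    have := integral_trap_le_measureReal (μ := μ) (a := a - 2 * δ) (b := b + 2 * δ) hδ
    convert this using 3 <;> ring
  have h5 : ∫ s, trap a b δ s ∂μ ≤ μ.real (Icc (a - 3 * δ) (b + 3 * δ)) :=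
    (integral_trap_le_measureReal (μ := μ) (a := a) (b := b) hδ).trans
      (measureReal_mono (Icc_subset_Icc (by linarith) (by linarith)))
  have h6 : 0 ≤ ∫ s, η s ∂μ := integral_nonneg fun s => trap_nonneg _ _ _ _
  have h7 : 0 ≤ ∫ s, trap a b δ s ∂μ := integral_nonneg fun s => trap_nonneg _ _ _ _
  calc (a - δ) * μ.real (Icc a b) ≤ (a - δ) * ∫ s, trap a b δ s ∂μ :=
        mul_le_mul_of_nonneg_left h3 (by linarith)
    _ ≤ _ := h2.trans h1
    _ ≤ _ := by gcongr

/-- Momentum bound for the limit measure on intervals. -/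
lemma IsEulerSol.mul_measureReal_Icc_le [IsFiniteMeasure μ] (h : IsEulerSol ω u)
    (h0 : ∀ x, 0 ≤ ω 0 x) (hμ : HasLimitMeasure ω μ) {p C N : ℝ} (hp : 2 < p) (hC0 : 0 < C)
    (hC : IsPotentialConst p C) (hN : 0 < N) (hNp : ∫ x, ω 0 x ^ p ≤ N ^ p) {a b : ℝ}
    (ha : 0 < a) :
    a * μ.real (Icc a b) ≤ C * N ^ ((p / (p - 1)) / 2) *
      μ.real (Icc a b) ^ (1 - (p / (p - 1)) / 2) * μ.real (Icc a b) := by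
  have hγ0 : 0 < 1 - (p / (p - 1)) / 2 := by
    have : p / (p - 1) < 2 := by rw [div_lt_iff₀ (by linarith)]; linarith
    linarith
  have hI : ⋂ δ > (0 : ℝ), Icc (a - 3 * δ) (b + 3 * δ) = Icc a b := by
    ext s
    simp only [mem_iInter, mem_Icc]
    refine ⟨fun hs => ⟨le_of_forall_pos_le_add fun ε hε => ?_,
      le_of_forall_pos_le_add fun ε hε => ?_⟩,
      fun hs δ hδ => ⟨by linarith [hs.1, show 0 < δ from hδ],
        by linarith [hs.2, show 0 < δ from hδ]⟩⟩
    · linarith [(hs (ε / 3) (by positivity)).1]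
    · linarith [(hs (ε / 3) (by positivity)).2]
  have hlim : Tendsto (fun δ : ℝ => μ.real (Icc (a - 3 * δ) (b + 3 * δ))) (𝓝[>] 0)
      (𝓝 (μ.real (Icc a b))) := by
    have := tendsto_measure_biInter_gt (μ := μ) (s := fun δ : ℝ => Icc (a - 3 * δ) (b + 3 * δ))
      (a := 0) (fun _ _ => measurableSet_Icc.nullMeasurableSet)
      (fun i j _ hij => Icc_subset_Icc (by linarith) (by linarith))
      ⟨1, one_pos, measure_ne_top _ _⟩
    rw [hI] at this
    exact (ENNReal.tendsto_toReal (measure_ne_top _ _)).comp this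
  have hl : Tendsto (fun δ : ℝ => (a - δ) * μ.real (Icc a b)) (𝓝[>] 0)
      (𝓝 (a * μ.real (Icc a b))) := by
    have : Tendsto (fun δ : ℝ => a - δ) (𝓝[>] 0) (𝓝 (a - 0)) :=
      (tendsto_const_nhds.sub tendsto_id).mono_left nhdsWithin_le_nhds
    simpa using this.mul_const (μ.real (Icc a b))
  refine le_of_tendsto_of_tendsto hl
    (((hlim.rpow_const (Or.inr hγ0.le)).const_mul _).mul hlim) ?_
  filter_upwards [Ioo_mem_nhdsGT ha] with δ hδ
  exact IsEulerSol.mul_measureReal_Icc_le_of_pos h h0 hμ hp hC0 hC hN hNp hδ.1 hδ.2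

end HalfPlane

namespace HalfPlane
open MeasureTheory Filter Set Metric Function Topology

variable {μ : Measure ℝ}

/-! ### Atomic structure of the limit measure -/

lemma exists_nhds_measure_zero [IsFiniteMeasure μ] {K γ : ℝ} (hγ : 0 < γ)
    (H : ∀ a b, 0 < a → a * μ.real (Icc a b) ≤ K * μ.real (Icc a b) ^ γ * μ.real (Icc a b))
    {s : ℝ} (hs : 0 < s) (hμs : μ {s} = 0) : ∃ U ∈ 𝓝 s, μ U = 0 := by
  have hI : ⋂ δ > (0 : ℝ), Icc (s - δ) (s + δ) = {s} := by
    ext r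
    simp only [mem_iInter, mem_Icc, mem_singleton_iff]
    refine ⟨fun hr => le_antisymm (le_of_forall_pos_le_add fun ε hε => (hr ε hε).2)
      (le_of_forall_pos_le_add fun ε hε => by linarith [(hr ε hε).1]), ?_⟩
    rintro rfl δ hδ
    exact ⟨by linarith [show 0 < δ from hδ], by linarith [show 0 < δ from hδ]⟩
  have hlim : Tendsto (fun δ : ℝ => μ.real (Icc (s - δ) (s + δ))) (𝓝[>] 0) (𝓝 0) := by
    have := tendsto_measure_biInter_gt (μ := μ) (s := fun δ : ℝ => Icc (s - δ) (s + δ))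
      (a := 0) (fun _ _ => measurableSet_Icc.nullMeasurableSet)
      (fun i j _ hij => Icc_subset_Icc (by linarith) (by linarith))
      ⟨1, one_pos, measure_ne_top _ _⟩
    rw [hI, hμs] at this
    exact (ENNReal.tendsto_toReal ENNReal.zero_ne_top).comp this
  have hlim' : Tendsto (fun δ : ℝ => K * μ.real (Icc (s - δ) (s + δ)) ^ γ) (𝓝[>] 0) (𝓝 0) := by
    simpa [Real.zero_rpow hγ.ne'] using (hlim.rpow_const (Or.inr hγ.le)).const_mul K
  obtain ⟨δ, hδ1, hδ⟩ := ((hlim'.eventually_lt_const (half_pos hs)).and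
    (Ioo_mem_nhdsGT (half_pos hs))).exists
  refine ⟨Icc (s - δ) (s + δ), Icc_mem_nhds (by linarith [hδ.1]) (by linarith [hδ.1]), ?_⟩
  by_contra hc
  have hpos : 0 < μ.real (Icc (s - δ) (s + δ)) :=
    measureReal_nonneg.lt_of_ne' fun h => hc ((measureReal_eq_zero_iff).1 h)
  have := le_of_mul_le_mul_right (H (s - δ) (s + δ) (by linarith [hδ.2])) hpos
  linarith [hδ.2]

lemma le_of_measure_singleton_ne_zero [IsFiniteMeasure μ] {K γ : ℝ}
    (H : ∀ a b, 0 < a → a * μ.real (Icc a b) ≤ K * μ.real (Icc a b) ^ γ * μ.real (Icc a b))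
    {s : ℝ} (hs : 0 < s) (hμs : μ {s} ≠ 0) : s ≤ K * μ.real {s} ^ γ := by
  have hpos : 0 < μ.real {s} :=
    measureReal_nonneg.lt_of_ne' fun h => hμs ((measureReal_eq_zero_iff).1 h)
  have := H s s hs
  rw [Icc_self] at this
  exact le_of_mul_le_mul_right this hpos

lemma finite_atoms [IsFiniteMeasure μ] {K γ : ℝ} (hK : 0 < K) (hγ : 0 < γ)
    (H : ∀ a b, 0 < a → a * μ.real (Icc a b) ≤ K * μ.real (Icc a b) ^ γ * μ.real (Icc a b))
    {a : ℝ} (ha : 0 < a) : {s | a ≤ s ∧ μ {s} ≠ 0}.Finite := by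
  have hε : 0 < ENNReal.ofReal ((a / K) ^ γ⁻¹) := ENNReal.ofReal_pos.2 (by positivity)
  refine (Measure.finite_const_le_meas_of_disjoint_iUnion μ hε (As := fun s : ℝ => {s})
    (fun s => measurableSet_singleton s) (fun s r hsr => by simpa using hsr)
    (measure_ne_top _ _)).subset fun s hs => ?_
  have h1 := le_of_measure_singleton_ne_zero H (ha.trans_le hs.1) hs.2
  have h2 : a / K ≤ μ.real {s} ^ γ := by
    rw [div_le_iff₀' hK]
    exact hs.1.trans h1
  have h3 : (a / K) ^ γ⁻¹ ≤ μ.real {s} := by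
    refine (Real.rpow_le_rpow (by positivity) h2 (by positivity)).trans_eq ?_
    rw [← Real.rpow_mul measureReal_nonneg, mul_inv_cancel₀ hγ.ne', Real.rpow_one]
  exact ENNReal.ofReal_le_of_le_toReal h3

lemma eq_sum_dirac_of_compl_range [IsFiniteMeasure μ] {α : ℕ → ℝ} (hα : Injective α)
    (h0 : μ (range α)ᶜ = 0) :
    μ = Measure.sum fun i => ENNReal.ofReal (μ.real {α i}) • Measure.dirac (α i) := by
  ext s hs
  rw [Measure.sum_apply _ hs]
  have h1 : μ s = μ (⋃ i, s ∩ {α i}) := by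
    rw [← inter_iUnion, iUnion_singleton_eq_range]
    exact (measure_inter_conull h0).symm
  rw [h1, measure_iUnion (fun i j hij => ?_) fun i => hs.inter (measurableSet_singleton _)]
  · refine tsum_congr fun i => ?_
    rw [Measure.smul_apply, Measure.dirac_apply' _ hs, ofReal_measureReal, smul_eq_mul]
    by_cases hi : α i ∈ s
    · simp [hi]
    · simp [hi]
  · exact (disjoint_singleton.2 (hα.ne hij)).mono inter_subset_right inter_subset_right

lemma exists_atomic_enumeration [IsFiniteMeasure μ] {K γ M : ℝ} (hK : 0 < K) (hγ : 0 < γ)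
    (H : ∀ a b, 0 < a → a * μ.real (Icc a b) ≤ K * μ.real (Icc a b) ^ γ * μ.real (Icc a b))
    (hM : 0 < M) (hneg : μ (Iio 0) = 0) (hbig : μ (Ioi M) = 0) :
    ∃ α : ℕ → ℝ, Injective α ∧ Tendsto α atTop (𝓝 0) ∧ (∀ i, α i ∈ Icc 0 M) ∧
      μ (range α)ᶜ = 0 := by
  set R : ℕ → ℝ := fun n => M / (n + 1) with hR
  have hRinj : Injective R := fun m n hmn => by
    have h1 : (0 : ℝ) < m + 1 := by positivity
    have h2 : (0 : ℝ) < n + 1 := by positivity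
    simp only [hR] at hmn
    rw [div_eq_div_iff h1.ne' h2.ne'] at hmn
    have := mul_left_cancel₀ hM.ne' hmn
    exact_mod_cast (by linarith : (m : ℝ) = n)
  have hRlim : Tendsto R atTop (𝓝 0) :=
    tendsto_const_nhds.div_atTop (tendsto_atTop_add_const_right _ _ tendsto_natCast_atTop_atTop)
  set A : Set ℝ := {0} ∪ {s | s ∈ Ioc 0 M ∧ μ {s} ≠ 0} ∪ range R with hA
  have hAM : A ⊆ Icc 0 M := by
    rintro s ((rfl | hs) | ⟨n, rfl⟩)
    · exact ⟨le_rfl, hM.le⟩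
    · exact ⟨hs.1.1.le, hs.1.2⟩
    · exact ⟨by positivity, div_le_self hM.le (by linarith [n.cast_nonneg (α := ℝ)])⟩
  have hfin : ∀ a, 0 < a → (A ∩ Ici a).Finite := fun a ha => by
    have hRfin : {n | a ≤ R n}.Finite := by
      have := hRlim.eventually_lt_const ha
      rw [← Nat.cofinite_eq_atTop, eventually_cofinite] at this
      simpa only [not_lt] using this
    refine ((finite_atoms hK hγ H ha).union (hRfin.image R)).subset ?_
    rintro s ⟨(hs | hs) | ⟨n, rfl⟩, hsa⟩
    · rw [mem_singleton_iff.1 hs] at hsa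
      exact absurd hsa (not_le.2 ha)
    · exact Or.inl ⟨hsa, hs.2⟩
    · exact Or.inr ⟨n, hsa, rfl⟩
  have hcount : A.Countable := by
    have : A ⊆ {0} ∪ ⋃ n : ℕ, A ∩ Ici (1 / (n + 1 : ℝ)) := fun s hs => by
      rcases (hAM hs).1.eq_or_lt with h | h
      · exact Or.inl h.symm
      · obtain ⟨n, hn⟩ := exists_nat_one_div_lt h
        exact Or.inr (mem_iUnion.2 ⟨n, hs, hn.le⟩)
    exact ((countable_singleton 0).union
      (countable_iUnion fun n => (hfin _ (by positivity)).countable)).mono this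
  have hinf : A.Infinite := (infinite_range_of_injective hRinj).mono subset_union_right
  have := hinf.to_subtype
  have := hcount.to_subtype
  obtain ⟨hden⟩ := nonempty_denumerable A
  have e : ℕ ≃ A := (Denumerable.eqv A).symm
  have hinj : Injective fun i => (e i : ℝ) := Subtype.val_injective.comp e.injective
  have hrange : range (fun i => (e i : ℝ)) = A := by
    ext s
    exact ⟨fun ⟨i, hi⟩ => hi ▸ (e i).2, fun hs => ⟨e.symm ⟨s, hs⟩, by simp⟩⟩
  refine ⟨fun i => e i, hinj, ?_, fun i => hAM (e i).2, ?_⟩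
  · refine tendsto_order.2 ⟨fun a ha => Eventually.of_forall fun i => ha.trans_le (hAM (e i).2).1,
      fun a ha => ?_⟩
    rw [← Nat.cofinite_eq_atTop, eventually_cofinite]
    refine ((hfin a ha).preimage hinj.injOn).subset fun i hi => ⟨(e i).2, not_lt.1 hi⟩
  · rw [hrange]
    have hloc : μ {s | 0 < s ∧ μ {s} = 0} = 0 :=
      measure_null_of_locally_null _ fun s hs => by
        obtain ⟨U, hU, hU0⟩ := exists_nhds_measure_zero hγ H hs.1 hs.2
        exact ⟨U, mem_nhdsWithin_of_mem_nhds hU, hU0⟩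
    refine measure_mono_null (fun s hs => ?_)
      (measure_union_null (measure_union_null hneg hbig) hloc)
    by_contra hc
    simp only [mem_union, mem_Iio, mem_Ioi, not_or, not_lt] at hc
    rcases hc.1.1.eq_or_lt with h | h
    · exact hs (Or.inl (Or.inl h.symm))
    · exact hs (Or.inl (Or.inr ⟨⟨h, hc.1.2⟩, fun h' => hc.2 ⟨h, h'⟩⟩))

end HalfPlane

namespace HalfPlane
open MeasureTheory Filter Set Metric Function Topology

variable {ω : ℝ → ℝ × ℝ → ℝ} {u : ℝ → ℝ × ℝ → ℝ × ℝ} {μ : Measure ℝ}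

lemma IsEulerSol.measure_compl_zero_ne_zero (h : IsEulerSol ω u) (h0 : ∀ x, 0 ≤ ω 0 x)
    (hne : ω 0 ≠ 0) (hμ : HasLimitMeasure ω μ) : μ {0}ᶜ ≠ 0 := fun hc => by
  obtain ⟨b, hb⟩ := IsEulerSol.exists_pos_le_integral h h0 hne hμ
  refine hb.ne' (integral_eq_zero_of_ae ?_)
  have : ∀ᵐ s ∂μ, s ∈ ({0} : Set ℝ) := mem_ae_iff.2 hc
  filter_upwards [this] with s hs
  simp [mem_singleton_iff.1 hs]

lemma IsEulerSol.measureReal_univ (h : IsEulerSol ω u) (hμ : HasLimitMeasure ω μ) :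
    μ.real univ = ∫ x, ω 0 x := by
  have h1 := hμ (fun _ => 1) continuous_const ⟨1, fun _ => by simp⟩
  simp only [one_mul, integral_const, smul_eq_mul, mul_one] at h1
  refine tendsto_nhds_unique h1 (tendsto_const_nhds.congr' ?_)
  filter_upwards [eventually_ge_atTop 0] with t ht
  exact (IsEulerSol.integral_eq_initial h ht).symm

lemma IsEulerSol.fst_le_sSup (h : IsEulerSol ω u) (h0 : ∀ x, 0 ≤ ω 0 x) :
    ∀ t, 0 ≤ t → ∀ x ∈ Hplane,
      (u t x).1 ≤ sSup {r : ℝ | ∃ t, 0 ≤ t ∧ ∃ x ∈ Hplane, r = nrm (u t x)} := by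
  obtain ⟨C, -, hC⟩ := IsEulerSol.exists_velocity_bound h h0
  have hbdd : BddAbove {r : ℝ | ∃ t, 0 ≤ t ∧ ∃ x ∈ Hplane, r = nrm (u t x)} := by
    refine ⟨2 * C, ?_⟩
    rintro r ⟨t, ht, x, hx, rfl⟩
    exact (nrm_le_two_mul_norm _).trans (by linarith [hC t ht x hx])
  exact fun t ht x hx => (le_abs_self _).trans
    ((abs_fst_le_nrm _).trans (le_csSup hbdd ⟨t, ht, x, hx, rfl⟩))

lemma tsum_measureReal_singleton [IsFiniteMeasure μ] {α : ℕ → ℝ} (hα : Injective α)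
    (h0 : μ (range α)ᶜ = 0) : ∑' i, μ.real {α i} = μ.real univ := by
  have h1 : μ univ = ∑' i, μ {α i} := by
    rw [← measure_iUnion (fun i j hij => disjoint_singleton.2 (hα.ne hij))
      fun i => measurableSet_singleton _, iUnion_singleton_eq_range]
    exact (measure_of_measure_compl_eq_zero h0).symm
  rw [measureReal_def, h1, ENNReal.tsum_toReal_eq fun i => measure_ne_top _ _]
  rfl

lemma IsProfile.integral_rpow_pos {w : ℝ × ℝ → ℝ} (hw : IsProfile w) (h0 : ∀ x, 0 ≤ w x)
    (hne : w ≠ 0) {p : ℝ} (hp : 0 < p) : 0 < ∫ x, w x ^ p := by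
  obtain ⟨x, hx⟩ := Function.ne_iff.1 hne
  exact (hw.cont.rpow_const fun _ => Or.inr hp.le).integral_pos_of_hasCompactSupport_nonneg_nonzero
    (hw.compactSupp.comp_left (g := fun r : ℝ => r ^ p) (Real.zero_rpow hp.ne'))
    (fun y => Real.rpow_nonneg (h0 y) p)
    (Real.rpow_pos_of_pos ((h0 x).lt_of_ne' hx) p).ne'

end HalfPlane

open HalfPlane

/-- Theorem 3.8 (main theorem): if the rescaled vorticity `ω̃(t,·)` converges
weak-* as `t → ∞` to `μ ⊗ δ₀` for a single finite nonnegative measure `μ`,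
then `μ = Σ_{i=1}^∞ m_i δ_{α_i}` where the `α_i` are distinct and tend to `0`,
the `m_i ≥ 0` sum to `‖ω₀‖_{L¹}`, each `α_i ∈ [0, M]` with
`M = ‖u‖_{L^∞([0,∞)×ℍ)}`, each atom with `m_i ≠ 0` satisfies
`α_i ≤ D ‖ω₀‖_{Lᵖ}^{p'/2} m_i^{1-p'/2}` with `D = D(p) > 0`, and some
`i₀` has `α_{i₀} ≠ 0` and `m_{i₀} ≠ 0`. -/
theorem stmt_17 (p : ℝ) (hp : 2 < p) :
    ∃ D : ℝ, 0 < D ∧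
      ∀ (ω : ℝ → ℝ × ℝ → ℝ) (u : ℝ → ℝ × ℝ → ℝ × ℝ),
        IsEulerSol ω u → (∀ x, 0 ≤ ω 0 x) → ω 0 ≠ 0 →
        ∀ μ : Measure ℝ, IsFiniteMeasure μ →
          (∀ φ : ℝ × ℝ → ℝ, Continuous φ → (∃ B, ∀ z, |φ z| ≤ B) →
            Tendsto (fun t : ℝ => ∫ y in Hplane, φ y * rescVort ω t y) atTop
              (nhds (∫ s, φ (s, 0) ∂μ))) →
          ∃ (α : ℕ → ℝ) (m : ℕ → ℝ),
            μ = Measure.sum (fun i => ENNReal.ofReal (m i) • Measure.dirac (α i)) ∧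
            (∀ i j, i ≠ j → α i ≠ α j) ∧
            Tendsto α atTop (nhds 0) ∧
            (∀ i, 0 ≤ m i) ∧
            (∑' i, m i) = ∫ y in Hplane, ω 0 y ∧
            (∀ i, α i ∈ Set.Icc 0
              (sSup {r : ℝ | ∃ t, 0 ≤ t ∧ ∃ x ∈ Hplane, r = nrm (u t x)})) ∧
            (∀ i, m i ≠ 0 →
              α i ≤ D * ((∫ y in Hplane, ω 0 y ^ p) ^ (1 / p)) ^ ((p / (p - 1)) / 2) *
                m i ^ (1 - (p / (p - 1)) / 2)) ∧
            (∃ i₀, α i₀ ≠ 0 ∧ m i₀ ≠ 0) := by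
  have hp0 : 0 < p := by linarith
  have hγ : 0 < 1 - (p / (p - 1)) / 2 := by
    have : p / (p - 1) < 2 := by rw [div_lt_iff₀ (by linarith)]; linarith
    linarith
  obtain ⟨C, hC0, hC⟩ := exists_potential_bound hp
  refine ⟨C, hC0, fun ω u h h0 hne μ hfin hconv => ?_⟩
  have hμ := IsEulerSol.hasLimitMeasure h hconv
  have hw := IsEulerSol.profile h 0
  have hI1 : ∫ y in Hplane, ω 0 y = ∫ y, ω 0 y := setIntegral_Hplane fun x hx => hw.eq_zero hx
  have hIp : ∫ y in Hplane, ω 0 y ^ p = ∫ y, ω 0 y ^ p :=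
    setIntegral_Hplane fun x hx => by rw [hw.eq_zero hx, Real.zero_rpow hp0.ne']
  rw [hI1, hIp]
  set N := (∫ y, ω 0 y ^ p) ^ (1 / p) with hN
  have hIpos := hw.integral_rpow_pos h0 hne hp0
  have hN0 : 0 < N := Real.rpow_pos_of_pos hIpos _
  have hNp : ∫ y, ω 0 y ^ p ≤ N ^ p := by
    rw [hN, ← Real.rpow_mul hIpos.le, one_div_mul_cancel hp0.ne', Real.rpow_one]
  set M := sSup {r : ℝ | ∃ t, 0 ≤ t ∧ ∃ x ∈ Hplane, r = nrm (u t x)} with hM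
  have hbig : μ (Set.Ioi M) = 0 := IsEulerSol.measure_Ioi h h0 hμ (IsEulerSol.fst_le_sSup h h0)
  have hneg := IsEulerSol.measure_Iio_zero h h0 hμ
  have hM0 : 0 < M := by
    by_contra! hc
    refine IsEulerSol.measure_compl_zero_ne_zero h h0 hne hμ
      (measure_mono_null (fun s hs => ?_) (measure_union_null hneg hbig))
    exact (lt_or_gt_of_ne hs).imp id fun hs' => hc.trans_lt hs'
  have H : ∀ a b, 0 < a → a * μ.real (Set.Icc a b) ≤ C * N ^ ((p / (p - 1)) / 2) *
      μ.real (Set.Icc a b) ^ (1 - (p / (p - 1)) / 2) * μ.real (Set.Icc a b) :=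
    fun a b ha => IsEulerSol.mul_measureReal_Icc_le h h0 hμ hp hC0 hC hN0 hNp ha
  have hK : 0 < C * N ^ ((p / (p - 1)) / 2) := by positivity
  obtain ⟨α, hinj, hlim, hαM, hnull⟩ := exists_atomic_enumeration hK hγ H hM0 hneg hbig
  refine ⟨α, fun i => μ.real {α i}, eq_sum_dirac_of_compl_range hinj hnull,
    fun i j hij => hinj.ne hij, hlim, fun i => measureReal_nonneg, ?_, hαM, fun i hi => ?_, ?_⟩
  · rw [tsum_measureReal_singleton hinj hnull, IsEulerSol.measureReal_univ h hμ]
  · rcases (hαM i).1.eq_or_lt with h1 | h1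
    · rw [← h1]
      positivity
    · exact le_of_measure_singleton_ne_zero H h1 fun hz => hi (by simp [measureReal_def, hz])
  · by_contra! hc
    refine IsEulerSol.measure_compl_zero_ne_zero h h0 hne hμ (measure_mono_null (fun s hs => ?_)
      (measure_union_null hnull (measure_iUnion_null
        (s := fun i => {α i} \ {0}) fun i => ?_)))
    · by_cases hr : s ∈ Set.range α
      · obtain ⟨i, rfl⟩ := hr
        exact Or.inr (Set.mem_iUnion.2 ⟨i, rfl, hs⟩)
      · exact Or.inl hr
    · by_cases hi : α i = 0
      · simp [hi]
      · exact measure_mono_null Set.sdiff_subset ((measureReal_eq_zero_iff).1 (hc i hi))
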